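/- arXiv:1609.05397 — 5 statements merged into one kernel-verified Lean document; each statement's English description precedes it below -/
import Mathlib

section
/- There exist δ₀ > 0 and C > 0 such that for every δ ∈ (0, δ₀] there is a twice continuously differentiable function ψ : [0,∞) → ℝ with ψ(0) = 0 and ψ(z) → 0 as z → ∞, solving on (0,∞) the ODE (1 − δ + ψ)ψ'' + (ψ')² + (z/2)ψ' = −2ψ'e_δ' − (e_δ')² − ψ e_δ'' − e_δ ψ'' − e_δ e_δ'', and satisfying the weighted bound ∫₀^∞ [ |ψ''(z)|² + (1 + z²)(|ψ(z)|² + |ψ'(z)|²) ] dz ≤ C δ². Moreover ψ is unique among C² functions with these boundary conditions that solve this ODE and satisfy this weighted bound. -/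
open Real MeasureTheory
open scoped ENNReal

/-- The Gaussian front profile `e_δ(z) = (δ/√π) ∫₀^z e^{-t²/4} dt`. -/
noncomputable def eDelta (δ : ℝ) (z : ℝ) : ℝ :=
  (δ / Real.sqrt Real.pi) * ∫ t in (0:ℝ)..z, Real.exp (-t^2/4)

/-- `ψ` is a C² solution on `[0,∞)` of the front-remainder ODE with the stated
boundary conditions. -/
def IsFrontRemainder (δ : ℝ) (ψ : ℝ → ℝ) : Prop :=
  ContDiffOn ℝ 2 ψ (Set.Ici 0) ∧ ψ 0 = 0 ∧ Filter.Tendsto ψ Filter.atTop (nhds 0) ∧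
  ∀ z : ℝ, 0 < z →
    (1 - δ + ψ z) * deriv (deriv ψ) z + (deriv ψ z)^2 + (z/2) * deriv ψ z =
      -2 * deriv ψ z * deriv (eDelta δ) z - (deriv (eDelta δ) z)^2
        - ψ z * deriv (deriv (eDelta δ)) z - eDelta δ z * deriv (deriv ψ) z
        - eDelta δ z * deriv (deriv (eDelta δ)) z

/-- The squared weighted `H²` norm `∫₀^∞ |ψ''|² + (1+z²)(|ψ|² + |ψ'|²) dz`. -/
noncomputable def weightedH2 (ψ : ℝ → ℝ) : ℝ≥0∞ :=
  ∫⁻ z in Set.Ioi (0:ℝ),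
    ENNReal.ofReal ((deriv (deriv ψ) z)^2 + (1 + z^2) * ((ψ z)^2 + (deriv ψ z)^2))


/-! ### The profile `eDelta` -/

lemma eD_hasDeriv (δ z : ℝ) :
    HasDerivAt (eDelta δ) (δ / √π * exp (-z^2/4)) z := by
  have hc : Continuous (fun t : ℝ => exp (-t^2/4)) := by fun_prop
  exact (hc.integral_hasStrictDerivAt 0 z).hasDerivAt.const_mul _

lemma eD_deriv (δ : ℝ) : deriv (eDelta δ) = fun z => δ / √π * exp (-z^2/4) :=
  funext fun z => (eD_hasDeriv δ z).deriv

lemma eD_hasDeriv2 (δ z : ℝ) :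
    HasDerivAt (fun z => δ / √π * exp (-z^2/4)) (-(z/2) * (δ / √π * exp (-z^2/4))) z := by
  have h1 : HasDerivAt (fun z : ℝ => -z^2/4) (-(z/2)) z := by
    have := ((hasDerivAt_pow 2 z).neg).div_const 4
    refine this.congr_deriv ?_
    norm_num; ring
  refine (h1.exp.const_mul (δ / √π)).congr_deriv ?_
  ring

lemma eD_deriv2 (δ z : ℝ) :
    deriv (deriv (eDelta δ)) z = -(z/2) * (δ / √π * exp (-z^2/4)) := by
  rw [eD_deriv]; exact (eD_hasDeriv2 δ z).deriv

lemma one_le_sqrt_pi : 1 ≤ √π := by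
  rw [Real.one_le_sqrt]; linarith [Real.pi_gt_three]

lemma eD_tendsto (δ : ℝ) : Filter.Tendsto (eDelta δ) Filter.atTop (nhds δ) := by
  have hi : IntegrableOn (fun t : ℝ => exp (-t^2/4)) (Set.Ioi 0) := by
    have := (integrable_exp_neg_mul_sq (b := 1/4) (by norm_num)).integrableOn (s := Set.Ioi 0)
    refine this.congr_fun (fun t _ => ?_) measurableSet_Ioi
    simp only; congr 1; ring
  have h := intervalIntegral_tendsto_integral_Ioi 0 hi Filter.tendsto_id
  have hv : ∫ t in Set.Ioi (0:ℝ), exp (-t^2/4) = √π := by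
    have := integral_gaussian_Ioi (1/4)
    have h2 : ∀ t : ℝ, exp (-t^2/4) = exp (-(1/4) * t^2) := fun t => by congr 1; ring
    simp_rw [h2]
    rw [this, show π / (1/4) = 2^2 * π by ring, Real.sqrt_mul (by norm_num),
      Real.sqrt_sq (by norm_num)]
    ring
  rw [hv] at h
  have := h.const_mul (δ / √π)
  rw [div_mul_cancel₀ _ (by positivity)] at this
  exact this

lemma eD_nonneg {δ z : ℝ} (hδ : 0 < δ) (hz : 0 ≤ z) : 0 ≤ eDelta δ z := by
  unfold eDelta
  have : 0 ≤ ∫ t in (0:ℝ)..z, exp (-t^2/4) :=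
    intervalIntegral.integral_nonneg hz (fun _ _ => (exp_pos _).le)
  positivity

lemma eD_le {δ : ℝ} (hδ : 0 < δ) (z : ℝ) : eDelta δ z ≤ δ := by
  have hm : Monotone (eDelta δ) := by
    refine monotone_of_deriv_nonneg (fun z => (eD_hasDeriv δ z).differentiableAt) (fun z => ?_)
    rw [eD_deriv]; positivity
  exact hm.ge_of_tendsto (eD_tendsto δ) z

lemma eD_contDiff (δ : ℝ) : ContDiff ℝ 2 (eDelta δ) := by
  have : (2 : WithTop ℕ∞) = 1 + 1 := by norm_num
  rw [this, contDiff_succ_iff_deriv]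
  refine ⟨fun z => (eD_hasDeriv δ z).differentiableAt, by simp, ?_⟩
  rw [eD_deriv]; fun_prop

lemma eD_d_bound {δ : ℝ} (hδ : 0 < δ) (z : ℝ) :
    0 ≤ δ / √π * exp (-z^2/4) ∧ δ / √π * exp (-z^2/4) ≤ δ * exp (-z^2/4) := by
  refine ⟨by positivity, ?_⟩
  gcongr
  exact div_le_self hδ.le one_le_sqrt_pi

/-! ### Uniqueness -/

lemma hasDeriv_min_sq (x : ℝ) : HasDerivAt (fun x : ℝ => (min x 0)^2) (2 * min x 0) x := by
  rcases lt_trichotomy x 0 with h | h | h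
  · have : (fun x : ℝ => x^2) =ᶠ[nhds x] (fun x : ℝ => (min x 0)^2) := by
      filter_upwards [Iio_mem_nhds h] with y hy
      rw [min_eq_left (le_of_lt hy)]
    rw [min_eq_left h.le]
    refine HasDerivAt.congr_of_eventuallyEq ?_ this.symm
    simpa using hasDerivAt_pow 2 x
  · subst h
    rw [hasDerivAt_iff_isLittleO_nhds_zero]
    simp only [zero_add, min_self, ne_eq, OfNat.ofNat_ne_zero, not_false_eq_true, zero_pow, sub_zero,
      mul_zero, smul_zero]
    have h1 : (fun h : ℝ => (min h 0)^2) =O[nhds 0] (fun h : ℝ => h^2) := by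
      refine Asymptotics.IsBigO.of_bound 1 (Filter.Eventually.of_forall fun h => ?_)
      simp only [norm_pow, one_mul]
      gcongr
      rcases le_total h 0 with h' | h'
      · rw [min_eq_left h']
      · rw [min_eq_right h']; simp
    refine h1.trans_isLittleO ?_
    exact Asymptotics.isLittleO_pow_id (by norm_num)
  · have : (fun x : ℝ => (0:ℝ)) =ᶠ[nhds x] (fun x : ℝ => (min x 0)^2) := by
      filter_upwards [Ioi_mem_nhds h] with y hy
      rw [min_eq_right (le_of_lt hy)]; simp
    rw [min_eq_right h.le]
    refine HasDerivAt.congr_of_eventuallyEq ?_ this.symm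
    simpa using hasDerivAt_const x (0:ℝ)

/-- positivity is propagated by the first order system -/
lemma system_nonneg (D G v : ℝ → ℝ) (hDc : ContinuousOn D (Set.Ici 0))
    (hGc : ContinuousOn G (Set.Ici 0))
    (hD : ∀ z, 0 < z → HasDerivAt D (G z - z/2 * v z) z)
    (hG : ∀ z, 0 < z → HasDerivAt G (v z / 2) z)
    (hs : ∀ z, 0 ≤ z → (0 ≤ D z → 0 ≤ v z) ∧ (D z ≤ 0 → v z ≤ 0 ∧ 2 * D z ≤ v z))
    (hD0 : D 0 = 0) (hG0 : 0 ≤ G 0) :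
    ∀ z, 0 ≤ z → 0 ≤ D z ∧ G 0 ≤ G z := by
  have key : ∀ z, 0 ≤ z → 0 ≤ D z := by
    set y : ℝ → ℝ := fun z => ((min (D z) 0)^2 + (min (G z) 0)^2) * exp (-2 * z) with hy
    have hyd : ∀ z, 0 < z → HasDerivAt y
        ((2 * min (D z) 0 * (G z - z/2 * v z) + 2 * min (G z) 0 * (v z / 2)) * exp (-2*z)
          + ((min (D z) 0)^2 + (min (G z) 0)^2) * (exp (-2 * z) * (-2 * 1))) z := by
      intro z hz
      have h1 := (hasDeriv_min_sq (D z)).comp z (hD z hz)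
      have h2 := (hasDeriv_min_sq (G z)).comp z (hG z hz)
      have h3 := ((hasDerivAt_id z).const_mul (-2)).exp
      exact (h1.add h2).mul h3
    have hanti : AntitoneOn y (Set.Ici 0) := by
      refine antitoneOn_of_deriv_nonpos (convex_Ici 0) ?_ ?_ ?_
      · have a1 : ContinuousOn (fun z => min (D z) 0) (Set.Ici 0) := hDc.inf continuousOn_const
        have a2 : ContinuousOn (fun z => min (G z) 0) (Set.Ici 0) := hGc.inf continuousOn_const
        exact ((a1.pow 2).add (a2.pow 2)).mul (by fun_prop)
      · intro z hz
        rw [interior_Ici] at hz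
        exact (hyd z hz).differentiableAt.differentiableWithinAt
      · intro z hz
        rw [interior_Ici] at hz
        have hz' : 0 < z := hz
        rw [(hyd z hz).deriv]
        have : (2 * min (D z) 0 * (G z - z/2 * v z) + 2 * min (G z) 0 * (v z / 2))
            - 2 * ((min (D z) 0)^2 + (min (G z) 0)^2) ≤ 0 := by
          obtain ⟨s1, s2⟩ := hs z hz'.le
          rcases le_total (D z) 0 with hd | hd
          · obtain ⟨s3, s4⟩ := s2 hd
            rw [min_eq_left hd]
            rcases le_total (G z) 0 with hg | hg
            · rw [min_eq_left hg]
              nlinarith [mul_nonneg hz'.le (mul_nonneg_of_nonpos_of_nonpos hd s3),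
                sq_nonneg (D z - G z), mul_nonneg_of_nonpos_of_nonpos hg s3,
                mul_nonneg (neg_nonneg.2 hg) (sub_nonneg.2 s4)]
            · rw [min_eq_right hg]
              nlinarith [mul_nonneg hz'.le (mul_nonneg_of_nonpos_of_nonpos hd s3),
                sq_nonneg (D z), mul_nonneg (neg_nonneg.2 hd) hg]
          · rw [min_eq_right hd]
            have s3 := s1 hd
            rcases le_total (G z) 0 with hg | hg
            · rw [min_eq_left hg]
              nlinarith [mul_nonneg (neg_nonneg.2 hg) s3, sq_nonneg (G z)]
            · rw [min_eq_right hg]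
              simp
        nlinarith [exp_pos (-2*z)]
    intro z hz
    have h1 := hanti (Set.mem_Ici.2 le_rfl) (Set.mem_Ici.2 hz) hz
    have h0 : y 0 = 0 := by simp [hy, hD0, hG0]
    rw [h0] at h1
    have h2 : (min (D z) 0)^2 ≤ 0 := by
      by_contra hcon
      push Not at hcon
      have : 0 < y z := by
        simp only [hy]
        have := sq_nonneg (min (G z) 0)
        positivity
      linarith
    have h3 : min (D z) 0 = 0 := by
      have := le_antisymm h2 (sq_nonneg _)
      exact pow_eq_zero_iff (by norm_num) |>.1 this
    exact min_eq_right_iff.1 h3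
  intro z hz
  refine ⟨key z hz, ?_⟩
  have hmono : MonotoneOn G (Set.Ici 0) := by
    refine monotoneOn_of_deriv_nonneg (convex_Ici 0) hGc ?_ ?_
    · intro z hz
      rw [interior_Ici] at hz
      exact (hG z hz).differentiableAt.differentiableWithinAt
    · intro z hz
      rw [interior_Ici] at hz
      have hz' : (0:ℝ) < z := hz
      rw [(hG z hz).deriv]
      have := (hs z hz'.le).1 (key z hz'.le)
      linarith
  exact hmono (Set.mem_Ici.2 le_rfl) (Set.mem_Ici.2 hz) hz

lemma sol_data (ψ : ℝ → ℝ) (h : ContDiffOn ℝ 2 ψ (Set.Ici 0)) :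
    ∃ g : ℝ → ℝ, ContinuousOn g (Set.Ici 0) ∧ (∀ z, 0 < z → deriv ψ z = g z) ∧
      (∀ z, 0 < z → HasDerivAt ψ (g z) z) ∧
      (∀ z, 0 < z → HasDerivAt g (deriv (deriv ψ) z) z) := by
  have hu : UniqueDiffOn ℝ (Set.Ici (0:ℝ)) := uniqueDiffOn_Ici 0
  have h2 : (2 : WithTop ℕ∞) = 1 + 1 := by norm_num
  have h' := h
  rw [h2, contDiffOn_succ_iff_derivWithin hu] at h'
  obtain ⟨hd, -, hg⟩ := h'
  have he : ∀ z, 0 < z → deriv ψ z = derivWithin ψ (Set.Ici 0) z := fun z hz =>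
    (derivWithin_of_mem_nhds (Ici_mem_nhds hz)).symm
  refine ⟨derivWithin ψ (Set.Ici 0), hg.continuousOn, he, ?_, ?_⟩
  · intro z hz
    rw [← he z hz]
    exact (hd.differentiableAt (Ici_mem_nhds hz)).hasDerivAt
  · intro z hz
    have h1 : DifferentiableAt ℝ (derivWithin ψ (Set.Ici 0)) z :=
      (hg.differentiableOn (by norm_num)).differentiableAt (Ici_mem_nhds hz)
    have h3 : deriv ψ =ᶠ[nhds z] derivWithin ψ (Set.Ici 0) := by
      filter_upwards [Ioi_mem_nhds hz] with y hy
      exact he y hy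
    rw [h3.deriv_eq]
    exact h1.hasDerivAt

lemma sup_bound (ψ : ℝ → ℝ) (h : ContDiffOn ℝ 2 ψ (Set.Ici 0)) (h0 : ψ 0 = 0) {B : ℝ}
    (hB : 0 ≤ B) (hw : weightedH2 ψ ≤ ENNReal.ofReal B) (z : ℝ) (hz : 0 ≤ z) : (ψ z)^2 ≤ B := by
  obtain ⟨g, hgc, hg1, hg2, -⟩ := sol_data ψ h
  have hψc := h.continuousOn
  have hsub : Set.uIcc 0 z ⊆ Set.Ici 0 := by
    rw [Set.uIcc_of_le hz]; exact Set.Icc_subset_Ici_self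
  have hic : ContinuousOn (fun t => (ψ t)^2 + (g t)^2) (Set.uIcc 0 z) :=
    ((hψc.pow 2).add (hgc.pow 2)).mono hsub
  have hic2 : ContinuousOn (fun t => 2 * ψ t * g t) (Set.uIcc 0 z) :=
    ((continuousOn_const.mul hψc).mul hgc).mono hsub
  have hftc : ∫ t in (0:ℝ)..z, 2 * ψ t * g t = (ψ z)^2 - (ψ 0)^2 := by
    refine intervalIntegral.integral_eq_sub_of_hasDerivAt_of_le hz
      ((hψc.pow 2).mono Set.Icc_subset_Ici_self) ?_ hic2.intervalIntegrable
    intro t ht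
    have := (hg2 t ht.1).pow 2
    refine this.congr_deriv ?_
    norm_num
  have h1 : (ψ z)^2 ≤ ∫ t in (0:ℝ)..z, ((ψ t)^2 + (g t)^2) := by
    have : (ψ z)^2 = ∫ t in (0:ℝ)..z, 2 * ψ t * g t := by rw [hftc, h0]; ring
    rw [this]
    refine intervalIntegral.integral_mono_on hz hic2.intervalIntegrable hic.intervalIntegrable ?_
    intro t _
    nlinarith [sq_nonneg (ψ t - g t)]
  have h2 : ENNReal.ofReal (∫ t in (0:ℝ)..z, ((ψ t)^2 + (g t)^2)) ≤ weightedH2 ψ := by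
    rw [intervalIntegral.integral_of_le hz, ofReal_integral_eq_lintegral_ofReal]
    · unfold weightedH2
      refine le_trans (setLIntegral_mono_ae' measurableSet_Ioc (Filter.Eventually.of_forall ?_))
        (lintegral_mono_set (Set.Ioc_subset_Ioi_self))
      intro t ht
      refine ENNReal.ofReal_le_ofReal ?_
      rw [hg1 t ht.1]
      nlinarith [sq_nonneg (deriv (deriv ψ) t), mul_nonneg (sq_nonneg t)
        (add_nonneg (sq_nonneg (ψ t)) (sq_nonneg (g t)))]
    · exact (intervalIntegrable_iff_integrableOn_Ioc_of_le hz).1 hic.intervalIntegrable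
    · exact Filter.Eventually.of_forall fun t => add_nonneg (sq_nonneg _) (sq_nonneg _)
  have h3 := (ENNReal.ofReal_le_ofReal_iff hB).1 (h2.trans hw)
  linarith

lemma wH2_aemeas (ψ : ℝ → ℝ) (h : ContinuousOn ψ (Set.Ici 0)) :
    AEMeasurable (fun z => ENNReal.ofReal ((deriv (deriv ψ) z)^2
      + (1 + z^2) * ((ψ z)^2 + (deriv ψ z)^2))) (volume.restrict (Set.Ioi 0)) := by
  have h1 : AEMeasurable ψ (volume.restrict (Set.Ioi 0)) :=
    (h.mono Set.Ioi_subset_Ici_self).aemeasurable measurableSet_Ioi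
  have h2 : Measurable (deriv ψ) := measurable_deriv ψ
  have h3 : Measurable (deriv (deriv ψ)) := measurable_deriv _
  have h4 : AEMeasurable (fun z : ℝ => 1 + z^2) (volume.restrict (Set.Ioi 0)) :=
    (by fun_prop : Measurable (fun z : ℝ => 1 + z^2)).aemeasurable
  exact ((h3.pow_const 2).aemeasurable.add (h4.mul ((h1.pow_const 2).add
    (h2.pow_const 2).aemeasurable))).ennreal_ofReal

lemma alg_G {a b E z g k f c s t : ℝ} (ha0 : 0 ≤ a) (ha : a ≤ 2) (hb0 : 0 ≤ b) (hb : b ≤ 2)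
    (hE0 : 0 ≤ E) (hE : E ≤ 1) :
    (a * g - b * k + E * (f - c) + z/2 * (f - c))^2 / 40 ≤
      s^2 + (1 + z^2) * (f^2 + g^2) + (t^2 + (1 + z^2) * (c^2 + k^2)) := by
  have four : ∀ x y s t : ℝ, (x - y + s + t)^2 ≤ 4 * (x^2 + y^2 + s^2 + t^2) := by
    intro x y s t
    linarith [sq_nonneg (x + y), sq_nonneg (x - s), sq_nonneg (x - t), sq_nonneg (y + s),
      sq_nonneg (y + t), sq_nonneg (s - t)]
  have h5 := four (a * g) (b * k) (E * (f - c)) (z/2 * (f - c))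
  have sqa : a^2 ≤ 4 := by
    have := pow_le_pow_left₀ ha0 ha 2
    linarith
  have sqb : b^2 ≤ 4 := by
    have := pow_le_pow_left₀ hb0 hb 2
    linarith
  have sqE : E^2 ≤ 1 := by
    have := pow_le_pow_left₀ hE0 hE 2
    linarith
  have t1 : (a * g)^2 ≤ 4 * g^2 := by
    rw [mul_pow]; exact mul_le_mul_of_nonneg_right sqa (sq_nonneg _)
  have t2 : (b * k)^2 ≤ 4 * k^2 := by
    rw [mul_pow]; exact mul_le_mul_of_nonneg_right sqb (sq_nonneg _)
  have t3 : (E * (f - c))^2 ≤ 1 * (f - c)^2 := by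
    rw [mul_pow]; exact mul_le_mul_of_nonneg_right sqE (sq_nonneg _)
  have hvv : (f - c)^2 ≤ 2 * (f^2 + c^2) := by linarith [sq_nonneg (f + c)]
  have t5 : z^2 * (f - c)^2 ≤ z^2 * (2 * (f^2 + c^2)) :=
    mul_le_mul_of_nonneg_left hvv (sq_nonneg _)
  linarith [sq_nonneg s, sq_nonneg t, mul_nonneg (sq_nonneg z) (sq_nonneg g),
    mul_nonneg (sq_nonneg z) (sq_nonneg k), mul_nonneg (sq_nonneg z) (sq_nonneg f),
    mul_nonneg (sq_nonneg z) (sq_nonneg c), sq_nonneg g, sq_nonneg k, sq_nonneg f, sq_nonneg c]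

set_option maxHeartbeats 1000000 in
lemma uniq_half {δ B : ℝ} (hδ : 0 < δ) (hδ1 : δ ≤ 1/4) (hB : 0 ≤ B) (hB1 : B ≤ 1/16)
    (φ χ : ℝ → ℝ) (hφ : IsFrontRemainder δ φ) (hχ : IsFrontRemainder δ χ)
    (hφw : weightedH2 φ ≤ ENNReal.ofReal B) (hχw : weightedH2 χ ≤ ENNReal.ofReal B)
    (g k : ℝ → ℝ) (hgc : ContinuousOn g (Set.Ici 0)) (hg1 : ∀ z, 0 < z → deriv φ z = g z)
    (hg2 : ∀ z, 0 < z → HasDerivAt φ (g z) z)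
    (hg3 : ∀ z, 0 < z → HasDerivAt g (deriv (deriv φ) z) z)
    (hkc : ContinuousOn k (Set.Ici 0)) (hk1 : ∀ z, 0 < z → deriv χ z = k z)
    (hk2 : ∀ z, 0 < z → HasDerivAt χ (k z) z)
    (hk3 : ∀ z, 0 < z → HasDerivAt k (deriv (deriv χ) z) z)
    (h00 : k 0 ≤ g 0) : g 0 = k 0 ∧ ∀ z, 0 ≤ z → χ z ≤ φ z := by
  obtain ⟨hφs, hφ0, -, hφe⟩ := hφ
  obtain ⟨hχs, hχ0, -, hχe⟩ := hχ
  have bφ : ∀ z, 0 ≤ z → |φ z| ≤ 1/4 := fun z hz =>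
    abs_le_of_sq_le_sq (by linarith [sup_bound φ hφs hφ0 hB hφw z hz]) (by norm_num)
  have bχ : ∀ z, 0 ≤ z → |χ z| ≤ 1/4 := fun z hz =>
    abs_le_of_sq_le_sq (by linarith [sup_bound χ hχs hχ0 hB hχw z hz]) (by norm_num)
  set e := eDelta δ with he
  set e' : ℝ → ℝ := fun z => δ / √π * exp (-z^2/4) with he'
  have hed : ∀ z, HasDerivAt e (e' z) z := eD_hasDeriv δ
  have hed2 : ∀ z, HasDerivAt e' (-(z/2) * e' z) z := eD_hasDeriv2 δ
  have hec : Continuous e := (eD_contDiff δ).continuous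
  have hec' : Continuous e' := by rw [he']; fun_prop
  have b1 : ∀ z, 0 ≤ z → 1/2 ≤ 1 - δ + φ z + e z ∧ 1 - δ + φ z + e z ≤ 2 := fun z hz => by
    have h1 := abs_le.1 (bφ z hz)
    have h2 := eD_nonneg hδ hz
    have h3 := eD_le hδ z
    constructor <;> linarith
  have b2 : ∀ z, 0 ≤ z → 1/2 ≤ 1 - δ + χ z + e z ∧ 1 - δ + χ z + e z ≤ 2 := fun z hz => by
    have h1 := abs_le.1 (bχ z hz)
    have h2 := eD_nonneg hδ hz
    have h3 := eD_le hδ z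
    constructor <;> linarith
  set D : ℝ → ℝ := fun z => ((1 - δ + φ z + e z)^2 - (1 - δ + χ z + e z)^2)/2 with hD
  set G : ℝ → ℝ := fun z => (1 - δ + φ z + e z) * (g z + e' z) - (1 - δ + χ z + e z) * (k z + e' z)
    + z/2 * (φ z - χ z) with hG
  set v : ℝ → ℝ := fun z => φ z - χ z with hv
  have hDv : ∀ z, D z = v z * (((1 - δ + φ z + e z) + (1 - δ + χ z + e z))/2) := fun z => by
    simp only [hD, hv]; ring
  have c1 : ContinuousOn (fun z => 1 - δ + φ z + e z) (Set.Ici 0) :=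
    (continuousOn_const.add hφs.continuousOn).add hec.continuousOn
  have c2 : ContinuousOn (fun z => 1 - δ + χ z + e z) (Set.Ici 0) :=
    (continuousOn_const.add hχs.continuousOn).add hec.continuousOn
  have hDc : ContinuousOn D (Set.Ici 0) := ((c1.pow 2).sub (c2.pow 2)).div_const 2
  have hGc : ContinuousOn G (Set.Ici 0) :=
    ((c1.mul (hgc.add hec'.continuousOn)).sub (c2.mul (hkc.add hec'.continuousOn))).add
      ((continuousOn_id.div_const 2).mul (hφs.continuousOn.sub hχs.continuousOn))
  have d1 : ∀ z, 0 < z → HasDerivAt (fun z => 1 - δ + φ z + e z) (g z + e' z) z := fun z hz =>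
    ((hg2 z hz).const_add _).add (hed z)
  have d2 : ∀ z, 0 < z → HasDerivAt (fun z => 1 - δ + χ z + e z) (k z + e' z) z := fun z hz =>
    ((hk2 z hz).const_add _).add (hed z)
  have hDd : ∀ z, 0 < z → HasDerivAt D (G z - z/2 * v z) z := fun z hz => by
    have := (((d1 z hz).pow 2).sub ((d2 z hz).pow 2)).div_const 2
    refine this.congr_deriv ?_
    simp only [hG, hv]; norm_num; ring
  have hGd : ∀ z, 0 < z → HasDerivAt G (v z / 2) z := fun z hz => by
    have := (((d1 z hz).mul ((hg3 z hz).add (hed2 z))).sub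
      ((d2 z hz).mul ((hk3 z hz).add (hed2 z)))).add
      (((hasDerivAt_id z).div_const 2).mul ((hg2 z hz).sub (hk2 z hz)))
    refine this.congr_deriv ?_
    have e1 := hφe z hz
    have e2 := hχe z hz
    rw [eD_deriv2, eD_deriv, hg1 z hz] at e1
    rw [eD_deriv2, eD_deriv, hk1 z hz] at e2
    simp only [hv, he', id, Pi.add_apply, Pi.sub_apply] at *
    linear_combination e1 - e2
  have hs : ∀ z, 0 ≤ z → (0 ≤ D z → 0 ≤ v z) ∧ (D z ≤ 0 → v z ≤ 0 ∧ 2 * D z ≤ v z) := by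
    intro z hz
    have h1 := b1 z hz
    have h2 := b2 z hz
    have h3 := hDv z
    set m := ((1 - δ + φ z + e z) + (1 - δ + χ z + e z))/2 with hm
    have hm1 : 1/2 ≤ m := by rw [hm]; linarith
    refine ⟨fun h => ?_, fun h => ?_⟩
    · by_contra hc
      push Not at hc
      nlinarith
    · have hv0 : v z ≤ 0 := by
        by_contra hc
        push Not at hc
        nlinarith
      exact ⟨hv0, by nlinarith⟩
  have hD0 : D 0 = 0 := by simp [hD, hφ0, hχ0]
  have he0 : e 0 = 0 := by simp [he, eDelta]
  have hG0e : G 0 = (1 - δ) * (g 0 - k 0) := by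
    simp only [hG, hφ0, hχ0, he0]; ring
  have hG0 : 0 ≤ G 0 := by
    rw [hG0e]; apply mul_nonneg <;> linarith
  have main := system_nonneg D G v hDc hGc hDd hGd hs hD0 hG0
  refine ⟨?_, fun z hz => ?_⟩
  · by_contra hne
    have hpos : 0 < G 0 := by
      rw [hG0e]
      have : k 0 < g 0 := lt_of_le_of_ne h00 (fun h => hne h.symm)
      apply mul_pos <;> linarith
    -- the integral of the sum is finite
    have hfin : weightedH2 φ + weightedH2 χ < ⊤ :=
      ENNReal.add_lt_top.2 ⟨hφw.trans_lt ENNReal.ofReal_lt_top, hχw.trans_lt ENNReal.ofReal_lt_top⟩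
    have hlow : ∫⁻ z in Set.Ioi (0:ℝ), ENNReal.ofReal (G 0 ^2 / 40) ≤
        weightedH2 φ + weightedH2 χ := by
      unfold weightedH2
      rw [← lintegral_add_left' (wH2_aemeas φ hφs.continuousOn)]
      refine setLIntegral_mono_ae' measurableSet_Ioi (Filter.Eventually.of_forall ?_)
      intro z hz
      have hz' : (0:ℝ) < z := hz
      rw [← ENNReal.ofReal_add (by positivity) (by positivity)]
      refine ENNReal.ofReal_le_ofReal ?_
      rw [hg1 z hz, hk1 z hz]
      have hGG := (main z hz'.le).2
      have hsq : G 0 ^2 ≤ G z ^2 := pow_le_pow_left₀ hG0 hGG 2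
      have hGz : G z = (1 - δ + φ z + e z) * g z - (1 - δ + χ z + e z) * k z + e' z * v z
        + z/2 * v z := by simp only [hG, hv]; ring
      have hb := eD_d_bound hδ z
      have hx : exp (-z^2/4) ≤ 1 := exp_le_one_iff.2 (by nlinarith)
      have hb1 : e' z ≤ 1 :=
        hb.2.trans (mul_le_one₀ (by linarith) (exp_pos _).le hx)
      obtain ⟨p1, p2⟩ := b1 z hz'.le
      obtain ⟨q1, q2⟩ := b2 z hz'.le
      have hfinal := alg_G (s := deriv (deriv φ) z) (t := deriv (deriv χ) z) (z := z) (g := g z)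
        (k := k z) (f := φ z) (c := χ z) (by linarith : 0 ≤ 1 - δ + φ z + e z) p2
        (by linarith : 0 ≤ 1 - δ + χ z + e z) q2 hb.1 hb1
      refine le_trans ?_ hfinal
      have hGz' : G z = (1 - δ + φ z + e z) * g z - (1 - δ + χ z + e z) * k z
        + (δ / √π * exp (-z^2/4)) * (φ z - χ z) + z/2 * (φ z - χ z) := hGz
      rw [← hGz']
      linarith
    have htop : ∫⁻ z in Set.Ioi (0:ℝ), ENNReal.ofReal (G 0 ^2 / 40) = ⊤ := by
      rw [setLIntegral_const, Real.volume_Ioi, ENNReal.mul_top]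
      simp only [ne_eq, ENNReal.ofReal_eq_zero, not_le]
      positivity
    rw [htop] at hlow
    exact absurd hfin (not_lt.2 hlow)
  · have := (hs z hz).1 (main z hz).1
    simp only [hv] at this
    linarith

lemma uniq {δ B : ℝ} (hδ : 0 < δ) (hδ1 : δ ≤ 1/4) (hB : 0 ≤ B) (hB1 : B ≤ 1/16)
    (φ χ : ℝ → ℝ) (hφ : IsFrontRemainder δ φ) (hχ : IsFrontRemainder δ χ)
    (hφw : weightedH2 φ ≤ ENNReal.ofReal B) (hχw : weightedH2 χ ≤ ENNReal.ofReal B) :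
    Set.EqOn φ χ (Set.Ici 0) := by
  obtain ⟨g, g0, g1, g2, g3⟩ := sol_data φ hφ.1
  obtain ⟨k, k0, k1, k2, k3⟩ := sol_data χ hχ.1
  have h : g 0 = k 0 := by
    rcases le_total (k 0) (g 0) with h | h
    · exact (uniq_half hδ hδ1 hB hB1 φ χ hφ hχ hφw hχw g k g0 g1 g2 g3 k0 k1 k2 k3 h).1
    · exact (uniq_half hδ hδ1 hB hB1 χ φ hχ hφ hχw hφw k g k0 k1 k2 k3 g0 g1 g2 g3 h).1.symm
  intro z hz
  exact le_antisymm
    ((uniq_half hδ hδ1 hB hB1 χ φ hχ hφ hχw hφw k g k0 k1 k2 k3 g0 g1 g2 g3 h.le).2 z hz)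
    ((uniq_half hδ hδ1 hB hB1 φ χ hφ hχ hφw hχw g k g0 g1 g2 g3 k0 k1 k2 k3 h.ge).2 z hz)

/-! ### Construction -/

lemma int_exp2 (a : ℝ) : IntegrableOn (fun s : ℝ => exp (-2 * s)) (Set.Ioi a) :=
  integrableOn_exp_mul_Ioi (by norm_num) a

lemma intOn_of_bound {f : ℝ → ℝ} (hf : Continuous f) {B : ℝ}
    (hb : ∀ z, 0 ≤ z → |f z| ≤ B * exp (-2 * z)) {a : ℝ} (ha : 0 ≤ a) :
    IntegrableOn f (Set.Ioi a) := by
  refine Integrable.mono' ((int_exp2 a).const_mul B) hf.aestronglyMeasurable ?_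
  refine (ae_restrict_iff' measurableSet_Ioi).2 (Filter.Eventually.of_forall fun z hz => ?_)
  exact hb z (ha.trans (le_of_lt hz))

lemma int_bound {f : ℝ → ℝ} {B : ℝ} (hB : 0 ≤ B)
    (hb : ∀ z, 0 ≤ z → |f z| ≤ B * exp (-2 * z)) {a : ℝ} (ha : 0 ≤ a) :
    |∫ s in Set.Ioi a, f s| ≤ B * exp (-2 * a) := by
  have h := norm_integral_le_of_norm_le (f := f) ((int_exp2 a).const_mul B)
    ((ae_restrict_iff' measurableSet_Ioi).2 (Filter.Eventually.of_forall fun z hz =>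
      hb z (ha.trans (le_of_lt hz))))
  rw [integral_const_mul, integral_exp_mul_Ioi (by norm_num)] at h
  rw [Real.norm_eq_abs] at h
  refine h.trans ?_
  have := exp_pos (-2 * a)
  refine mul_le_mul_of_nonneg_left ?_ hB
  linarith

lemma int_bound' {f : ℝ → ℝ} {B : ℝ} (hB : 0 ≤ B)
    (hb : ∀ z, 0 ≤ z → |f z| ≤ B * exp (-2 * z)) {z : ℝ} (hz : 0 ≤ z) :
    |∫ s in (0:ℝ)..z, f s| ≤ B := by
  rw [intervalIntegral.integral_of_le hz]
  have hi : IntegrableOn (fun s : ℝ => B * exp (-2 * s)) (Set.Ioi 0) := (int_exp2 0).const_mul B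
  have h := norm_integral_le_of_norm_le (f := f) (hi.mono_set (Set.Ioc_subset_Ioi_self : Set.Ioc 0 z ⊆ Set.Ioi 0))
    ((ae_restrict_iff' measurableSet_Ioc).2 (Filter.Eventually.of_forall fun z hz =>
      hb z (le_of_lt hz.1)))
  rw [Real.norm_eq_abs] at h
  refine h.trans ((setIntegral_mono_set hi (Filter.Eventually.of_forall fun s => by
    simp only [Pi.zero_apply]; positivity)
    (Set.Ioc_subset_Ioi_self).eventuallyLE).trans ?_)
  rw [integral_const_mul, integral_exp_mul_Ioi (by norm_num)]
  norm_num
  linarith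

structure Good (p : ℝ → ℝ) : Prop where
  cont : Continuous p
  lo : ∀ z, 3/4 ≤ p z
  hi : ∀ z, p z ≤ 5/4

noncomputable def Af (p : ℝ → ℝ) (z : ℝ) : ℝ := ∫ s in (0:ℝ)..z, s * p s / 2
noncomputable def Ef (p : ℝ → ℝ) (z : ℝ) : ℝ := exp (-(Af p z))
noncomputable def Sf (p : ℝ → ℝ) (z : ℝ) : ℝ := ∫ t in (0:ℝ)..z, t * exp (Af p t - t^2/4)
noncomputable def Ff (p : ℝ → ℝ) (z : ℝ) : ℝ := p z * Ef p z
noncomputable def Nf (p : ℝ → ℝ) (z : ℝ) : ℝ := p z * (Ef p z * Sf p z)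

lemma Af_deriv {p : ℝ → ℝ} (hp : Good p) (z : ℝ) : HasDerivAt (Af p) (z * p z / 2) z := by
  have := hp.cont
  have hc : Continuous (fun s : ℝ => s * p s / 2) := by fun_prop
  exact (hc.integral_hasStrictDerivAt 0 z).hasDerivAt

lemma Af_cont {p : ℝ → ℝ} (hp : Good p) : Continuous (Af p) :=
  continuous_iff_continuousAt.2 fun z => (Af_deriv hp z).continuousAt

lemma Ef_deriv {p : ℝ → ℝ} (hp : Good p) (z : ℝ) :
    HasDerivAt (Ef p) (-(z * p z / 2) * Ef p z) z := by
  have := (Af_deriv hp z).neg.exp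
  exact this.congr_deriv (by simp only [Ef, Pi.neg_apply]; ring)

lemma Ef_cont {p : ℝ → ℝ} (hp : Good p) : Continuous (Ef p) :=
  continuous_iff_continuousAt.2 fun z => (Ef_deriv hp z).continuousAt

lemma Sf_deriv {p : ℝ → ℝ} (hp : Good p) (z : ℝ) :
    HasDerivAt (Sf p) (z * exp (Af p z - z^2/4)) z := by
  have := Af_cont hp
  have hc : Continuous (fun t : ℝ => t * exp (Af p t - t^2/4)) := by fun_prop
  exact (hc.integral_hasStrictDerivAt 0 z).hasDerivAt

lemma Sf_cont {p : ℝ → ℝ} (hp : Good p) : Continuous (Sf p) :=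
  continuous_iff_continuousAt.2 fun z => (Sf_deriv hp z).continuousAt

lemma Ff_cont {p : ℝ → ℝ} (hp : Good p) : Continuous (Ff p) := hp.cont.mul (Ef_cont hp)
lemma Nf_cont {p : ℝ → ℝ} (hp : Good p) : Continuous (Nf p) :=
  hp.cont.mul ((Ef_cont hp).mul (Sf_cont hp))

lemma int_lin (c a b : ℝ) : ∫ s in a..b, c * s = c * (b^2 - a^2)/2 := by
  rw [intervalIntegral.integral_const_mul, integral_id]; ring

lemma Af_sub {p : ℝ → ℝ} (hp : Good p) (t z : ℝ) :
    Af p z - Af p t = ∫ s in t..z, s * p s / 2 := by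
  have := hp.cont
  have hc : Continuous (fun s : ℝ => s * p s / 2) := by fun_prop
  unfold Af
  rw [intervalIntegral.integral_interval_sub_left (hc.intervalIntegrable _ _)
    (hc.intervalIntegrable _ _)]

lemma Af_lo {p : ℝ → ℝ} (hp : Good p) {t z : ℝ} (ht : 0 ≤ t) (hz : t ≤ z) :
    3/16 * (z^2 - t^2) ≤ Af p z - Af p t := by
  have := hp.cont
  have hc : Continuous (fun s : ℝ => s * p s / 2) := by fun_prop
  have h := intervalIntegral.integral_mono_on (μ := volume) (f := fun s : ℝ => (3/8) * s)
    (g := fun s : ℝ => s * p s / 2) hz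
    ((by fun_prop : Continuous fun s : ℝ => (3/8) * s).intervalIntegrable _ _)
    (hc.intervalIntegrable _ _) (fun s hs => by
      have h1 := hp.lo s
      have h2 : 0 ≤ s := ht.trans hs.1
      nlinarith)
  rw [Af_sub hp]
  rw [int_lin] at h
  linarith

lemma Af_hi {p : ℝ → ℝ} (hp : Good p) {z : ℝ} (hz : 0 ≤ z) :
    Af p z ≤ 5/16 * z^2 := by
  have := hp.cont
  have hc : Continuous (fun s : ℝ => s * p s / 2) := by fun_prop
  have h := intervalIntegral.integral_mono_on (μ := volume) (f := fun s : ℝ => s * p s / 2)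
    (g := fun s : ℝ => (5/8) * s) hz
    (hc.intervalIntegrable _ _)
    ((by fun_prop : Continuous fun s : ℝ => (5/8) * s).intervalIntegrable _ _)
    (fun s hs => by
      have h1 := hp.hi s
      have h2 : 0 ≤ s := hs.1
      nlinarith)
  rw [int_lin] at h
  unfold Af
  linarith

lemma Af_diff {p r : ℝ → ℝ} (hp : Good p) (hr : Good r) {d : ℝ} (hd : ∀ z, |p z - r z| ≤ d)
    {t z : ℝ} (ht : 0 ≤ t) (hz : t ≤ z) :
    |(Af p z - Af p t) - (Af r z - Af r t)| ≤ d * z^2 := by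
  have h1 := hp.cont
  have h2 := hr.cont
  have hd0 : 0 ≤ d := (abs_nonneg _).trans (hd 0)
  have hz0 := ht.trans hz
  have hc : Continuous (fun s : ℝ => s * p s / 2) := by fun_prop
  have hc' : Continuous (fun s : ℝ => s * r s / 2) := by fun_prop
  rw [Af_sub hp, Af_sub hr, ← intervalIntegral.integral_sub (hc.intervalIntegrable _ _)
    (hc'.intervalIntegrable _ _)]
  have := intervalIntegral.norm_integral_le_of_norm_le_const (a := t) (b := z) (C := d * z)
    (f := fun s => s * p s / 2 - s * r s / 2) (fun s hs => by
      rw [Set.uIoc_of_le hz] at hs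
      have hs0 : 0 ≤ s := ht.trans hs.1.le
      rw [show s * p s / 2 - s * r s / 2 = s/2 * (p s - r s) by ring, Real.norm_eq_abs, abs_mul,
        abs_of_nonneg (by linarith), mul_comm]
      exact mul_le_mul (hd s) (by linarith [hs.2]) (by linarith) hd0)
  rw [Real.norm_eq_abs] at this
  refine this.trans ?_
  rw [abs_of_nonneg (by linarith)]
  nlinarith [mul_nonneg hd0 (mul_nonneg hz0 ht)]

lemma exp_diff {x y m : ℝ} (hx : m ≤ x) (hy : m ≤ y) :
    |exp (-x) - exp (-y)| ≤ exp (-m) * |x - y| := by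
  wlog h : x ≤ y generalizing x y
  · rw [abs_sub_comm, abs_sub_comm x]; exact this hy hx (le_of_not_ge h)
  rw [abs_of_nonneg (sub_nonneg.2 (exp_le_exp.2 (by linarith))), abs_sub_comm,
    abs_of_nonneg (sub_nonneg.2 h)]
  have h1 : exp (-y) = exp (-x) * exp (x - y) := by rw [← exp_add]; ring_nf
  have h2 := add_one_le_exp (x - y)
  have h3 : exp (-x) ≤ exp (-m) := exp_le_exp.2 (by linarith)
  have h4 := exp_pos (-x)
  rw [h1]
  nlinarith

/-- the Gaussian weight -/
noncomputable def gw (z : ℝ) : ℝ := (1 + z)^4 * exp (-(3/16 * z^2))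

noncomputable def M0 : ℝ := 24 * exp 13

lemma gw_le {z : ℝ} (hz : 0 ≤ z) : gw z ≤ M0 * exp (-2 * z) := by
  have h := Real.pow_div_factorial_le_exp (1 + z) (by linarith) 4
  have h4 : ((Nat.factorial 4 : ℕ) : ℝ) = 24 := by norm_num [Nat.factorial]
  rw [h4, div_le_iff₀ (by norm_num)] at h
  unfold gw M0
  calc (1 + z)^4 * exp (-(3/16 * z^2)) ≤ (exp (1 + z) * 24) * exp (-(3/16 * z^2)) := by gcongr
    _ = 24 * exp (1 + z + -(3/16 * z^2)) := by rw [exp_add (1 + z)]; ring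
    _ ≤ 24 * exp (13 + -2 * z) := by
        refine mul_le_mul_of_nonneg_left (exp_le_exp.2 ?_) (by norm_num)
        nlinarith [sq_nonneg (z - 8)]
    _ = 24 * exp 13 * exp (-2 * z) := by rw [exp_add]; ring

lemma Af_zero (p : ℝ → ℝ) : Af p 0 = 0 := by simp [Af]

lemma Ef_le {p : ℝ → ℝ} (hp : Good p) {z : ℝ} (hz : 0 ≤ z) : |Ef p z| ≤ gw z := by
  have h := Af_lo hp le_rfl hz
  rw [Af_zero] at h
  unfold Ef gw
  rw [abs_of_pos (exp_pos _)]
  have h1 : exp (-(Af p z)) ≤ exp (-(3/16 * z^2)) := exp_le_exp.2 (by linarith)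
  have h2 : 1 ≤ (1 + z)^4 := one_le_pow₀ (by linarith)
  nlinarith [exp_pos (-(3/16 * z^2))]

lemma Ef_diff {p r : ℝ → ℝ} (hp : Good p) (hr : Good r) {d : ℝ} (hd : ∀ z, |p z - r z| ≤ d)
    {z : ℝ} (hz : 0 ≤ z) : |Ef p z - Ef r z| ≤ d * gw z := by
  have h := Af_lo hp le_rfl hz
  have h' := Af_lo hr le_rfl hz
  have h2 := Af_diff hp hr hd le_rfl hz
  rw [Af_zero] at h h' h2
  rw [Af_zero] at h2
  have hd0 : 0 ≤ d := (abs_nonneg _).trans (hd 0)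
  have h3 := exp_diff (x := Af p z) (y := Af r z) (m := 3/16 * z^2) (by linarith) (by linarith)
  simp only [sub_zero] at h2
  unfold Ef gw
  have h4 : z^2 ≤ (1 + z)^4 := by nlinarith [pow_nonneg hz 3, pow_nonneg hz 4, pow_nonneg hz 2]
  calc _ ≤ exp (-(3/16 * z^2)) * |Af p z - Af r z| := h3
    _ ≤ exp (-(3/16 * z^2)) * (d * (1 + z)^4) := by gcongr; exact h2.trans (by gcongr)
    _ = _ := by ring

lemma ES_eq {p : ℝ → ℝ} (z : ℝ) :
    Ef p z * Sf p z = ∫ t in (0:ℝ)..z, t * exp (-t^2/4) * exp (-(Af p z - Af p t)) := by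
  unfold Ef Sf
  rw [← intervalIntegral.integral_const_mul]
  congr 1; ext t
  rw [mul_left_comm, ← exp_add, mul_assoc, ← exp_add]
  congr 2; ring

lemma gauss_comb {t z : ℝ} :
    exp (-t^2/4) * exp (-(3/16 * (z^2 - t^2))) ≤ exp (-(3/16 * z^2)) := by
  rw [← exp_add]
  refine exp_le_exp.2 ?_
  nlinarith [sq_nonneg t]

lemma ES_le {p : ℝ → ℝ} (hp : Good p) {z : ℝ} (hz : 0 ≤ z) : |Ef p z * Sf p z| ≤ gw z := by
  rw [ES_eq]
  have := intervalIntegral.norm_integral_le_of_norm_le_const (a := 0) (b := z)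
    (C := z * exp (-(3/16 * z^2)))
    (f := fun t => t * exp (-t^2/4) * exp (-(Af p z - Af p t))) (fun t ht => by
      rw [Set.uIoc_of_le hz] at ht
      have ht0 := ht.1
      have h1 := Af_lo hp ht.1.le ht.2
      rw [Real.norm_eq_abs, abs_of_nonneg (by positivity), mul_assoc]
      refine mul_le_mul ht.2 (le_trans ?_ (gauss_comb (t := t))) (by positivity) hz
      gcongr)
  rw [Real.norm_eq_abs] at this
  refine this.trans ?_
  rw [sub_zero, abs_of_nonneg hz]
  unfold gw
  have h4 : z^2 ≤ (1 + z)^4 := by nlinarith [pow_nonneg hz 3, pow_nonneg hz 4, pow_nonneg hz 2]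
  nlinarith [exp_pos (-(3/16 * z^2))]

lemma ES_diff {p r : ℝ → ℝ} (hp : Good p) (hr : Good r) {d : ℝ} (hd : ∀ z, |p z - r z| ≤ d)
    {z : ℝ} (hz : 0 ≤ z) : |Ef p z * Sf p z - Ef r z * Sf r z| ≤ d * gw z := by
  have hd0 : 0 ≤ d := (abs_nonneg _).trans (hd 0)
  have c1 := Af_cont hp
  have c2 := Af_cont hr
  rw [ES_eq, ES_eq, ← intervalIntegral.integral_sub
    ((by fun_prop : Continuous _).intervalIntegrable _ _)
    ((by fun_prop : Continuous _).intervalIntegrable _ _)]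
  have := intervalIntegral.norm_integral_le_of_norm_le_const (a := 0) (b := z)
    (C := z * (exp (-(3/16 * z^2)) * (d * z^2)))
    (f := fun t => t * exp (-t^2/4) * exp (-(Af p z - Af p t))
      - t * exp (-t^2/4) * exp (-(Af r z - Af r t))) (fun t ht => by
      rw [Set.uIoc_of_le hz] at ht
      have ht0 := ht.1
      have h1 := Af_lo hp ht.1.le ht.2
      have h2 := Af_lo hr ht.1.le ht.2
      have h3 := exp_diff h1 h2
      have h4 := Af_diff hp hr hd ht.1.le ht.2
      rw [Real.norm_eq_abs, ← mul_sub, abs_mul, abs_of_nonneg (by positivity), mul_assoc]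
      refine mul_le_mul ht.2 ?_ (by positivity) hz
      calc _ ≤ exp (-t^2/4) * (exp (-(3/16 * (z^2 - t^2))) * (d * z^2)) := by
              gcongr
              exact h3.trans (by gcongr)
        _ = (exp (-t^2/4) * exp (-(3/16 * (z^2 - t^2)))) * (d * z^2) := by ring
        _ ≤ _ := by gcongr; exact gauss_comb)
  rw [Real.norm_eq_abs] at this
  refine this.trans ?_
  rw [sub_zero, abs_of_nonneg hz]
  unfold gw
  have h4 : z^4 ≤ (1 + z)^4 := by gcongr; linarith
  calc _ = d * (z^4 * exp (-(3/16 * z^2))) := by ring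
    _ ≤ _ := by gcongr

lemma gw_nonneg {z : ℝ} : 0 ≤ gw z := by unfold gw; positivity

lemma mul_bd {p a g : ℝ} (h1 : 3/4 ≤ p) (h2 : p ≤ 5/4) (h : |a| ≤ g) : |p * a| ≤ 3 * g := by
  rw [abs_mul, abs_of_nonneg (by linarith)]
  nlinarith [abs_nonneg a]

lemma mul_diff_bd {p r a b g d : ℝ} (h1 : 3/4 ≤ r) (h2 : r ≤ 5/4) (hg : 0 ≤ g) (hd : |p - r| ≤ d)
    (h : |a| ≤ g) (hab : |a - b| ≤ d * g) : |p * a - r * b| ≤ d * (3 * g) := by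
  have hd0 : 0 ≤ d := (abs_nonneg _).trans hd
  calc |p * a - r * b| = |(p - r) * a + r * (a - b)| := by ring_nf
    _ ≤ |p - r| * |a| + |r| * |a - b| := by
        refine (abs_add_le _ _).trans ?_
        rw [abs_mul, abs_mul]
    _ ≤ d * g + (5/4) * (d * g) := by
        rw [abs_of_nonneg (by linarith : 0 ≤ r)]
        gcongr
    _ ≤ _ := by nlinarith [mul_nonneg hd0 hg]

noncomputable def M : ℝ := 3 * M0

lemma M_pos : 0 < M := by unfold M M0; positivity

lemma gw3 {z : ℝ} (hz : 0 ≤ z) : 3 * gw z ≤ M * exp (-2 * z) := by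
  have := gw_le hz
  unfold M
  linarith

lemma Ff_le {p : ℝ → ℝ} (hp : Good p) {z : ℝ} (hz : 0 ≤ z) : |Ff p z| ≤ M * exp (-2 * z) :=
  (mul_bd (hp.lo z) (hp.hi z) (Ef_le hp hz)).trans (gw3 hz)

lemma Nf_le {p : ℝ → ℝ} (hp : Good p) {z : ℝ} (hz : 0 ≤ z) : |Nf p z| ≤ M * exp (-2 * z) :=
  (mul_bd (hp.lo z) (hp.hi z) (ES_le hp hz)).trans (gw3 hz)

lemma Ff_diff {p r : ℝ → ℝ} (hp : Good p) (hr : Good r) {d : ℝ} (hd : ∀ z, |p z - r z| ≤ d)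
    {z : ℝ} (hz : 0 ≤ z) : |Ff p z - Ff r z| ≤ (d * M) * exp (-2 * z) := by
  have hd0 : 0 ≤ d := (abs_nonneg _).trans (hd 0)
  refine (mul_diff_bd (hr.lo z) (hr.hi z) gw_nonneg (hd z) (Ef_le hp hz)
    (Ef_diff hp hr hd hz)).trans ?_
  rw [mul_assoc]
  exact mul_le_mul_of_nonneg_left (gw3 hz) hd0

lemma Nf_diff {p r : ℝ → ℝ} (hp : Good p) (hr : Good r) {d : ℝ} (hd : ∀ z, |p z - r z| ≤ d)
    {z : ℝ} (hz : 0 ≤ z) : |Nf p z - Nf r z| ≤ (d * M) * exp (-2 * z) := by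
  have hd0 : 0 ≤ d := (abs_nonneg _).trans (hd 0)
  refine (mul_diff_bd (hr.lo z) (hr.hi z) gw_nonneg (hd z) (ES_le hp hz)
    (ES_diff hp hr hd hz)).trans ?_
  rw [mul_assoc]
  exact mul_le_mul_of_nonneg_left (gw3 hz) hd0

noncomputable def Kc (p : ℝ → ℝ) : ℝ := ∫ s in Set.Ioi (0:ℝ), Ff p s
noncomputable def Lc (p : ℝ → ℝ) : ℝ := ∫ s in Set.Ioi (0:ℝ), Nf p s

lemma Ff_int {p : ℝ → ℝ} (hp : Good p) : IntegrableOn (Ff p) (Set.Ioi 0) :=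
  intOn_of_bound (Ff_cont hp) (fun _ hz => Ff_le hp hz) le_rfl
lemma Nf_int {p : ℝ → ℝ} (hp : Good p) : IntegrableOn (Nf p) (Set.Ioi 0) :=
  intOn_of_bound (Nf_cont hp) (fun _ hz => Nf_le hp hz) le_rfl

lemma Kc_ge {p : ℝ → ℝ} (hp : Good p) : 1/2 ≤ Kc p := by
  unfold Kc
  have h0 : ∀ s, 0 ≤ Ff p s := fun s =>
    mul_nonneg (by linarith [hp.lo s]) (exp_pos _).le
  have h1 : ∫ s in (0:ℝ)..1, Ff p s ≤ ∫ s in Set.Ioi (0:ℝ), Ff p s := by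
    rw [intervalIntegral.integral_of_le zero_le_one]
    exact setIntegral_mono_set (Ff_int hp) (Filter.Eventually.of_forall h0)
      (Set.Ioc_subset_Ioi_self).eventuallyLE
  have h2 : ∫ s in (0:ℝ)..1, (1/2 : ℝ) ≤ ∫ s in (0:ℝ)..1, Ff p s := by
    refine intervalIntegral.integral_mono_on zero_le_one (by simp)
      ((Ff_cont hp).intervalIntegrable _ _) (fun s hs => ?_)
    have h3 := Af_hi hp hs.1
    have h4 : s^2 ≤ 1 := pow_le_one₀ hs.1 hs.2
    have h5 := add_one_le_exp (-(Af p s))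
    have h6 := hp.lo s
    unfold Ff Ef
    nlinarith
  simp at h2
  linarith

lemma Kc_diff {p r : ℝ → ℝ} (hp : Good p) (hr : Good r) {d : ℝ} (hd : ∀ z, |p z - r z| ≤ d) :
    |Kc p - Kc r| ≤ d * M := by
  have hd0 : 0 ≤ d := (abs_nonneg _).trans (hd 0)
  unfold Kc
  rw [← integral_sub (Ff_int hp) (Ff_int hr)]
  have := int_bound (f := fun s => Ff p s - Ff r s) (mul_nonneg hd0 M_pos.le)
    (fun z hz => Ff_diff hp hr hd hz) le_rfl
  simpa using this

lemma Lc_diff {p r : ℝ → ℝ} (hp : Good p) (hr : Good r) {d : ℝ} (hd : ∀ z, |p z - r z| ≤ d) :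
    |Lc p - Lc r| ≤ d * M := by
  have hd0 : 0 ≤ d := (abs_nonneg _).trans (hd 0)
  unfold Lc
  rw [← integral_sub (Nf_int hp) (Nf_int hr)]
  have := int_bound (f := fun s => Nf p s - Nf r s) (mul_nonneg hd0 M_pos.le)
    (fun z hz => Nf_diff hp hr hd hz) le_rfl
  simpa using this

lemma Lc_le {p : ℝ → ℝ} (hp : Good p) : |Lc p| ≤ M := by
  have := int_bound (f := fun s => Nf p s) M_pos.le (fun z hz => Nf_le hp hz) le_rfl
  simpa [Lc] using this

noncomputable def kap (δ : ℝ) : ℝ := δ^2 / (2 * √π)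

lemma kap_nonneg (δ : ℝ) : 0 ≤ kap δ := by unfold kap; positivity

lemma kap_le {δ : ℝ} (h : 0 < δ) (h1 : δ ≤ 1) : kap δ ≤ δ := by
  unfold kap
  rw [div_le_iff₀ (by positivity)]
  nlinarith [one_le_sqrt_pi]

noncomputable def q0 (δ : ℝ) (p : ℝ → ℝ) : ℝ := (δ - kap δ * Lc p) / Kc p

lemma q0_le {δ : ℝ} (h : 0 < δ) (h1 : δ ≤ 1) {p : ℝ → ℝ} (hp : Good p) :
    |q0 δ p| ≤ 2 * (1 + M) * δ := by
  unfold q0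
  have hK := Kc_ge hp
  have hL := Lc_le hp
  have hk := kap_le h h1
  have hk0 := kap_nonneg δ
  rw [abs_div, abs_of_pos (by linarith : 0 < Kc p), div_le_iff₀ (by linarith)]
  have h2 : |δ - kap δ * Lc p| ≤ δ + δ * M := by
    refine (abs_sub _ _).trans ?_
    rw [abs_mul, abs_of_pos h, abs_of_nonneg hk0]
    gcongr
  have := M_pos
  nlinarith [mul_pos this h]

lemma q0_diff {δ : ℝ} (h : 0 < δ) (h1 : δ ≤ 1) {p r : ℝ → ℝ} (hp : Good p) (hr : Good r) {d : ℝ}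
    (hd : ∀ z, |p z - r z| ≤ d) :
    |q0 δ p - q0 δ r| ≤ (2 * M + 4 * (1 + M) * M) * δ * d := by
  have hd0 : 0 ≤ d := (abs_nonneg _).trans (hd 0)
  have hK := Kc_ge hp
  have hq := q0_le h h1 hr
  have hKd := Kc_diff hp hr hd
  have hLd := Lc_diff hp hr hd
  have hk := kap_le h h1
  have hk0 := kap_nonneg δ
  have hM := M_pos
  have hKr := Kc_ge hr
  have hKr' : Kc r ≠ 0 := by linarith
  have hKp' : Kc p ≠ 0 := by linarith
  have e1 : q0 δ p - q0 δ r = (- kap δ * (Lc p - Lc r) - q0 δ r * (Kc p - Kc r)) / Kc p := by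
    unfold q0
    field_simp
    ring
  rw [e1, abs_div, abs_of_pos (by linarith : 0 < Kc p), div_le_iff₀ (by linarith)]
  have h2 : |- kap δ * (Lc p - Lc r) - q0 δ r * (Kc p - Kc r)| ≤
      δ * (d * M) + (2 * (1 + M) * δ) * (d * M) := by
    refine (abs_sub _ _).trans ?_
    rw [abs_mul, abs_mul, abs_neg, abs_of_nonneg hk0]
    gcongr
  refine h2.trans ?_
  have h3 : 0 ≤ (2 * M + 4 * (1 + M) * M) * δ * d := by positivity
  nlinarith

/-- derivative of the new profile -/
noncomputable def ud (δ : ℝ) (p : ℝ → ℝ) (z : ℝ) : ℝ := q0 δ p * Ff p z + kap δ * Nf p z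
noncomputable def uu (δ : ℝ) (p : ℝ → ℝ) (z : ℝ) : ℝ := 1 - δ + ∫ s in (0:ℝ)..z, ud δ p s

lemma ud_cont (δ : ℝ) {p : ℝ → ℝ} (hp : Good p) : Continuous (ud δ p) :=
  (continuous_const.mul (Ff_cont hp)).add (continuous_const.mul (Nf_cont hp))

lemma uu_deriv (δ : ℝ) {p : ℝ → ℝ} (hp : Good p) (z : ℝ) : HasDerivAt (uu δ p) (ud δ p z) z :=
  ((ud_cont δ hp).integral_hasStrictDerivAt 0 z).hasDerivAt.const_add _

noncomputable def M1 : ℝ := 2 * (1 + M) * M + M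
noncomputable def M2 : ℝ := (2 * M + 4 * (1 + M) * M) * M + 2 * (1 + M) * M + M

lemma M1_pos : 0 < M1 := by have := M_pos; unfold M1; positivity
lemma M2_pos : 0 < M2 := by have := M_pos; unfold M2; positivity

lemma ud_le {δ : ℝ} (h : 0 < δ) (h1 : δ ≤ 1) {p : ℝ → ℝ} (hp : Good p) {z : ℝ} (hz : 0 ≤ z) :
    |ud δ p z| ≤ (M1 * δ) * exp (-2 * z) := by
  unfold ud
  have hM := M_pos
  calc _ ≤ |q0 δ p| * |Ff p z| + |kap δ| * |Nf p z| := by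
        refine (abs_add_le _ _).trans ?_
        rw [abs_mul, abs_mul]
    _ ≤ (2 * (1 + M) * δ) * (M * exp (-2 * z)) + δ * (M * exp (-2 * z)) := by
        rw [abs_of_nonneg (kap_nonneg δ)]
        gcongr
        · exact q0_le h h1 hp
        · exact Ff_le hp hz
        · exact kap_le h h1
        · exact Nf_le hp hz
    _ = _ := by unfold M1; ring

lemma ud_diff {δ : ℝ} (h : 0 < δ) (h1 : δ ≤ 1) {p r : ℝ → ℝ} (hp : Good p) (hr : Good r) {d : ℝ}
    (hd : ∀ z, |p z - r z| ≤ d) {z : ℝ} (hz : 0 ≤ z) :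
    |ud δ p z - ud δ r z| ≤ (M2 * δ * d) * exp (-2 * z) := by
  have hd0 : 0 ≤ d := (abs_nonneg _).trans (hd 0)
  unfold ud
  have hM := M_pos
  calc _ = |(q0 δ p - q0 δ r) * Ff p z + q0 δ r * (Ff p z - Ff r z)
          + kap δ * (Nf p z - Nf r z)| := by ring_nf
    _ ≤ |q0 δ p - q0 δ r| * |Ff p z| + |q0 δ r| * |Ff p z - Ff r z|
          + |kap δ| * |Nf p z - Nf r z| := by
        refine (abs_add_three _ _ _).trans ?_
        rw [abs_mul, abs_mul, abs_mul]
    _ ≤ ((2 * M + 4 * (1 + M) * M) * δ * d) * (M * exp (-2 * z))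
          + (2 * (1 + M) * δ) * (d * M * exp (-2 * z)) + δ * (d * M * exp (-2 * z)) := by
        rw [abs_of_nonneg (kap_nonneg δ)]
        gcongr
        · exact q0_diff h h1 hp hr hd
        · exact Ff_le hp hz
        · exact q0_le h h1 hr
        · exact Ff_diff hp hr hd hz
        · exact kap_le h h1
        · exact Nf_diff hp hr hd hz
    _ = _ := by unfold M2; ring

lemma uu_near {δ : ℝ} (h : 0 < δ) (h1 : δ ≤ 1) {p : ℝ → ℝ} (hp : Good p) {z : ℝ} (hz : 0 ≤ z) :
    |uu δ p z - 1| ≤ (1 + M1) * δ := by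
  have hM := M1_pos
  have := int_bound' (f := ud δ p) (mul_nonneg hM.le h.le) (fun z hz => ud_le h h1 hp hz) hz
  unfold uu
  rw [abs_le] at *
  constructor <;> linarith

lemma uu_diff {δ : ℝ} (h : 0 < δ) (h1 : δ ≤ 1) {p r : ℝ → ℝ} (hp : Good p) (hr : Good r) {d : ℝ}
    (hd : ∀ z, |p z - r z| ≤ d) {z : ℝ} (hz : 0 ≤ z) :
    |uu δ p z - uu δ r z| ≤ M2 * δ * d := by
  have hd0 : 0 ≤ d := (abs_nonneg _).trans (hd 0)
  have hM := M2_pos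
  have := int_bound' (f := fun s => ud δ p s - ud δ r s) (by positivity : 0 ≤ M2 * δ * d)
    (fun z hz => ud_diff h h1 hp hr hd hz) hz
  rw [intervalIntegral.integral_sub ((ud_cont δ hp).intervalIntegrable _ _)
    ((ud_cont δ hr).intervalIntegrable _ _)] at this
  unfold uu
  rw [add_sub_add_left_eq_sub]
  exact this

lemma uu_tendsto {δ : ℝ} {p : ℝ → ℝ} (hp : Good p) :
    Filter.Tendsto (uu δ p) Filter.atTop (nhds 1) := by
  have hF := Ff_int hp
  have hN := Nf_int hp
  have hi : IntegrableOn (ud δ p) (Set.Ioi 0) := (hF.const_mul (q0 δ p)).add (hN.const_mul (kap δ))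
  have h := (intervalIntegral_tendsto_integral_Ioi 0 hi Filter.tendsto_id).const_add (1 - δ)
  have hv : ∫ s in Set.Ioi (0:ℝ), ud δ p s = δ := by
    unfold ud
    rw [integral_add (hF.const_mul (q0 δ p)) (hN.const_mul (kap δ)), integral_const_mul,
      integral_const_mul]
    change q0 δ p * Kc p + kap δ * Lc p = δ
    have := Kc_ge hp
    unfold q0
    rw [div_mul_cancel₀ _ (by linarith)]
    ring
  rw [hv] at h
  have e1 : 1 - δ + δ = 1 := by ring
  rw [e1] at h
  exact h

/-! fixed point -/

noncomputable def cinv (x : ℝ) : ℝ := (max (min x (4/3)) (4/5))⁻¹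

lemma cinv_diff (x y : ℝ) : |cinv x - cinv y| ≤ 2 * |x - y| := by
  unfold cinv
  set a := max (min x (4/3)) (4/5) with ha
  set b := max (min y (4/3)) (4/5) with hb
  have h1 : 4/5 ≤ a := le_max_right _ _
  have h2 : 4/5 ≤ b := le_max_right _ _
  have h3 : |a - b| ≤ |x - y| := by
    refine (abs_max_sub_max_le_abs _ _ _).trans ?_
    refine (abs_min_sub_min_le_max _ _ _ _).trans ?_
    simp
  have h4 : a⁻¹ - b⁻¹ = (b - a) / (a * b) := by
    have : a ≠ 0 := by linarith
    have : b ≠ 0 := by linarith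
    field_simp
  have h5 : 16/25 ≤ a * b := by nlinarith
  rw [h4, abs_div, abs_of_pos (by linarith : 0 < a * b), div_le_iff₀ (by linarith), abs_sub_comm b]
  nlinarith [abs_nonneg (x - y)]

lemma good_cinv {w : ℝ → ℝ} (hw : Continuous w) : Good (fun z => cinv (w z)) := by
  refine ⟨?_, fun z => ?_, fun z => ?_⟩
  · unfold cinv
    refine Continuous.inv₀ (by fun_prop) (fun z => ?_)
    have : (4/5 : ℝ) ≤ max (min (w z) (4/3)) (4/5) := le_max_right _ _
    intro h
    linarith
  · unfold cinv
    have h1 : (4/5 : ℝ) ≤ max (min (w z) (4/3)) (4/5) := le_max_right _ _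
    have h2 : max (min (w z) (4/3)) (4/5) ≤ (4/3:ℝ) := max_le (min_le_right _ _) (by norm_num)
    rw [le_inv_comm₀ (by norm_num) (by linarith)]
    norm_num
    try simpa using h2
  · unfold cinv
    have h1 : (4/5 : ℝ) ≤ max (min (w z) (4/3)) (4/5) := le_max_right _ _
    rw [inv_le_comm₀ (by linarith) (by norm_num)]
    norm_num

lemma exists_fix {δ : ℝ} (h : 0 < δ) (h1 : δ ≤ 1) (h2 : 4 * M2 * δ ≤ 1)
    (h3 : 5 * (1 + M1) * δ ≤ 1) :
    ∃ p : ℝ → ℝ, Good p ∧ ∀ z, 0 ≤ z → 4/5 ≤ uu δ p z ∧ uu δ p z ≤ 4/3 ∧ p z = (uu δ p z)⁻¹ := by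
  let T : BoundedContinuousFunction ℝ ℝ → BoundedContinuousFunction ℝ ℝ := fun w =>
    BoundedContinuousFunction.ofNormedAddCommGroup (fun z => uu δ (fun s => cinv (w s)) |z|)
      ((continuous_iff_continuousAt.2 fun z =>
        (uu_deriv δ (good_cinv w.continuous) z).continuousAt).comp continuous_abs) 2
      (fun z => by
        have := uu_near h h1 (good_cinv w.continuous) (abs_nonneg z)
        rw [Real.norm_eq_abs]
        rw [abs_le] at *
        constructor <;> linarith)
  have hT : ∀ w z, T w z = uu δ (fun s => cinv (w s)) |z| := fun w z => rfl
  have hc : ContractingWith (1/2) T := by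
    refine ⟨by norm_num, LipschitzWith.of_dist_le_mul fun w y => ?_⟩
    have hd0 : 0 ≤ dist w y := dist_nonneg
    rw [BoundedContinuousFunction.dist_le (by positivity)]
    intro z
    rw [hT, hT, Real.dist_eq]
    have := uu_diff h h1 (good_cinv w.continuous) (good_cinv y.continuous) (d := 2 * dist w y)
      (fun s => (cinv_diff _ _).trans (by
        have := BoundedContinuousFunction.dist_coe_le_dist (f := w) (g := y) s
        rw [Real.dist_eq] at this
        linarith)) (abs_nonneg z)
    refine this.trans ?_
    have e : ((1/2 : NNReal) : ℝ) = 1/2 := by norm_num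
    rw [e]
    nlinarith
  have hf := hc.fixedPoint_isFixedPt
  set w := ContractingWith.fixedPoint T hc with hw
  have hfix : ∀ z, w z = uu δ (fun s => cinv (w s)) |z| := fun z => by
    rw [← hT]; exact congrArg (fun f : BoundedContinuousFunction ℝ ℝ => f z) hf.symm
  refine ⟨fun s => cinv (w s), good_cinv w.continuous, fun z hz => ?_⟩
  have h4 := abs_le.1 (uu_near h h1 (good_cinv w.continuous) hz)
  have h5 := hfix z
  rw [abs_of_nonneg hz] at h5
  have h6 : 4/5 ≤ uu δ (fun s => cinv (w s)) z := by linarith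
  have h7 : uu δ (fun s => cinv (w s)) z ≤ 4/3 := by linarith
  refine ⟨h6, h7, ?_⟩
  change cinv (w z) = _
  rw [← h5] at h6 h7 ⊢
  unfold cinv
  rw [min_eq_left h7, max_eq_left h6]

noncomputable def qq (δ : ℝ) (p : ℝ → ℝ) (z : ℝ) : ℝ := Ef p z * (q0 δ p + kap δ * Sf p z)

lemma ud_eq (δ : ℝ) (p : ℝ → ℝ) (z : ℝ) : ud δ p z = p z * qq δ p z := by
  unfold ud qq Ff Nf; ring

lemma qq_deriv (δ : ℝ) {p : ℝ → ℝ} (hp : Good p) (z : ℝ) :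
    HasDerivAt (qq δ p) (-(z/2) * ud δ p z + kap δ * z * exp (-z^2/4)) z := by
  have h := (Ef_deriv hp z).mul (((Sf_deriv hp z).const_mul (kap δ)).const_add (q0 δ p))
  refine h.congr_deriv ?_
  have h1 : exp (-z^2/4) = Ef p z * exp (Af p z - z^2/4) := by
    unfold Ef
    rw [← exp_add]; congr 1; ring
  rw [ud_eq, h1]
  unfold qq
  ring

lemma qq_contDiff (δ : ℝ) {p : ℝ → ℝ} (hp : Good p) : ContDiff ℝ 1 (qq δ p) := by
  rw [contDiff_one_iff_deriv]
  refine ⟨fun z => (qq_deriv δ hp z).differentiableAt, ?_⟩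
  have : deriv (qq δ p) = fun z => -(z/2) * ud δ p z + kap δ * z * exp (-z^2/4) :=
    funext fun z => (qq_deriv δ hp z).deriv
  rw [this]
  have := ud_cont δ hp
  fun_prop

lemma uu_contDiff (δ : ℝ) {p : ℝ → ℝ} (hp : Good p) : ContDiff ℝ 1 (uu δ p) := by
  rw [contDiff_one_iff_deriv]
  refine ⟨fun z => (uu_deriv δ hp z).differentiableAt, ?_⟩
  have : deriv (uu δ p) = ud δ p := funext fun z => (uu_deriv δ hp z).deriv
  rw [this]
  exact ud_cont δ hp

lemma uu_contDiffOn (δ : ℝ) {p : ℝ → ℝ} (hp : Good p)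
    (hu : ∀ z, 0 ≤ z → 4/5 ≤ uu δ p z ∧ uu δ p z ≤ 4/3 ∧ p z = (uu δ p z)⁻¹) :
    ContDiffOn ℝ 2 (uu δ p) (Set.Ici 0) := by
  have h2 : (2 : WithTop ℕ∞) = 1 + 1 := by norm_num
  rw [h2, contDiffOn_succ_iff_derivWithin (uniqueDiffOn_Ici 0)]
  refine ⟨fun z _ => (uu_deriv δ hp z).differentiableAt.differentiableWithinAt, by simp, ?_⟩
  have h3 : ContDiffOn ℝ 1 (fun z => qq δ p z / uu δ p z) (Set.Ici 0) :=
    (qq_contDiff δ hp).contDiffOn.div (uu_contDiff δ hp).contDiffOn (fun z hz => by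
      have := (hu z hz).1
      intro h
      linarith)
  refine h3.congr fun z hz => ?_
  rw [(uu_deriv δ hp z).hasDerivWithinAt.derivWithin (uniqueDiffOn_Ici 0 z hz), ud_eq,
    (hu z hz).2.2]
  ring

lemma ud_deriv (δ : ℝ) {p : ℝ → ℝ} (hp : Good p)
    (hu : ∀ z, 0 ≤ z → 4/5 ≤ uu δ p z ∧ uu δ p z ≤ 4/3 ∧ p z = (uu δ p z)⁻¹) {z : ℝ}
    (hz : 0 < z) :
    HasDerivAt (ud δ p)
      ((-(z/2) * ud δ p z + kap δ * z * exp (-z^2/4) - (ud δ p z)^2) / uu δ p z) z := by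
  have h0 : uu δ p z ≠ 0 := by
    have := (hu z hz.le).1
    intro h
    linarith
  have h := (qq_deriv δ hp z).div (uu_deriv δ hp z) h0
  have he : ud δ p =ᶠ[nhds z] qq δ p / uu δ p := by
    filter_upwards [Ioi_mem_nhds hz] with y hy
    rw [ud_eq, (hu y (le_of_lt hy)).2.2, Pi.div_apply]
    ring
  refine (h.congr_of_eventuallyEq he).congr_deriv ?_
  have hq : qq δ p z = uu δ p z * ud δ p z := by
    rw [ud_eq, (hu z hz.le).2.2]
    field_simp
  rw [hq]
  field_simp

lemma gauss_le {z : ℝ} (hz : 0 ≤ z) : exp (-z^2/4) ≤ M * exp (-2 * z) := by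
  have h1 := gw3 hz
  have h2 : 1 ≤ (1 + z)^4 := one_le_pow₀ (by linarith)
  have h3 : exp (-z^2/4) ≤ exp (-(3/16 * z^2)) := exp_le_exp.2 (by nlinarith [sq_nonneg z])
  unfold gw at h1
  nlinarith [exp_pos (-(3/16 * z^2))]

noncomputable def MB : ℝ := M1 + M
noncomputable def MC : ℝ := (9 * (1 + MB)^2 + 2) * MB^2

lemma MB_pos : 0 < MB := add_pos M1_pos M_pos
lemma MC_pos : 0 < MC := by have := MB_pos; unfold MC; positivity

/-- pointwise algebra for the weighted bound -/
lemma pt_bound {s f g z X B : ℝ} (hz : 0 ≤ z) (hf : |f| ≤ X) (hg : |g| ≤ X)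
    (hs : |s| ≤ 3 * (1 + B) * (1 + z) * X) :
    s^2 + (1 + z^2) * (f^2 + g^2) ≤ (9 * (1 + B)^2 + 2) * ((1 + z)^2 * X^2) := by
  have h1 : s^2 ≤ (3 * (1 + B) * (1 + z) * X)^2 := by
    rw [← sq_abs]; exact pow_le_pow_left₀ (abs_nonneg _) hs 2
  have h2 : f^2 ≤ X^2 := by rw [← sq_abs f]; exact pow_le_pow_left₀ (abs_nonneg _) hf 2
  have h3 : g^2 ≤ X^2 := by rw [← sq_abs g]; exact pow_le_pow_left₀ (abs_nonneg _) hg 2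
  have h4 : (1 + z^2) * (f^2 + g^2) ≤ (1 + z)^2 * (X^2 + X^2) := by
    gcongr
    nlinarith
  linarith

lemma existence {δ : ℝ} (h : 0 < δ) (h1 : δ ≤ 1) (h2 : 4 * M2 * δ ≤ 1)
    (h3 : 5 * (1 + M1) * δ ≤ 1) :
    ∃ ψ, IsFrontRemainder δ ψ ∧ weightedH2 ψ ≤ ENNReal.ofReal (MC * δ^2) := by
  obtain ⟨p, hp, hu⟩ := exists_fix h h1 h2 h3
  set u := uu δ p with hudef
  set e' : ℝ → ℝ := fun z => δ / √π * exp (-z^2/4) with he'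
  set ψ : ℝ → ℝ := fun z => u z - (1 - δ) - eDelta δ z with hψ
  have hd : ∀ z, HasDerivAt ψ (ud δ p z - e' z) z := fun z =>
    ((uu_deriv δ hp z).sub_const _).sub (eD_hasDeriv δ z)
  have hdf : deriv ψ = fun z => ud δ p z - e' z := funext fun z => (hd z).deriv
  have hdd : ∀ z, 0 < z → deriv (deriv ψ) z =
      (-(z/2) * ud δ p z + kap δ * z * exp (-z^2/4) - (ud δ p z)^2) / u z
        - -(z/2) * e' z := fun z hz => by
    rw [hdf]
    exact ((ud_deriv δ hp hu hz).sub (eD_hasDeriv2 δ z)).deriv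
  have hk : ∀ z, kap δ * z * exp (-z^2/4) = δ * (z/2) * e' z := fun z => by
    simp only [he', kap]
    field_simp
  have hu0 : ∀ z, 0 ≤ z → u z ≠ 0 := fun z hz h0 => by
    have := (hu z hz).1
    linarith
  have hlim : Filter.Tendsto ψ Filter.atTop (nhds 0) := by
    have := ((uu_tendsto (δ := δ) hp).sub_const (1 - δ)).sub (eD_tendsto δ)
    simpa using this
  refine ⟨ψ, ⟨?_, ?_, hlim, ?_⟩, ?_⟩
  · exact ((uu_contDiffOn δ hp hu).sub contDiffOn_const).sub (eD_contDiff δ).contDiffOn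
  · simp [hψ, hudef, uu, eDelta]
  · intro z hz
    have e1 : deriv (eDelta δ) z = e' z := by rw [eD_deriv]
    rw [eD_deriv2, e1, hdd z hz, hdf, hk]
    change (1 - δ + ψ z) * _ + (ud δ p z - e' z)^2 + z/2 * (ud δ p z - e' z) = 
      -2 * (ud δ p z - e' z) * e' z - (e' z)^2 - ψ z * (-(z/2) * e' z) - _ - 
      eDelta δ z * (-(z/2) * e' z)
    have := hu0 z hz.le
    set t := (-(z/2) * ud δ p z + δ * (z/2) * e' z - (ud δ p z)^2) / u z with ht
    have hkey : u z * t = -(z/2) * ud δ p z + δ * (z/2) * e' z - (ud δ p z)^2 := by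
      rw [ht]; field_simp
    simp only [hψ]
    linear_combination hkey
  · have hB := MB_pos
    have hM := M_pos
    have hM1 := M1_pos
    have b1 : ∀ z, 0 ≤ z → |ud δ p z| ≤ M1 * δ * exp (-2 * z) := fun z hz => ud_le h h1 hp hz
    have b2 : ∀ z, 0 ≤ z → 0 ≤ e' z ∧ e' z ≤ M * δ * exp (-2 * z) := fun z hz => by
      have h5 := eD_d_bound h z
      refine ⟨h5.1, h5.2.trans ?_⟩
      have := mul_le_mul_of_nonneg_left (gauss_le hz) h.le
      linarith
    have b3 : ∀ z, 0 ≤ z → |ud δ p z - e' z| ≤ MB * δ * exp (-2 * z) := fun z hz => by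
      refine (abs_sub _ _).trans ?_
      rw [abs_of_nonneg (b2 z hz).1]
      have := b1 z hz
      have := (b2 z hz).2
      unfold MB
      linarith
    have hcont : Continuous (fun z => ud δ p z - e' z) := by
      have := ud_cont δ hp
      rw [he']
      fun_prop
    have b4 : ∀ z, 0 ≤ z → |ψ z| ≤ MB * δ * exp (-2 * z) := fun z hz => by
      have hI := intOn_of_bound hcont b3 hz
      have h6 := integral_Ioi_of_hasDerivAt_of_tendsto' (a := z) (fun x _ => hd x) hI hlim
      have h7 := int_bound (by positivity) b3 hz
      rw [h6, zero_sub, abs_neg] at h7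
      exact h7
    have b5 : ∀ z, 0 < z → |deriv (deriv ψ) z| ≤
        3 * (1 + MB) * (1 + z) * (MB * δ * exp (-2 * z)) := fun z hz => by
      rw [hdd z hz, hk]
      set X := MB * δ * exp (-2 * z) with hX
      have hX0 : 0 ≤ X := by positivity
      have hexp : exp (-2 * z) ≤ 1 := exp_le_one_iff.2 (by linarith)
      have hXB : X ≤ MB := by
        rw [hX, mul_assoc]
        refine mul_le_of_le_one_right hB.le (mul_le_one₀ h1 (exp_pos _).le hexp)
      have c0 : 0 ≤ M * δ * exp (-2 * z) := by positivity
      have c0' : 0 ≤ M1 * δ * exp (-2 * z) := by positivity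
      have hsum : X = M1 * δ * exp (-2 * z) + M * δ * exp (-2 * z) := by
        rw [hX]; unfold MB; ring
      have c1 : |ud δ p z| ≤ X := (b1 z hz.le).trans (by linarith)
      have c2 : e' z ≤ X := (b2 z hz.le).2.trans (by linarith)
      have c3 := (b2 z hz.le).1
      have hul := (hu z hz.le).1
      have n1 : |-(z/2) * ud δ p z + δ * (z/2) * e' z - (ud δ p z)^2| ≤
          z/2 * X + z/2 * X + MB * X := by
        have s1 : |-(z/2) * ud δ p z| ≤ z/2 * X := by
          rw [abs_mul, abs_neg, abs_of_pos (by linarith : 0 < z/2)]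
          gcongr
        have s2 : |δ * (z/2) * e' z| ≤ z/2 * X := by
          rw [abs_of_nonneg (by positivity)]
          have : δ * (z/2) ≤ z/2 := mul_le_of_le_one_left (by linarith) h1
          gcongr
        have s3 : |(ud δ p z)^2| ≤ MB * X := by
          rw [abs_pow, sq]
          exact mul_le_mul (c1.trans hXB) c1 (abs_nonneg _) hB.le
        exact (abs_sub _ _).trans (add_le_add ((abs_add_le _ _).trans (add_le_add s1 s2)) s3)
      have n2 : |(-(z/2) * ud δ p z + δ * (z/2) * e' z - (ud δ p z)^2) / u z| ≤
          2 * (z * X + MB * X) := by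
        rw [abs_div, abs_of_pos (by linarith : 0 < u z), div_le_iff₀ (by linarith)]
        refine n1.trans ?_
        have : 0 ≤ z * X + MB * X := by positivity
        nlinarith
      have n3 : |-(z/2) * e' z| ≤ z * X := by
        rw [abs_mul, abs_neg, abs_of_pos (by linarith : 0 < z/2), abs_of_nonneg c3]
        gcongr
        linarith
      refine (abs_sub _ _).trans ((add_le_add n2 n3).trans ?_)
      have p1 : 0 ≤ MB * X := by positivity
      have p2 : 0 ≤ MB * z * X := by positivity
      nlinarith
    have b6 : ∀ z, 0 < z → (deriv (deriv ψ) z)^2 + (1 + z^2) * ((ψ z)^2 + (deriv ψ z)^2) ≤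
        MC * δ^2 * exp (-2 * z) := fun z hz => by
      have h8 := pt_bound hz.le (b4 z hz.le) (b3 z hz.le) (b5 z hz)
      rw [hdf] at h8 ⊢
      refine h8.trans ?_
      have h9 : (1 + z)^2 ≤ exp (2 * z) := by
        have := pow_le_pow_left₀ (by linarith) (add_one_le_exp z) 2
        rw [← exp_nat_mul] at this
        push_cast at this
        linarith
      have h10 : exp (2 * z) * exp (-2 * z) = 1 := by
        rw [← exp_add]; simp
      calc _ ≤ (9 * (1 + MB)^2 + 2) * (exp (2 * z) * (MB * δ * exp (-2 * z))^2) := by gcongr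
        _ = MC * δ^2 * exp (-2 * z) * (exp (2 * z) * exp (-2 * z)) := by unfold MC; ring
        _ = _ := by rw [h10, mul_one]
    have hMC := MC_pos
    have hi : IntegrableOn (fun z : ℝ => MC * δ^2 * exp (-2 * z)) (Set.Ioi 0) :=
      (int_exp2 0).const_mul _
    calc weightedH2 ψ ≤ ∫⁻ z in Set.Ioi (0:ℝ), ENNReal.ofReal (MC * δ^2 * exp (-2 * z)) :=
          setLIntegral_mono_ae' measurableSet_Ioi (Filter.Eventually.of_forall fun z hz =>
            ENNReal.ofReal_le_ofReal (b6 z hz))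
      _ = ENNReal.ofReal (∫ z in Set.Ioi (0:ℝ), MC * δ^2 * exp (-2 * z)) :=
          (ofReal_integral_eq_lintegral_ofReal hi (Filter.Eventually.of_forall fun z => by
            simp only [Pi.zero_apply]; positivity)).symm
      _ ≤ ENNReal.ofReal (MC * δ^2) := by
          refine ENNReal.ofReal_le_ofReal ?_
          rw [integral_const_mul, integral_exp_mul_Ioi (by norm_num)]
          norm_num
          nlinarith [mul_pos hMC (pow_pos h 2)]

theorem stmt1 :
    ∃ δ₀ > (0:ℝ), ∃ C > (0:ℝ), ∀ δ : ℝ, 0 < δ → δ ≤ δ₀ →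
      ∃ ψ : ℝ → ℝ, IsFrontRemainder δ ψ ∧
        weightedH2 ψ ≤ ENNReal.ofReal (C * δ^2) ∧
        ∀ ψ' : ℝ → ℝ, IsFrontRemainder δ ψ' →
          weightedH2 ψ' ≤ ENNReal.ofReal (C * δ^2) →
          Set.EqOn ψ' ψ (Set.Ici 0) := by
  have hM1 := M1_pos
  have hM2 := M2_pos
  have hMC := MC_pos
  set S : ℝ := 4 + 4 * M2 + 5 * (1 + M1) + 16 * MC with hS
  have hSpos : 0 < S := by positivity
  refine ⟨1 / S, by positivity, MC, hMC, fun δ hδ hδ0 => ?_⟩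
  rw [le_div_iff₀ hSpos] at hδ0
  have hb : ∀ x, 0 ≤ x → x ≤ S → x * δ ≤ 1 := fun x _ hx => by nlinarith
  have h4 := hb 4 (by norm_num) (by rw [hS]; nlinarith)
  have h2 := hb (4 * M2) (by positivity) (by rw [hS]; nlinarith)
  have h3 := hb (5 * (1 + M1)) (by positivity) (by rw [hS]; nlinarith)
  have h5 := hb (16 * MC) (by positivity) (by rw [hS]; nlinarith)
  obtain ⟨ψ, hψ, hw⟩ := existence hδ (by linarith) h2 h3
  refine ⟨ψ, hψ, hw, fun χ hχ hχw => ?_⟩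
  exact uniq hδ (by linarith) (by positivity) (by nlinarith) χ ψ hχ hψ hχw hw
end

section
/- Let K ≥ 0 be an integer, let A₁,…,A_K > 0 and δ > 0, and let f : ℝ → ℝ be a C^K function with sup_{t∈ℝ} (1+|t|)^{1/2} |f(t)| ≤ δ and sup_{t∈ℝ} (1+|t|)^{k+1/2} |∂_t^k f(t)| ≤ A_k for each 1 ≤ k ≤ K. Let v(x,Y) = ∫_ℝ P_Y(x−t) f(t) dt. Then there is a universal constant C such that sup_{Y>0} |v(x,Y)| ≤ C δ x^{−1/2} for all x ≥ 1, and for each 1 ≤ k ≤ K there is a constant C(k, δ, A₁,…,A_k) such that sup_{Y>0} |∂_x^k v(x,Y)| ≤ C(k, δ, A₁,…,A_k) x^{−k−1/2} for all x ≥ 1. -/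
open MeasureTheory

/-- The Poisson extension of `f` to the upper half-plane with the
(unnormalized) kernel `P_Y(x) = Y/(Y² + x²)`. -/
noncomputable def poissonExt (f : ℝ → ℝ) (x Y : ℝ) : ℝ :=
  ∫ t : ℝ, (Y / (Y^2 + (x - t)^2)) * f t

/-- `n`-th derivative of the Poisson kernel. -/
noncomputable def pkQ (n : ℕ) (Y s : ℝ) : ℝ :=
  -(((-1:ℂ)^n * (n.factorial : ℂ)) * (((s:ℂ) + Y * Complex.I)^(n+1))⁻¹).im

lemma pk_ne {Y : ℝ} (hY : 0 < Y) (s : ℝ) : ((s:ℂ) + Y * Complex.I) ≠ 0 := by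
  intro h
  have := congrArg Complex.im h
  simp at this
  exact hY.ne' this

lemma pkQ_zero {Y : ℝ} (s : ℝ) : pkQ 0 Y s = Y / (Y^2 + s^2) := by
  simp [pkQ, Complex.inv_im, Complex.normSq_apply]
  rw [neg_div, neg_neg]
  congr 1
  ring

lemma pkQ_deriv (n : ℕ) {Y : ℝ} (hY : 0 < Y) (s : ℝ) :
    HasDerivAt (pkQ n Y) (pkQ (n+1) Y s) s := by
  have h0 : HasDerivAt (fun s : ℝ => (s:ℂ) + Y * Complex.I) 1 s :=
    (Complex.ofRealCLM.hasDerivAt (x := s)).add_const _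
  have h1 := ((h0.fun_pow (n+1)).fun_inv (pow_ne_zero _ (pk_ne hY s))).const_mul
    ((-1:ℂ)^n * (n.factorial : ℂ))
  have h2 := (Complex.imCLM.hasFDerivAt.comp_hasDerivAt s h1).fun_neg
  refine h2.congr_deriv ?_
  simp only [pkQ, Complex.imCLM_apply]
  congr 2
  have := pk_ne hY s
  generalize (s:ℂ) + Y * Complex.I = z at *
  rw [Nat.factorial_succ]
  push_cast
  field_simp
  ring

lemma pkQ_cont (n : ℕ) {Y : ℝ} (hY : 0 < Y) : Continuous (pkQ n Y) :=
  continuous_iff_continuousAt.2 fun s => (pkQ_deriv n hY s).continuousAt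

lemma pkQ_bound (n : ℕ) {Y : ℝ} (_hY : 0 < Y) {s : ℝ} {b : ℝ} (hb : 0 < b) (hs : b ≤ s) :
    |pkQ n Y s| ≤ n.factorial / b^(n+1) := by
  rw [pkQ, abs_neg]
  refine (Complex.abs_im_le_norm _).trans ?_
  rw [norm_mul, norm_mul, norm_inv, norm_pow, norm_pow, div_eq_mul_inv]
  simp only [norm_neg, norm_one, one_pow, one_mul, Complex.norm_natCast]
  have : b ≤ ‖(s:ℂ) + Y * Complex.I‖ := by
    refine hs.trans ((le_abs_self s).trans ?_)
    have := Complex.abs_re_le_norm ((s:ℂ) + Y * Complex.I)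
    simpa using this
  gcongr

lemma pk_eq {Y : ℝ} (hY : 0 < Y) (s : ℝ) :
    Y / (Y^2 + s^2) = Y⁻¹ * (1 + (s / Y)^2)⁻¹ := by
  have : Y^2 + s^2 ≠ 0 := by positivity
  field_simp

lemma pk_integrable {Y : ℝ} (hY : 0 < Y) : Integrable (fun s : ℝ => Y / (Y^2 + s^2)) := by
  simp_rw [pk_eq hY]
  exact (integrable_inv_one_add_sq.comp_div hY.ne').const_mul _

lemma pk_integral {Y : ℝ} (hY : 0 < Y) : ∫ s : ℝ, Y / (Y^2 + s^2) = Real.pi := by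
  simp_rw [pk_eq hY]
  rw [integral_const_mul, Measure.integral_comp_div (fun s : ℝ => (1 + s^2)⁻¹),
    integral_univ_inv_one_add_sq, abs_of_pos hY, smul_eq_mul]
  field_simp

lemma pk_integrable_mul {Y : ℝ} (hY : 0 < Y) (x : ℝ) {g : ℝ → ℝ} (hg : Continuous g) {M : ℝ}
    (hM : ∀ t, |g t| ≤ M) : Integrable (fun t : ℝ => Y / (Y^2 + (x - t)^2) * g t) :=
  ((pk_integrable hY).comp_sub_left x).mul_bdd hg.aestronglyMeasurable
    (Filter.Eventually.of_forall hM)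

lemma pext_eq (g : ℝ → ℝ) (x Y : ℝ) :
    poissonExt g x Y = ∫ t : ℝ, Y / (Y^2 + t^2) * g (x - t) := by
  rw [poissonExt, ← integral_sub_left_eq_self _ volume x]
  simp

lemma pext_deriv {Y : ℝ} (hY : 0 < Y) {g : ℝ → ℝ} {g' : ℝ → ℝ} (hg : ∀ t, HasDerivAt g (g' t) t)
    (hg' : Continuous g') {M M' : ℝ} (hM : ∀ t, |g t| ≤ M) (hM' : ∀ t, |g' t| ≤ M') (x : ℝ) :
    HasDerivAt (fun x => poissonExt g x Y) (poissonExt g' x Y) x := by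
  simp_rw [pext_eq]
  have hgc : Continuous g := continuous_iff_continuousAt.2 fun s => (hg s).continuousAt
  have hk : Continuous fun t : ℝ => Y / (Y^2 + t^2) :=
    continuous_const.div (by fun_prop) (fun t => by positivity)
  refine (hasDerivAt_integral_of_dominated_loc_of_deriv_le (μ := volume)
    (F := fun x t => Y / (Y^2 + t^2) * g (x - t)) (F' := fun x t => Y / (Y^2 + t^2) * g' (x - t))
    (bound := fun t => Y / (Y^2 + t^2) * M') (s := Set.univ) Filter.univ_mem ?_ ?_ ?_ ?_ ?_ ?_).2
  · exact Filter.Eventually.of_forall fun x => by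
      apply Continuous.aestronglyMeasurable; fun_prop
  · refine (pk_integrable hY).mul_bdd (c := M) ?_ (Filter.Eventually.of_forall fun t => hM _)
    apply Continuous.aestronglyMeasurable; fun_prop
  · apply Continuous.aestronglyMeasurable; fun_prop
  · refine Filter.Eventually.of_forall fun t x _ => ?_
    rw [norm_mul, Real.norm_of_nonneg (by positivity)]
    exact mul_le_mul_of_nonneg_left (hM' _) (by positivity)
  · exact (pk_integrable hY).mul_const _
  · refine Filter.Eventually.of_forall fun t x _ => ?_
    exact ((hg (x - t)).comp_sub_const x t).const_mul _

/-- The decay hypotheses. -/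
def PDecay (K : ℕ) (B : ℕ → ℝ) (f : ℝ → ℝ) : Prop :=
  ContDiff ℝ K f ∧ ∀ j ≤ K, ∀ t, (1 + |t|)^j * √(1 + |t|) * |iteratedDeriv j f t| ≤ B j

lemma PDecay.nonneg {K : ℕ} {B : ℕ → ℝ} {f : ℝ → ℝ} (h : PDecay K B f) {j : ℕ} (hj : j ≤ K) :
    0 ≤ B j := le_trans (by positivity) (h.2 j hj 0)

lemma PDecay.bdd {K : ℕ} {B : ℕ → ℝ} {f : ℝ → ℝ} (h : PDecay K B f) {j : ℕ} (hj : j ≤ K) (t : ℝ) :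
    |iteratedDeriv j f t| ≤ B j := by
  refine le_trans ?_ (h.2 j hj t)
  refine le_mul_of_one_le_left (abs_nonneg _) ?_
  have h1 : 1 ≤ 1 + |t| := by linarith [abs_nonneg t]
  exact one_le_mul_of_one_le_of_one_le (one_le_pow₀ h1) (Real.one_le_sqrt.2 h1)

lemma PDecay.cont {K : ℕ} {B : ℕ → ℝ} {f : ℝ → ℝ} (h : PDecay K B f) {j : ℕ} (hj : j ≤ K) :
    Continuous (iteratedDeriv j f) :=
  h.1.continuous_iteratedDeriv j (by exact_mod_cast hj)

lemma PDecay.deriv {K : ℕ} {B : ℕ → ℝ} {f : ℝ → ℝ} (h : PDecay K B f) {j : ℕ} (hj : j + 1 ≤ K)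
    (t : ℝ) : HasDerivAt (iteratedDeriv j f) (iteratedDeriv (j+1) f t) t := by
  rw [iteratedDeriv_succ]
  exact (h.1.differentiable_iteratedDeriv j (by exact_mod_cast hj) t).hasDerivAt

lemma PDecay.far {K : ℕ} {B : ℕ → ℝ} {f : ℝ → ℝ} (h : PDecay K B f) {j : ℕ} (hj : j ≤ K) {x t : ℝ}
    (hx : 1 ≤ x) (ht : x / 2 ≤ |t|) :
    |iteratedDeriv j f t| ≤ 2^(j+1) * B j / (x^j * √x) := by
  have hx0 : 0 < x := by linarith
  have := Real.sqrt_pos.2 hx0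
  rw [le_div_iff₀ (by positivity)]
  have h1 : x ≤ 2 * (1 + |t|) := by linarith
  have h2 : √x ≤ 2 * √(1+|t|) := by
    rw [Real.sqrt_le_left (by positivity), mul_pow, Real.sq_sqrt (by positivity)]
    linarith [abs_nonneg t]
  calc |iteratedDeriv j f t| * (x^j * √x)
      ≤ |iteratedDeriv j f t| * ((2 * (1+|t|))^j * (2 * √(1+|t|))) := by gcongr
    _ = 2^(j+1) * ((1 + |t|)^j * √(1 + |t|) * |iteratedDeriv j f t|) := by rw [mul_pow]; ring
    _ ≤ _ := by gcongr; exact h.2 j hj t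

lemma pext_iter {K : ℕ} {B : ℕ → ℝ} {f : ℝ → ℝ} (h : PDecay K B f) {Y : ℝ} (hY : 0 < Y) (k : ℕ)
    (hk : k ≤ K) : iteratedDeriv k (fun x => poissonExt f x Y)
      = fun x => poissonExt (iteratedDeriv k f) x Y := by
  induction k with
  | zero => simp
  | succ k ih =>
    rw [iteratedDeriv_succ, ih (by omega)]
    funext x
    exact (pext_deriv hY (fun t => h.deriv hk t) (h.cont hk) (h.bdd (by omega)) (h.bdd hk) x).deriv

lemma int_half {a : ℝ} (ha : 0 ≤ a) : ∫ t in (0:ℝ)..a, (√(1+|t|))⁻¹ ≤ 2 * √a := by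
  have h : ∫ t in (0:ℝ)..a, (√(1+|t|))⁻¹ = 2 * √(1+a) - 2 * √(1+0) := by
    apply intervalIntegral.integral_eq_sub_of_hasDerivAt (f := fun t => 2 * √(1+t))
    · intro t ht
      rw [Set.uIcc_of_le ha] at ht
      have h1 : 0 < 1 + t := by linarith [ht.1]
      have := (((hasDerivAt_id t).const_add 1).sqrt h1.ne').const_mul 2
      refine this.congr_deriv ?_
      have := Real.sqrt_pos.2 h1
      rw [abs_of_nonneg ht.1]
      simp only [id]
      field_simp
    · apply Continuous.intervalIntegrable
      exact Continuous.inv₀ (by fun_prop) (fun t => (Real.sqrt_pos.2 (by positivity)).ne')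
  rw [h]
  have : √(1+a) ≤ 1 + √a := by
    rw [Real.sqrt_le_left (by positivity), add_sq, Real.sq_sqrt ha]
    nlinarith [Real.sqrt_nonneg a]
  simp only [add_zero, Real.sqrt_one]
  linarith

lemma int_full {a : ℝ} (ha : 0 ≤ a) : ∫ t in (-a)..a, (√(1+|t|))⁻¹ ≤ 4 * √a := by
  have hc : Continuous fun t : ℝ => (√(1+|t|))⁻¹ :=
    Continuous.inv₀ (by fun_prop) (fun t => (Real.sqrt_pos.2 (by positivity)).ne')
  rw [← intervalIntegral.integral_add_adjacent_intervals (b := 0)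
    (hc.intervalIntegrable _ _) (hc.intervalIntegrable _ _)]
  have := intervalIntegral.integral_comp_neg (a := 0) (b := a) (fun t : ℝ => (√(1+|t|))⁻¹)
  simp only [abs_neg, neg_zero] at this
  rw [← this]
  linarith [int_half ha]

lemma inner_zero {K : ℕ} {B : ℕ → ℝ} {f : ℝ → ℝ} (h : PDecay K B f) {Y : ℝ} (hY : 0 < Y) (n : ℕ)
    {x : ℝ} (hx : 1 ≤ x) :
    |∫ t in (-(x/2))..(x/2), pkQ n Y (x - t) * f t|
      ≤ n.factorial * 2^(n+3) * B 0 / (x^n * √x) := by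
  have hx0 : 0 < x := by linarith
  have hB := h.nonneg (Nat.zero_le K)
  have hc : Continuous fun t : ℝ => (√(1+|t|))⁻¹ :=
    Continuous.inv₀ (by fun_prop) (fun t => (Real.sqrt_pos.2 (by positivity)).ne')
  have h1 := intervalIntegral.norm_integral_le_of_norm_le (μ := volume) (a := -(x/2)) (b := x/2)
    (f := fun t => pkQ n Y (x - t) * f t)
    (g := fun t => (n.factorial / (x/2)^(n+1) * B 0) * (√(1+|t|))⁻¹) (by linarith)
    (Filter.Eventually.of_forall fun t ht => by
      rw [norm_mul, mul_assoc]
      refine mul_le_mul (pkQ_bound n hY (by positivity) (by linarith [ht.2])) ?_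
        (norm_nonneg _) (by positivity)
      have := h.2 0 (Nat.zero_le K) t
      simp only [pow_zero, one_mul, iteratedDeriv_zero] at this
      have hs : 0 < √(1+|t|) := Real.sqrt_pos.2 (by positivity)
      rw [← div_eq_mul_inv, le_div_iff₀ hs, Real.norm_eq_abs]
      linarith)
    ((hc.const_mul _).intervalIntegrable _ _)
  rw [Real.norm_eq_abs, intervalIntegral.integral_const_mul] at h1
  refine h1.trans ?_
  have h2 : ∫ t in (-(x/2))..(x/2), (√(1+|t|))⁻¹ ≤ 4 * √x :=
    (int_full (by positivity)).trans (by gcongr; linarith)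
  refine (mul_le_mul_of_nonneg_left h2 (by positivity)).trans (le_of_eq ?_)
  have hs := Real.sqrt_pos.2 hx0
  have hss : √x * √x = x := Real.mul_self_sqrt hx0.le
  rw [div_pow]
  field_simp
  rw [sq, hss]
  ring

lemma inner_step {K : ℕ} {B : ℕ → ℝ} {f : ℝ → ℝ} (h : PDecay K B f) {Y : ℝ} (hY : 0 < Y) (n m : ℕ)
    (hm : m + 1 ≤ K) {x : ℝ} (hx : 1 ≤ x) :
    |∫ t in (-(x/2))..(x/2), pkQ n Y (x - t) * iteratedDeriv (m+1) f t|
      ≤ 2 * (n.factorial * 2^(n+1) * 2^(m+1) * B m) / (x^(n+(m+1)) * √x) +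
      |∫ t in (-(x/2))..(x/2), pkQ (n+1) Y (x - t) * iteratedDeriv m f t| := by
  have hx0 : 0 < x := by linarith
  have hs := Real.sqrt_pos.2 hx0
  have hB := h.nonneg (j := m) (by omega)
  rw [intervalIntegral.integral_mul_deriv_eq_deriv_mul (u := fun t => pkQ n Y (x - t))
    (u' := fun t => - pkQ (n+1) Y (x - t)) (v := iteratedDeriv m f)
    (fun t _ => (pkQ_deriv n hY (x - t)).comp_const_sub x t) (fun t _ => h.deriv hm t)
    ((((pkQ_cont (n+1) hY).comp (continuous_const.sub continuous_id)).neg).intervalIntegrable _ _)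
    ((h.cont hm).intervalIntegrable _ _)]
  simp only [neg_mul, intervalIntegral.integral_neg, sub_neg_eq_add]
  refine (abs_add_le _ _).trans ?_
  gcongr
  have key : ∀ t, t ≤ x/2 → x/2 ≤ |t| → |pkQ n Y (x - t) * iteratedDeriv m f t| ≤
      (n.factorial * 2^(n+1) * 2^(m+1) * B m) / (x^(n+(m+1)) * √x) := by
    intro t ht ht'
    rw [abs_mul]
    refine (mul_le_mul (pkQ_bound n hY (b := x/2) (by positivity) (by linarith))
      (h.far (by omega) hx ht') (abs_nonneg _) (by positivity)).trans (le_of_eq ?_)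
    rw [div_pow]
    field_simp
    ring
  refine (abs_sub _ _).trans ?_
  have k1 := key (x/2) le_rfl (le_abs_self _)
  have k2 := key (-(x/2)) (by linarith) (by rw [abs_neg]; exact le_abs_self _)
  rw [sub_neg_eq_add] at k2
  rw [mul_div_assoc, two_mul]
  exact add_le_add k1 k2

lemma inner_all (B : ℕ → ℝ) (K : ℕ) (m : ℕ) (hm : m ≤ K) : ∀ n : ℕ, ∃ C : ℝ, ∀ f, PDecay K B f →
    ∀ x : ℝ, 1 ≤ x → ∀ Y : ℝ, 0 < Y →
    |∫ t in (-(x/2))..(x/2), pkQ n Y (x - t) * iteratedDeriv m f t| ≤ C / (x^(n+m) * √x) := by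
  induction m with
  | zero =>
    intro n
    refine ⟨n.factorial * 2^(n+3) * B 0, fun f h x hx Y hY => ?_⟩
    simpa using inner_zero h hY n hx
  | succ m ih =>
    intro n
    obtain ⟨C, hC⟩ := ih (by omega) (n+1)
    refine ⟨2 * (n.factorial * 2^(n+1) * 2^(m+1) * B m) + C, fun f h x hx Y hY => ?_⟩
    refine (inner_step h hY n m hm hx).trans ?_
    have := hC f h x hx Y hY
    rw [add_div]
    rw [show n + 1 + m = n + (m+1) by ring] at this
    gcongr

lemma outer {K : ℕ} {B : ℕ → ℝ} {f : ℝ → ℝ} (h : PDecay K B f) {Y : ℝ} (hY : 0 < Y) (k : ℕ)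
    (hk : k ≤ K) {x : ℝ} (hx : 1 ≤ x) :
    |poissonExt (iteratedDeriv k f) x Y| ≤
      |∫ t in (-(x/2))..(x/2), pkQ 0 Y (x - t) * iteratedDeriv k f t|
      + Real.pi * (2^(k+1) * B k) / (x^k * √x) := by
  have hx0 : 0 < x := by linarith
  have hB := h.nonneg hk
  have hint := pk_integrable_mul hY x (h.cont hk) (h.bdd hk)
  rw [poissonExt, ← integral_add_compl (measurableSet_Ioc (a := -(x/2)) (b := x/2)) hint,
    intervalIntegral.integral_of_le (by linarith)]
  simp only [pkQ_zero]
  refine (abs_add_le _ _).trans ?_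
  gcongr
  have hki := ((pk_integrable hY).comp_sub_left x).mul_const (2^(k+1) * B k / (x^k * √x))
  have h1 := norm_integral_le_of_norm_le
    (μ := volume.restrict (Set.Ioc (-(x/2)) (x/2))ᶜ)
    (f := fun t => Y / (Y^2 + (x-t)^2) * iteratedDeriv k f t) hki.integrableOn
    (ae_restrict_of_forall_mem measurableSet_Ioc.compl fun t ht => by
      rw [norm_mul, Real.norm_of_nonneg (by positivity)]
      refine mul_le_mul_of_nonneg_left (h.far hk hx ?_) (by positivity)
      by_contra hcon
      push Not at hcon
      rw [abs_lt] at hcon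
      exact ht ⟨hcon.1, hcon.2.le⟩)
  refine h1.trans ((setIntegral_le_integral hki
    (Filter.Eventually.of_forall fun t => by positivity)).trans (le_of_eq ?_))
  rw [integral_mul_const, integral_sub_left_eq_self (fun s => Y / (Y^2 + s^2)) volume x,
    pk_integral hY]
  ring

lemma mkDecay {K : ℕ} {A : ℕ → ℝ} {δ : ℝ} {f : ℝ → ℝ} (h1 : ContDiff ℝ K f)
    (h2 : ∀ t : ℝ, (1 + |t|) ^ ((1:ℝ)/2) * |f t| ≤ δ)
    (h3 : ∀ k : ℕ, 1 ≤ k → k ≤ K →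
          ∀ t : ℝ, (1 + |t|) ^ ((k:ℝ) + 1/2) * |iteratedDeriv k f t| ≤ A k) :
    PDecay K (fun j => if j = 0 then δ else A j) f := by
  refine ⟨h1, fun j hj t => ?_⟩
  by_cases hj0 : j = 0
  · subst hj0
    simpa [Real.sqrt_eq_rpow] using h2 t
  · simp only [hj0, if_false]
    have := h3 j (by omega) hj t
    rwa [Real.rpow_add (by positivity), Real.rpow_natCast, ← Real.sqrt_eq_rpow] at this

lemma pow_conv {x : ℝ} (hx : 1 ≤ x) (k : ℕ) (C : ℝ) :
    C / (x^k * √x) = C * x ^ (-(k:ℝ) - 1/2) := by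
  have hx0 : 0 < x := by linarith
  rw [show -(k:ℝ) - 1/2 = -((k:ℝ) + 1/2) by ring, Real.rpow_neg hx0.le, Real.rpow_add hx0,
    Real.rpow_natCast, ← Real.sqrt_eq_rpow, div_eq_mul_inv]

theorem stmt5 :
    ∃ C > (0:ℝ), ∀ (K : ℕ) (A : ℕ → ℝ) (δ : ℝ), 0 < δ →
      (∀ f : ℝ → ℝ, ContDiff ℝ K f →
        (∀ t : ℝ, (1 + |t|) ^ ((1:ℝ)/2) * |f t| ≤ δ) →
        (∀ k : ℕ, 1 ≤ k → k ≤ K →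
          ∀ t : ℝ, (1 + |t|) ^ ((k:ℝ) + 1/2) * |iteratedDeriv k f t| ≤ A k) →
        ∀ x : ℝ, 1 ≤ x → ∀ Y : ℝ, 0 < Y →
          |poissonExt f x Y| ≤ C * δ * x ^ (-(1:ℝ)/2)) ∧
      (∀ k : ℕ, 1 ≤ k → k ≤ K → ∃ C' > (0:ℝ),
        ∀ f : ℝ → ℝ, ContDiff ℝ K f →
          (∀ t : ℝ, (1 + |t|) ^ ((1:ℝ)/2) * |f t| ≤ δ) →
          (∀ j : ℕ, 1 ≤ j → j ≤ K →
            ∀ t : ℝ, (1 + |t|) ^ ((j:ℝ) + 1/2) * |iteratedDeriv j f t| ≤ A j) →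
          ∀ x : ℝ, 1 ≤ x → ∀ Y : ℝ, 0 < Y →
            |iteratedDeriv k (fun x' => poissonExt f x' Y) x| ≤ C' * x ^ (-(k:ℝ) - 1/2)) := by
  refine ⟨8 + Real.pi * 2, by positivity, fun K A δ hδ => ⟨?_, ?_⟩⟩
  · intro f h1 h2 h3 x hx Y hY
    have h := mkDecay h1 h2 h3
    have e1 := outer h hY 0 (Nat.zero_le _) hx
    have e2 := inner_zero h hY 0 hx
    simp only [iteratedDeriv_zero] at e1
    have e3 := e1.trans (add_le_add_left e2 _)
    rw [pow_conv hx, pow_conv hx] at e3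
    simp only [if_true, Nat.cast_zero, neg_zero, zero_sub, Nat.factorial_zero, Nat.cast_one] at e3
    rw [neg_div]
    refine e3.trans (le_of_eq ?_)
    ring
  · intro k _ hk
    obtain ⟨C, hC⟩ := inner_all (fun j => if j = 0 then δ else A j) K k hk 0
    refine ⟨max 1 (C + Real.pi * (2^(k+1) * (if k = 0 then δ else A k))),
      lt_max_of_lt_left one_pos, ?_⟩
    intro f h1 h2 h3 x hx Y hY
    have h := mkDecay h1 h2 h3
    rw [pext_iter h hY k hk]
    have e1 := outer h hY k hk hx
    have e2 := hC f h x hx Y hY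
    rw [zero_add] at e2
    have e3 := e1.trans (add_le_add_left e2 _)
    rw [pow_conv hx, pow_conv hx, ← add_mul] at e3
    refine e3.trans ?_
    have : 0 ≤ x ^ (-(k:ℝ) - 1/2) := Real.rpow_nonneg (by linarith) _
    exact mul_le_mul_of_nonneg_right (le_max_right _ _) this
end

section
/- Let K ≥ 1 be an integer, let A₀,…,A_K > 0, and let f : ℝ → ℝ be a C^K function with sup_{t∈ℝ} (1+|t|)^{k+1/2} |∂_t^k f(t)| ≤ A_k for each 0 ≤ k ≤ K. Let v(x,Y) = ∫_ℝ P_Y(x−t) f(t) dt. Then for every integer k with 1 ≤ k ≤ K and every integer s ≥ 0 with 0 ≤ k − s ≤ 1, there is a constant C(k, A₀,…,A_k) such that |∂_x^k v(x,Y)| ≤ C(k, A₀,…,A_k) x^{−s−1/2} Y^{−(k−s)} for all x ≥ 1 and all Y > 0. -/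
open MeasureTheory

namespace PoissonAux

noncomputable def phi (t : ℝ) : ℝ := (1 + |t|)⁻¹ * (√|t|)⁻¹

lemma phi_nonneg (t : ℝ) : 0 ≤ phi t := by unfold phi; positivity

lemma phi_meas : Measurable phi := by unfold phi; fun_prop

lemma phi_integrable : Integrable phi := by
  have h1 : IntegrableOn phi (Set.Ioc 0 1) := by
    have h := (intervalIntegral.intervalIntegrable_rpow' (a := 0) (b := 1) (r := -(1/2)) (by norm_num))
    rw [intervalIntegrable_iff_integrableOn_Ioc_of_le zero_le_one] at h
    refine Integrable.mono' h phi_meas.aestronglyMeasurable ?_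
    refine (ae_restrict_iff' measurableSet_Ioc).2 (Filter.Eventually.of_forall ?_)
    intro t ht
    rw [Real.norm_of_nonneg (phi_nonneg t), phi, abs_of_pos ht.1, Real.rpow_neg ht.1.le, ← Real.sqrt_eq_rpow]
    have : (1 + t)⁻¹ ≤ 1 := inv_le_one_of_one_le₀ (by linarith [ht.1])
    exact mul_le_of_le_one_left (by positivity) this
  have h2 : IntegrableOn phi (Set.Ioi 1) := by
    have h := integrableOn_Ioi_rpow_of_lt (a := -(3/2)) (c := 1) (by norm_num) one_pos
    refine Integrable.mono' h phi_meas.aestronglyMeasurable ?_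
    refine (ae_restrict_iff' measurableSet_Ioi).2 (Filter.Eventually.of_forall ?_)
    intro t ht
    have ht : 1 < t := ht
    have h0 : 0 < t := by linarith
    rw [Real.norm_of_nonneg (phi_nonneg t), phi, abs_of_pos h0, Real.rpow_neg h0.le, ← mul_inv]
    have : t ^ (3/2 : ℝ) = t * √t := by
      rw [Real.sqrt_eq_rpow, ← Real.rpow_one_add' h0.le (by norm_num)]; norm_num
    rw [this]
    gcongr
    linarith
  have h3 : IntegrableOn phi (Set.Ioi 0) := by
    rw [← Set.Ioc_union_Ioi_eq_Ioi (zero_le_one' ℝ)]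
    exact h1.union h2
  have h4 := (integrable_indicator_iff measurableSet_Ioi).2 h3
  refine (h4.add h4.comp_neg).congr (Filter.Eventually.of_forall ?_)
  intro t
  have e : phi (-t) = phi t := by simp [phi]
  rcases lt_trichotomy t 0 with h | h | h
  · simp [Set.indicator, h, not_lt.2 h.le, e]
  · subst h; simp [phi]
  · simp [Set.indicator, h, not_lt.2 h.le, e]

noncomputable def J : ℝ := ∫ t, phi t

lemma J_nonneg : 0 ≤ J := integral_nonneg phi_nonneg

lemma phi_scale {y : ℝ} (hy : 0 < y) (t : ℝ) :
    (y + |t|)⁻¹ * (√|t|)⁻¹ = (y * √y)⁻¹ * phi (t / y) := by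
  unfold phi
  rw [abs_div, abs_of_pos hy, Real.sqrt_div (abs_nonneg t)]
  have := Real.sqrt_pos.2 hy
  by_cases ht : t = 0
  · simp [ht]
  have := Real.sqrt_pos.2 (abs_pos.2 ht)
  field_simp

lemma scale_int {y : ℝ} (hy : 0 < y) :
    Integrable (fun t : ℝ => (y + |t|)⁻¹ * (√|t|)⁻¹) := by
  simp_rw [phi_scale hy]
  exact (phi_integrable.comp_div hy.ne').const_mul _

lemma scale_integral {y : ℝ} (hy : 0 < y) :
    ∫ t : ℝ, (y + |t|)⁻¹ * (√|t|)⁻¹ = J / √y := by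
  simp_rw [phi_scale hy]
  rw [integral_const_mul, Measure.integral_comp_div, abs_of_pos hy]
  have := Real.sqrt_pos.2 hy
  simp only [smul_eq_mul]
  change _ * (y * J) = _
  field_simp

noncomputable def P (Y u : ℝ) : ℝ := Y / (Y^2 + u^2)

lemma P_eq {Y : ℝ} (hY : 0 < Y) (u : ℝ) : P Y u = Y⁻¹ * (1 + (u / Y)^2)⁻¹ := by
  unfold P
  field_simp

lemma P_cont {Y : ℝ} (hY : 0 < Y) : Continuous (P Y) := by
  unfold P
  exact continuous_const.div (by fun_prop) (fun u => by positivity)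

lemma P_nonneg {Y : ℝ} (hY : 0 < Y) (u : ℝ) : 0 ≤ P Y u := by unfold P; positivity

lemma P_int {Y : ℝ} (hY : 0 < Y) : Integrable (P Y) := by
  rw [funext (P_eq hY)]
  exact (integrable_inv_one_add_sq.comp_div hY.ne').const_mul _

lemma P_integral {Y : ℝ} (hY : 0 < Y) : ∫ u, P Y u = Real.pi := by
  rw [funext (P_eq hY), integral_const_mul,
    Measure.integral_comp_div (fun u : ℝ => (1 + u^2)⁻¹), integral_univ_inv_one_add_sq,
    abs_of_pos hY, smul_eq_mul]
  field_simp

lemma P_le {Y : ℝ} (hY : 0 < Y) (u : ℝ) : P Y u ≤ Y⁻¹ := by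
  rw [P_eq hY]
  refine mul_le_of_le_one_right (by positivity) (inv_le_one_of_one_le₀ ?_)
  nlinarith [sq_nonneg (u / Y)]

lemma poisson_deriv {Y : ℝ} (hY : 0 < Y) {g g' : ℝ → ℝ} {M M' : ℝ}
    (hg : ∀ t, HasDerivAt g (g' t) t) (hg' : Continuous g')
    (hM : ∀ t, |g t| ≤ M) (hM' : ∀ t, |g' t| ≤ M') (x : ℝ) :
    HasDerivAt (fun x' => poissonExt g x' Y) (poissonExt g' x Y) x := by
  have key : ∀ (h : ℝ → ℝ) (x : ℝ), poissonExt h x Y = ∫ u, P Y u * h (x - u) := by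
    intro h x
    rw [← integral_sub_left_eq_self _ _ x]
    simp [poissonExt, P]
  have hgc : Continuous g := continuous_iff_continuousAt.2 fun t => (hg t).continuousAt
  simp_rw [key]
  have := P_cont hY
  refine (hasDerivAt_integral_of_dominated_loc_of_deriv_le (s := Set.univ) (𝕜 := ℝ)
    (F := fun x u => P Y u * g (x - u)) (F' := fun x u => P Y u * g' (x - u)) (bound := fun u => P Y u * M') Filter.univ_mem ?_ ?_ ?_ ?_ ((P_int hY).mul_const _) ?_).2
  · exact Filter.Eventually.of_forall fun x => (by fun_prop : Continuous _).aestronglyMeasurable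
  · refine ((P_int hY).mul_const M).mono' (by fun_prop : Continuous _).aestronglyMeasurable ?_
    refine Filter.Eventually.of_forall fun u => ?_
    rw [norm_mul, Real.norm_of_nonneg (P_nonneg hY u)]
    exact mul_le_mul_of_nonneg_left (hM _) (P_nonneg hY u)
  · exact (by fun_prop : Continuous _).aestronglyMeasurable
  · refine Filter.Eventually.of_forall fun u x _ => ?_
    rw [norm_mul, Real.norm_of_nonneg (P_nonneg hY u)]
    exact mul_le_mul_of_nonneg_left (hM' _) (P_nonneg hY u)
  · refine Filter.Eventually.of_forall fun u x _ => ?_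
    exact ((hg (x - u)).comp_sub_const x u).const_mul _

/-- the kernel `∂_t^i P_Y(x-t)` -/
noncomputable def G (x Y : ℝ) (i : ℕ) (t : ℝ) : ℝ :=
  ((i.factorial : ℂ) * ((((x - t : ℝ) : ℂ) - Y * Complex.I) ^ (i+1))⁻¹).im

lemma w_ne {Y : ℝ} (hY : 0 < Y) (u : ℝ) : ((u : ℂ) - Y * Complex.I) ≠ 0 := by
  intro h
  have := congrArg Complex.im h
  simp at this
  exact hY.ne' this

lemma G_zero (x Y t : ℝ) : G x Y 0 t = P Y (x - t) := by
  simp [G, P, Complex.inv_im, Complex.normSq_apply]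
  ring

lemma G_deriv {Y : ℝ} (hY : 0 < Y) (x : ℝ) (i : ℕ) (t : ℝ) :
    HasDerivAt (G x Y i) (G x Y (i+1) t) t := by
  have hw := w_ne hY (x - t)
  have h1 : HasDerivAt (fun t : ℝ => (((x - t : ℝ) : ℂ) - Y * Complex.I)) (-1 : ℂ) t := by
    have : HasDerivAt (fun t : ℝ => ((x - t : ℝ) : ℂ)) (((-1 : ℝ)) : ℂ) t :=
      HasDerivAt.ofReal_comp ((hasDerivAt_id t).const_sub x)
    simpa using this.sub_const (Y * Complex.I)
  have h2 := ((h1.pow (i+1)).inv (pow_ne_zero _ hw)).const_mul (i.factorial : ℂ)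
  have h3 := Complex.imCLM.hasFDerivAt.comp_hasDerivAt t h2
  refine h3.congr_deriv ?_
  simp only [G, Complex.imCLM_apply]
  congr 1
  rw [Nat.factorial_succ]
  push_cast at hw ⊢
  simp only [Pi.pow_apply, Complex.ofReal_sub, Nat.add_sub_cancel]
  field_simp
  ring

lemma G_cont {Y : ℝ} (hY : 0 < Y) (x : ℝ) (i : ℕ) : Continuous (G x Y i) :=
  continuous_iff_continuousAt.2 fun t => (G_deriv hY x i t).continuousAt

lemma w_norm_u (Y u : ℝ) : |u| ≤ ‖((u : ℂ) - Y * Complex.I)‖ := by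
  have := Complex.abs_re_le_norm ((u : ℂ) - Y * Complex.I)
  simpa using this

lemma w_norm_Y {Y : ℝ} (hY : 0 < Y) (u : ℝ) : Y ≤ ‖((u : ℂ) - Y * Complex.I)‖ := by
  have := Complex.abs_im_le_norm ((u : ℂ) - Y * Complex.I)
  simpa [abs_of_pos hY] using this

lemma w_norm_sq (Y u : ℝ) : ‖((u : ℂ) - Y * Complex.I)‖^2 = Y^2+u^2 := by
  rw [Complex.sq_norm, Complex.normSq_apply]
  simp
  ring

lemma G_le_w (x Y : ℝ) (i : ℕ) (t : ℝ) :
    |G x Y i t| ≤ i.factorial * (‖(((x - t : ℝ) : ℂ) - Y * Complex.I)‖ ^ (i+1))⁻¹ := by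
  refine (Complex.abs_im_le_norm _).trans (le_of_eq ?_)
  simp

lemma G_le_P {Y : ℝ} (hY : 0 < Y) (x : ℝ) (i : ℕ) (t : ℝ) :
    |G x Y i t| ≤ i.factorial * (Y^i)⁻¹ * P Y (x - t) := by
  rcases i with _ | i
  · rw [G_zero, abs_of_nonneg (P_nonneg hY _)]; simp
  refine (G_le_w x Y _ t).trans ?_
  rw [mul_assoc]
  gcongr
  unfold P
  rw [← w_norm_sq]
  have h := w_norm_Y hY (x - t)
  set w := ‖(((x - t : ℝ) : ℂ) - Y * Complex.I)‖
  have hw : 0 < w := hY.trans_le h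
  have : (Y ^ (i+1))⁻¹ * (Y / w^2) = (Y^i * w^2)⁻¹ := by field_simp; ring
  rw [this, show i + 1 + 1 = i + 2 from rfl, pow_add]
  gcongr

lemma G_le {Y : ℝ} (hY : 0 < Y) (x : ℝ) {i p e : ℕ} (h : p + e = i + 1) {t : ℝ} (ht : t < x) :
    |G x Y i t| ≤ i.factorial * ((x - t)^p * Y^e)⁻¹ := by
  refine (G_le_w x Y _ t).trans ?_
  have h1 := w_norm_Y hY (x - t)
  have h2 := w_norm_u Y (x - t)
  have h0 : 0 < x - t := by linarith
  rw [abs_of_pos h0] at h2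
  rw [← h, pow_add]
  gcongr

noncomputable def D (A : ℕ → ℝ) : ℕ → ℕ → ℝ
  | 0, i => 2 * i.factorial * A 0 * J
  | m+1, i => i.factorial * A m + D A m (i+1)

lemma G_mul_int {Y : ℝ} (hY : 0 < Y) (x : ℝ) (i : ℕ) {g : ℝ → ℝ} (hg : Continuous g) {M : ℝ}
    (hM : ∀ t, |g t| ≤ M) : Integrable (fun t => G x Y i t * g t) := by
  have hc := G_cont hY x i
  refine ((((P_int hY).comp_sub_left x).const_mul (i.factorial * (Y^i)⁻¹)).mul_const M).mono'
    (by fun_prop : Continuous _).aestronglyMeasurable (Filter.Eventually.of_forall fun t => ?_)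
  rw [norm_mul]
  have h1 := G_le_P hY x i t
  exact mul_le_mul h1 (hM t) (abs_nonneg _) ((abs_nonneg _).trans h1)

lemma left_bound {K : ℕ} {A : ℕ → ℝ} {h : ℕ → ℝ → ℝ}
    (hder : ∀ j < K, ∀ t, HasDerivAt (h j) (h (j+1) t) t)
    (hcont : ∀ j ≤ K, Continuous (h j))
    (hb : ∀ j ≤ K, ∀ t, |h j t| ≤ A j)
    (hw : ∀ j ≤ K, ∀ t, |t|^j * √|t| * |h j t| ≤ A j)
    {y Y : ℝ} (hy : 0 < y) (hY : 0 < Y) {e : ℕ} (he : e ≤ 1) :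
    ∀ m i s : ℕ, m ≤ K → i + m = s + e →
      |∫ t in Set.Iic y, G (2*y) Y i t * h m t| ≤ D A m i * (y^s * √y * Y^e)⁻¹ := by
  intro m
  have hsy := Real.sqrt_pos.2 hy
  induction m with
  | zero =>
    intro i s hm his
    have hA : 0 ≤ A 0 := (abs_nonneg _).trans (hb 0 hm 0)
    have hmaj : Integrable (fun t : ℝ => (2 * i.factorial * A 0 * (y^s * Y^e)⁻¹) *
      ((y + |t|)⁻¹ * (√|t|)⁻¹)) := (scale_int hy).const_mul _
    have h1 : ‖∫ t in Set.Iic y, G (2*y) Y i t * h 0 t‖ ≤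
        ∫ t in Set.Iic y, (2 * i.factorial * A 0 * (y^s * Y^e)⁻¹) * ((y + |t|)⁻¹ * (√|t|)⁻¹) := by
      refine norm_integral_le_of_norm_le hmaj.integrableOn ?_
      rw [ae_restrict_iff' measurableSet_Iic]
      filter_upwards [Measure.ae_ne volume (0:ℝ)] with t ht0 hty
      have hty : t ≤ y := hty
      have hlt : t < 2 * y := by linarith
      have g1 := G_le hY (2*y) (i := i) (p := s+1) (e := e) (by omega) hlt
      have hst : 0 < √|t| := Real.sqrt_pos.2 (abs_pos.2 ht0)
      have g2 : |h 0 t| ≤ A 0 * (√|t|)⁻¹ := by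
        rw [← div_eq_mul_inv, le_div_iff₀ hst]
        have := hw 0 hm t
        simp at this
        linarith
      have hu : (y + |t|) / 2 ≤ 2 * y - t := by
        rcases abs_cases t with h | h <;> linarith
      have g3 : ((2*y - t)^(s+1) * Y^e)⁻¹ ≤ 2 * (y^s * Y^e)⁻¹ * (y + |t|)⁻¹ := by
        have e1 : 2 * (y^s * Y^e)⁻¹ * (y + |t|)⁻¹ = (y^s * ((y + |t|)/2) * Y^e)⁻¹ := by
          have : 0 < y + |t| := by positivity
          field_simp
        rw [e1, pow_succ]
        have : y ≤ 2 * y - t := by linarith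
        gcongr
      rw [norm_mul]
      calc |G (2*y) Y i t| * |h 0 t|
          ≤ (i.factorial * (2 * (y^s * Y^e)⁻¹ * (y + |t|)⁻¹)) * (A 0 * (√|t|)⁻¹) := by
            refine mul_le_mul (g1.trans ?_) g2 (abs_nonneg _) (by positivity)
            gcongr
        _ = _ := by ring
    refine h1.trans ((setIntegral_le_integral hmaj
      (Filter.Eventually.of_forall fun t => by positivity)).trans (le_of_eq ?_))
    rw [integral_const_mul, scale_integral hy, D]
    field_simp
  | succ m ih =>
    intro i s hm his
    have hmK : m ≤ K := by omega
    have i1 := (G_mul_int hY (2*y) (i+1) (hcont m hmK) (hb m hmK)).integrableOn (s := Set.Iic y)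
    have i2 := (G_mul_int hY (2*y) i (hcont (m+1) hm) (hb (m+1) hm)).integrableOn (s := Set.Iic y)
    have i0 := (G_mul_int hY (2*y) i (hcont m hmK) (hb m hmK)).integrableOn (s := Set.Iic y)
    have hd : ∀ t ∈ Set.Iic y, HasDerivAt (fun t => G (2*y) Y i t * h m t)
        (G (2*y) Y (i+1) t * h m t + G (2*y) Y i t * h (m+1) t) t :=
      fun t _ => (G_deriv hY (2*y) i t).mul (hder m (by omega) t)
    have ht := tendsto_zero_of_hasDerivAt_of_integrableOn_Iic hd (i1.add i2) i0
    have hI := integral_Iic_of_hasDerivAt_of_tendsto' hd (i1.add i2) ht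
    rw [integral_add i1 i2] at hI
    have ih' := ih (i+1) s hmK (by omega)
    obtain ⟨p, hp⟩ : ∃ p, p + e = i + 1 := ⟨i + 1 - e, by omega⟩
    have hs : s = p + m := by omega
    have hB : |G (2*y) Y i y * h m y| ≤ i.factorial * A m * (y^s * √y * Y^e)⁻¹ := by
      have g1 := G_le hY (2*y) hp (t := y) (by linarith)
      rw [show 2 * y - y = y by ring] at g1
      have g2 : |h m y| ≤ A m * (y^m * √y)⁻¹ := by
        rw [← div_eq_mul_inv, le_div_iff₀ (by positivity)]
        have := hw m hmK y
        rw [abs_of_pos hy] at this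
        linarith
      rw [abs_mul]
      refine (mul_le_mul g1 g2 (abs_nonneg _) (by positivity)).trans (le_of_eq ?_)
      rw [hs, pow_add]
      field_simp
    have e1 : ∫ t in Set.Iic y, G (2*y) Y i t * h (m+1) t =
        G (2*y) Y i y * h m y - ∫ t in Set.Iic y, G (2*y) Y (i+1) t * h m t := by linarith
    rw [e1, D, add_mul]
    exact (abs_sub _ _).trans (add_le_add hB ih')

lemma right_bound {k : ℕ} {a : ℝ} {g : ℝ → ℝ} 
    (hw : ∀ t, |t|^k * √|t| * |g t| ≤ a)
    {y Y : ℝ} (hy : 0 < y) (hY : 0 < Y) {e s : ℕ} (he : e ≤ 1) (hk : 1 ≤ k) (hks : k = s + e) :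
      |∫ t in Set.Ioi y, G (2*y) Y 0 t * g t| ≤ (Real.pi * a) * (y^s * √y * Y^e)⁻¹ := by
  have hsy := Real.sqrt_pos.2 hy
  have ha : 0 ≤ a := le_trans (by positivity) (hw 0)
  have hg : ∀ t, 0 < t → |g t| ≤ a * (t^k * √t)⁻¹ := by
    intro t ht
    have := Real.sqrt_pos.2 ht
    rw [← div_eq_mul_inv, le_div_iff₀ (by positivity)]
    have := hw t
    rw [abs_of_pos ht] at this
    linarith
  obtain rfl | rfl : e = 0 ∨ e = 1 := by omega
  · have hmaj : Integrable (fun t : ℝ => (a * (y^k * √y)⁻¹) * P Y (2*y - t)) :=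
      ((P_int hY).comp_sub_left (2*y)).const_mul _
    have h1 : ‖∫ t in Set.Ioi y, G (2*y) Y 0 t * g t‖ ≤
        ∫ t in Set.Ioi y, (a * (y^k * √y)⁻¹) * P Y (2*y - t) := by
      refine norm_integral_le_of_norm_le hmaj.integrableOn ?_
      rw [ae_restrict_iff' measurableSet_Ioi]
      refine Filter.Eventually.of_forall fun t ht => ?_
      have ht : y < t := ht
      have h0 := hy.trans ht
      rw [norm_mul, G_zero, Real.norm_of_nonneg (P_nonneg hY _), mul_comm]
      refine mul_le_mul_of_nonneg_right ((hg t (hy.trans ht)).trans ?_) (P_nonneg hY _)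
      gcongr
    refine h1.trans ((setIntegral_le_integral hmaj
      (Filter.Eventually.of_forall fun t => mul_nonneg (by positivity) (P_nonneg hY _))).trans
        (le_of_eq ?_))
    rw [integral_const_mul, integral_sub_left_eq_self (P Y) volume (2*y), P_integral hY, hks]
    simp
    ring
  · have hr : -(k:ℝ) - 1/2 < -1 := by
      have : (1:ℝ) ≤ k := by exact_mod_cast hk
      linarith
    have hmaj : IntegrableOn (fun t : ℝ => (a * Y⁻¹) * t ^ (-(k:ℝ) - 1/2)) (Set.Ioi y) :=
      (integrableOn_Ioi_rpow_of_lt hr hy).const_mul _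
    have h1 : ‖∫ t in Set.Ioi y, G (2*y) Y 0 t * g t‖ ≤
        ∫ t in Set.Ioi y, (a * Y⁻¹) * t ^ (-(k:ℝ) - 1/2) := by
      refine norm_integral_le_of_norm_le hmaj ?_
      rw [ae_restrict_iff' measurableSet_Ioi]
      refine Filter.Eventually.of_forall fun t ht => ?_
      have ht : y < t := ht
      have h0 := hy.trans ht
      rw [norm_mul, G_zero, Real.norm_of_nonneg (P_nonneg hY _)]
      have e2 : t ^ (-(k:ℝ) - 1/2) = (t^k * √t)⁻¹ := by
        rw [← neg_add', Real.rpow_neg h0.le, Real.rpow_add h0, Real.rpow_natCast, Real.sqrt_eq_rpow]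
      rw [e2]
      refine (mul_le_mul (P_le hY _) (hg t h0) (abs_nonneg _) (by positivity)).trans (le_of_eq ?_)
      ring
    refine h1.trans ?_
    rw [integral_const_mul, integral_Ioi_rpow_of_lt hr hy]
    have e3 : y ^ (-(k:ℝ) - 1/2 + 1) = (y^s * √y)⁻¹ := by
      rw [hks, show -((s+1 : ℕ):ℝ) - 1/2 + 1 = -((s:ℝ) + 1/2) by push_cast; ring,
        Real.rpow_neg hy.le, Real.rpow_add hy, Real.rpow_natCast, Real.sqrt_eq_rpow]
    have hk1 : (1:ℝ) ≤ k := by exact_mod_cast hk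
    have e4 : -(y^s * √y)⁻¹ / (-(k:ℝ) - 1/2 + 1) = (y^s * √y)⁻¹ * ((k:ℝ) - 1/2)⁻¹ := by
      rw [show -(k:ℝ) - 1/2 + 1 = -((k:ℝ) - 1/2) by ring, neg_div_neg_eq, div_eq_mul_inv]
    rw [e3, e4]
    have e5 : ((k:ℝ) - 1/2)⁻¹ ≤ Real.pi := by
      have : ((k:ℝ) - 1/2)⁻¹ ≤ (1/2)⁻¹ := by
        gcongr
        linarith
      linarith [Real.pi_gt_three]
    calc a * Y⁻¹ * ((y^s * √y)⁻¹ * ((k:ℝ) - 1/2)⁻¹)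
        ≤ a * Y⁻¹ * ((y^s * √y)⁻¹ * Real.pi) := by gcongr
      _ = _ := by field_simp

end PoissonAux

theorem stmt7 (K : ℕ) (hK : 1 ≤ K) (A : ℕ → ℝ) :
    ∀ k : ℕ, 1 ≤ k → k ≤ K → ∃ C > (0:ℝ),
      ∀ f : ℝ → ℝ, ContDiff ℝ K f →
        (∀ j : ℕ, j ≤ K →
          ∀ t : ℝ, (1 + |t|) ^ ((j:ℝ) + 1/2) * |iteratedDeriv j f t| ≤ A j) →
        ∀ s : ℕ, s ≤ k → k ≤ s + 1 →
        ∀ x : ℝ, 1 ≤ x → ∀ Y : ℝ, 0 < Y →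
          |iteratedDeriv k (fun x' => poissonExt f x' Y) x|
            ≤ C * x ^ (-(s:ℝ) - 1/2) * Y ^ (-((k:ℝ) - (s:ℝ))) := by
  intro k hk hkK
  refine ⟨(|PoissonAux.D A k 0| + Real.pi * |A k| + 1) * 2^(k+1), by positivity, ?_⟩
  intro f hf hA s hsk hks x hx Y hY
  have hcont : ∀ j ≤ K, Continuous (iteratedDeriv j f) := fun j hj =>
    hf.continuous_iteratedDeriv j (by exact_mod_cast hj)
  have hder : ∀ j < K, ∀ t, HasDerivAt (iteratedDeriv j f) (iteratedDeriv (j+1) f t) t := by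
    intro j hj t
    rw [iteratedDeriv_succ]
    exact (hf.differentiable_iteratedDeriv j (by exact_mod_cast hj) t).hasDerivAt
  have hb : ∀ j ≤ K, ∀ t, |iteratedDeriv j f t| ≤ A j := by
    intro j hj t
    refine le_trans (le_mul_of_one_le_left (abs_nonneg _) ?_) (hA j hj t)
    exact Real.one_le_rpow (by linarith [abs_nonneg t]) (by positivity)
  have hw : ∀ j ≤ K, ∀ t, |t|^j * √|t| * |iteratedDeriv j f t| ≤ A j := by
    intro j hj t
    refine le_trans (mul_le_mul_of_nonneg_right ?_ (abs_nonneg _)) (hA j hj t)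
    have h1 : (0:ℝ) < 1 + |t| := by positivity
    rw [Real.rpow_add h1, Real.rpow_natCast, ← Real.sqrt_eq_rpow]
    gcongr <;> linarith
  have hid : ∀ j ≤ K, iteratedDeriv j (fun x' => poissonExt f x' Y) =
      fun x' => poissonExt (iteratedDeriv j f) x' Y := by
    intro j
    induction j with
    | zero => intro _; simp
    | succ j ih =>
      intro hj
      rw [iteratedDeriv_succ, ih (by omega)]
      funext x'
      exact (PoissonAux.poisson_deriv hY (hder j (by omega)) (hcont (j+1) hj)
        (hb j (by omega)) (hb (j+1) hj) x').deriv
  rw [hid k hkK]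
  obtain ⟨e, he⟩ : ∃ e, k = s + e := ⟨k - s, by omega⟩
  have he1 : e ≤ 1 := by omega
  obtain ⟨y, rfl⟩ : ∃ y, x = 2 * y := ⟨x / 2, by ring⟩
  have hy : 0 < y := by linarith
  have hsy := Real.sqrt_pos.2 hy
  have hL := PoissonAux.left_bound hder hcont hb hw hy hY he1 k 0 s hkK (by omega)
  have hR := PoissonAux.right_bound (hw k hkK) hy hY he1 hk he
  have hGint := PoissonAux.G_mul_int hY (2*y) 0 (hcont k hkK) (hb k hkK)
  have hsplit := integral_add_compl (measurableSet_Iic (a := y)) hGint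
  rw [Set.compl_Iic] at hsplit
  have hval : poissonExt (iteratedDeriv k f) (2*y) Y =
      ∫ t, PoissonAux.G (2*y) Y 0 t * iteratedDeriv k f t := by
    simp only [PoissonAux.G_zero]
    rfl
  simp only [hval]
  rw [← hsplit]
  have h2y : (0:ℝ) < 2 * y := by linarith
  have e1 : (2*y) ^ (-(s:ℝ) - 1/2) = ((2*y)^s * √(2*y))⁻¹ := by
    rw [← neg_add', Real.rpow_neg h2y.le, Real.rpow_add h2y, Real.rpow_natCast, Real.sqrt_eq_rpow]
  have e2 : Y ^ (-((k:ℝ) - (s:ℝ))) = (Y^e)⁻¹ := by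
    rw [he, Real.rpow_neg hY.le]
    push_cast
    rw [add_sub_cancel_left, Real.rpow_natCast]
  rw [e1, e2]
  have h2s : 0 < √(2*y) := Real.sqrt_pos.2 h2y
  have e3 : (y^s * √y)⁻¹ ≤ 2^(k+1) * ((2*y)^s * √(2*y))⁻¹ := by
    rw [← div_eq_mul_inv, le_div_iff₀ (by positivity), inv_mul_le_iff₀ (by positivity)]
    have q1 : √(2*y) ≤ 2 * √y := by
      rw [Real.sqrt_le_left (by positivity), mul_pow, Real.sq_sqrt hy.le]
      linarith
    have q2 : (2:ℝ)^s ≤ 2^k := pow_le_pow_right₀ (by norm_num) hsk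
    calc (2*y)^s * √(2*y) ≤ (2^k * y^s) * (2 * √y) := by
          rw [mul_pow]
          gcongr
      _ = _ := by ring
  have hAk : 0 ≤ |A k| := abs_nonneg _
  calc |_ + _| ≤ _ := abs_add_le _ _
    _ ≤ _ := add_le_add hL hR
    _ = (PoissonAux.D A k 0 + Real.pi * A k) * ((y^s * √y)⁻¹ * (Y^e)⁻¹) := by
        rw [mul_inv]; ring
    _ ≤ (|PoissonAux.D A k 0| + Real.pi * |A k| + 1) * ((2^(k+1) * ((2*y)^s * √(2*y))⁻¹) * (Y^e)⁻¹) := by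
        have q : PoissonAux.D A k 0 + Real.pi * A k ≤ |PoissonAux.D A k 0| + Real.pi * |A k| + 1 := by
          have := le_abs_self (PoissonAux.D A k 0)
          have := mul_le_mul_of_nonneg_left (le_abs_self (A k)) Real.pi_pos.le
          linarith
        gcongr
    _ = _ := by ring
end

section
/- Let N > 0, let Ω = (1,∞) × (0,N), and let 0 ≤ m₁ < m₂ be real numbers. Let (f_n) be a sequence of functions on Ω such that sup_n ∫_Ω f_n(x,y)² x^{2m₂} dx dy < ∞ and such that for every bounded open subset U of Ω the sequence is uniformly bounded in H¹(U), i.e. sup_n ( ‖f_n‖_{L²(U)} + ‖∇f_n‖_{L²(U)} ) < ∞ (gradients in the weak sense). Then there is a subsequence (f_{n_j}) that is Cauchy in the weighted space L²(Ω, x^{2m₁} dx dy), i.e. ∫_Ω |f_{n_j} − f_{n_k}|² x^{2m₁} dx dy → 0 as j, k → ∞. -/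
open MeasureTheory
open scoped ENNReal

lemma aux_quad {α : Type*} [MeasurableSpace α] (μ : Measure α) [IsFiniteMeasure μ] (g : α → ℝ)
    (hint : Integrable g μ) (hint2 : Integrable (fun p => (g p)^2) μ) (a b c : ℝ) (F : α → ℝ)
    (hF : ∀ p, F p = a * (g p)^2 + b * g p + c) :
    Integrable F μ ∧ ∫ p, F p ∂μ = a * (∫ p, (g p)^2 ∂μ) + b * (∫ p, g p ∂μ)
      + c * (μ Set.univ).toReal := by
  have i1 : Integrable (fun p => a * (g p)^2) μ := hint2.const_mul a
  have i2 : Integrable (fun p => b * g p) μ := hint.const_mul b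
  have i3 : Integrable (fun p => a * (g p)^2 + b * g p) μ := i1.add i2
  have i4 : Integrable (fun p => a * (g p)^2 + b * g p + c) μ := i3.add (integrable_const c)
  have hF' : F = fun p => a * (g p)^2 + b * g p + c := funext hF
  refine ⟨hF' ▸ i4, ?_⟩
  rw [hF', integral_add i3 (integrable_const c), integral_add i1 i2, integral_const_mul,
    integral_const_mul, integral_const]
  simp [Measure.real, mul_comm]

lemma aux_one_d (u u' : ℝ → ℝ) (hu' : Measurable u') (a b : ℝ) (hab : a ≤ b)
    (hd : ∀ s ∈ Set.Icc a b, HasDerivAt u (u' s) s) :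
    ENNReal.ofReal ((u b - u a)^2) ≤
      ENNReal.ofReal (b - a) * ∫⁻ s in Set.Icc a b, ENNReal.ofReal ((u' s)^2) := by
  rcases hab.eq_or_lt with rfl | hlt
  · simp
  by_cases htop : ∫⁻ s in Set.Icc a b, ENNReal.ofReal ((u' s)^2) = ⊤
  · rw [htop, ENNReal.mul_top]
    · exact le_top
    · simpa using hlt
  have hint2 : Integrable (fun s => (u' s)^2) (volume.restrict (Set.Icc a b)) := by
    refine ⟨(hu'.pow_const 2).aestronglyMeasurable, ?_⟩
    rw [hasFiniteIntegral_iff_ofReal (Filter.Eventually.of_forall fun s => sq_nonneg _)]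
    exact lt_top_iff_ne_top.2 htop
  have hint : Integrable u' (volume.restrict (Set.Icc a b)) := by
    refine Integrable.mono' (hint2.add (integrable_const (1:ℝ))) hu'.aestronglyMeasurable ?_
    refine Filter.Eventually.of_forall fun s => ?_
    simp only [Pi.add_apply, Real.norm_eq_abs]
    nlinarith [sq_abs (u' s), sq_nonneg (|u' s| - 1)]
  have hftc : ∫ s in a..b, u' s = u b - u a := by
    apply intervalIntegral.integral_eq_sub_of_hasDerivAt
    · intro s hs; rw [Set.uIcc_of_le hab] at hs; exact hd s hs
    · rw [intervalIntegrable_iff_integrableOn_Icc_of_le hab]; exact hint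
  rw [intervalIntegral.integral_of_le hab, ← integral_Icc_eq_integral_Ioc] at hftc
  rw [← ofReal_integral_eq_lintegral_ofReal hint2 (Filter.Eventually.of_forall fun s => sq_nonneg _),
    ← ENNReal.ofReal_mul (by linarith)]
  apply ENNReal.ofReal_le_ofReal
  set c := u b - u a with hc
  set S := ∫ s in Set.Icc a b, (u' s)^2 with hS
  have h0 : 0 ≤ ∫ s in Set.Icc a b, ((b - a) * u' s - c)^2 := integral_nonneg fun s => sq_nonneg _
  have h1 : ∫ s in Set.Icc a b, ((b - a) * u' s - c)^2
      = (b-a)^2 * S - 2 * (b-a) * c * c + (b-a) * c^2 := by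
    rw [(aux_quad _ u' hint hint2 ((b-a)^2) (-(2 * (b-a) * c)) (c^2) _ (fun s => by ring)).2, hftc]
    simp [hab]
    ring
  have h2 : 0 ≤ (b-a) * ((b-a) * S - c^2) := by rw [h1] at h0; linarith
  have := nonneg_of_mul_nonneg_right h2 (by linarith)
  linarith

lemma aux_poincare (A B : Set ℝ) (hAm : MeasurableSet A) (hBm : MeasurableSet B)
    (hAo : A.OrdConnected) (hBo : B.OrdConnected) (h : ℝ)
    (hA : ∀ x ∈ A, ∀ x' ∈ A, |x - x'| ≤ h) (hB : ∀ x ∈ B, ∀ x' ∈ B, |x - x'| ≤ h)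
    (g : ℝ × ℝ → ℝ) (hg : Measurable g) (hd : ∀ p ∈ A ×ˢ B, DifferentiableAt ℝ g p)
    (hfin : ∫⁻ p in A ×ˢ B, ENNReal.ofReal ((g p)^2) ≠ ⊤) :
    ∫⁻ p in A ×ˢ B, ENNReal.ofReal ((g p)^2) ≤
      ENNReal.ofReal ((∫ p in A ×ˢ B, g p)^2 / (volume (A ×ˢ B)).toReal) +
      ENNReal.ofReal (2 * h^2) * ∫⁻ p in A ×ˢ B, ENNReal.ofReal (‖fderiv ℝ g p‖^2) := by
  rcases (A ×ˢ B).eq_empty_or_nonempty with hemp | ⟨p0, hp0⟩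
  · rw [hemp]; simp
  have hh : 0 ≤ h := by simpa using hA p0.1 hp0.1 p0.1 hp0.1
  set G : ℝ × ℝ → ℝ≥0∞ := fun p => ENNReal.ofReal (‖fderiv ℝ g p‖^2) with hG
  have hGm : Measurable G := ((measurable_fderiv ℝ g).norm.pow_const 2).ennreal_ofReal
  have hvol : ∀ C : Set ℝ, (∀ x ∈ C, ∀ x' ∈ C, |x - x'| ≤ h) → volume C ≤ ENNReal.ofReal h := by
    intro C hC
    refine (Real.volume_le_diam C).trans (Metric.ediam_le fun x hx y hy => ?_)
    rw [edist_dist, Real.dist_eq]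
    exact ENNReal.ofReal_le_ofReal (hC x hx y hy)
  set μ := (volume : Measure (ℝ × ℝ)).restrict (A ×ˢ B) with hμ
  have hμp : μ = (volume.restrict A).prod (volume.restrict B) := by
    rw [hμ, Measure.volume_eq_prod, Measure.prod_restrict]
  have fA : IsFiniteMeasure (volume.restrict A) :=
    ⟨by simpa using (hvol A hA).trans_lt ENNReal.ofReal_lt_top⟩
  have fB : IsFiniteMeasure (volume.restrict B) :=
    ⟨by simpa using (hvol B hB).trans_lt ENNReal.ofReal_lt_top⟩
  have fμ : IsFiniteMeasure μ := by rw [hμp]; infer_instance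
  have hμu : volume (A ×ˢ B) = μ Set.univ := by simp [hμ]
  -- line estimates
  have hx : ∀ y ∈ B, ∀ x ∈ A, ∀ x' ∈ A, ENNReal.ofReal ((g (x,y) - g (x',y))^2) ≤
      ENNReal.ofReal h * ∫⁻ s in A, G (s, y) := by
    intro y hy
    have key : ∀ x ∈ A, ∀ x' ∈ A, x ≤ x' → ENNReal.ofReal ((g (x',y) - g (x,y))^2) ≤
      ENNReal.ofReal h * ∫⁻ s in A, G (s, y) := by
      intro x hx x' hx' hle
      have hsub := hAo.out hx hx'
      refine (aux_one_d (fun s => g (s,y)) (fun s => fderiv ℝ g (s,y) (1,0))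
        ((measurable_fderiv_apply_const ℝ g (1,0)).comp (by fun_prop)) x x' hle ?_).trans ?_
      · intro s hs
        have h1 := (hd (s,y) ⟨hsub hs, hy⟩).hasFDerivAt
        have h2 : HasDerivAt (fun s : ℝ => (s, y)) ((1:ℝ), (0:ℝ)) s :=
          (hasDerivAt_id s).prodMk (hasDerivAt_const s y)
        exact h1.comp_hasDerivAt s h2
      · gcongr ?_ * ?_
        · exact ENNReal.ofReal_le_ofReal ((le_abs_self _).trans (hA x' hx' x hx))
        · refine (lintegral_mono fun s => ?_).trans (lintegral_mono_set hsub)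
          apply ENNReal.ofReal_le_ofReal
          rw [← sq_abs, ← Real.norm_eq_abs]
          gcongr
          refine ((fderiv ℝ g (s,y)).le_opNorm _).trans ?_
          simp [Prod.norm_def]
    intro x hx x' hx'
    rcases le_total x x' with hle | hle
    · rw [← neg_sq, neg_sub]; exact key x hx x' hx' hle
    · exact key x' hx' x hx hle
  have hy : ∀ x ∈ A, ∀ y ∈ B, ∀ y' ∈ B, ENNReal.ofReal ((g (x,y) - g (x,y'))^2) ≤
      ENNReal.ofReal h * ∫⁻ s in B, G (x, s) := by
    intro x hx
    have key : ∀ y ∈ B, ∀ y' ∈ B, y ≤ y' → ENNReal.ofReal ((g (x,y') - g (x,y))^2) ≤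
      ENNReal.ofReal h * ∫⁻ s in B, G (x, s) := by
      intro y hy y' hy' hle
      have hsub := hBo.out hy hy'
      refine (aux_one_d (fun s => g (x,s)) (fun s => fderiv ℝ g (x,s) (0,1))
        ((measurable_fderiv_apply_const ℝ g (0,1)).comp (by fun_prop)) y y' hle ?_).trans ?_
      · intro s hs
        have h1 := (hd (x,s) ⟨hx, hsub hs⟩).hasFDerivAt
        have h2 : HasDerivAt (fun s : ℝ => (x, s)) ((0:ℝ), (1:ℝ)) s :=
          (hasDerivAt_const s x).prodMk (hasDerivAt_id s)
        exact h1.comp_hasDerivAt s h2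
      · gcongr ?_ * ?_
        · exact ENNReal.ofReal_le_ofReal ((le_abs_self _).trans (hB y' hy' y hy))
        · refine (lintegral_mono fun s => ?_).trans (lintegral_mono_set hsub)
          apply ENNReal.ofReal_le_ofReal
          rw [← sq_abs, ← Real.norm_eq_abs]
          gcongr
          refine ((fderiv ℝ g (x,s)).le_opNorm _).trans ?_
          simp [Prod.norm_def]
    intro y hy y' hy'
    rcases le_total y y' with hle | hle
    · rw [← neg_sq, neg_sub]; exact key y hy y' hy' hle
    · exact key y' hy' y hy hle
  have hpq : ∀ p ∈ A ×ˢ B, ∀ q ∈ A ×ˢ B, ENNReal.ofReal ((g p - g q)^2) ≤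
      ENNReal.ofReal (2 * h) * ((∫⁻ s in A, G (s, p.2)) + ∫⁻ t in B, G (q.1, t)) := by
    rintro ⟨x, y⟩ ⟨hx1, hy1⟩ ⟨x', y'⟩ ⟨hx2, hy2⟩
    have e1 := hx y hy1 x hx1 x' hx2
    have e2 := hy x' hx2 y hy1 y' hy2
    have e3 : (g (x,y) - g (x',y'))^2 ≤
        2 * ((g (x,y) - g (x',y))^2 + (g (x',y) - g (x',y'))^2) := by
      nlinarith [sq_nonneg ((g (x,y) - g (x',y)) - (g (x',y) - g (x',y')))]
    refine (ENNReal.ofReal_le_ofReal e3).trans ?_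
    rw [ENNReal.ofReal_mul (by norm_num), ENNReal.ofReal_add (sq_nonneg _) (sq_nonneg _),
      ENNReal.ofReal_mul (by norm_num), mul_assoc]
    gcongr
    rw [mul_add]
    exact add_le_add e1 e2
  set T := ∫⁻ p, G p ∂μ with hT
  have hT1 : ∫⁻ p, (∫⁻ s in A, G (s, p.2)) ∂μ = volume A * T := by
    rw [hT, hμp, lintegral_prod _ (by fun_prop), lintegral_prod_symm' _ hGm]
    simp [mul_comm]
  have hT2 : ∫⁻ p, (∫⁻ t in B, G (p.1, t)) ∂μ = volume B * T := by
    rw [hT, hμp, lintegral_prod _ (by fun_prop), lintegral_prod _ hGm.aemeasurable]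
    simp [mul_comm]
    rw [lintegral_mul_const _ (by fun_prop), mul_comm]
  have hmem : ∀ᵐ p ∂μ, p ∈ A ×ˢ B := ae_restrict_mem (hAm.prod hBm)
  have hm1 : Measurable fun p : ℝ × ℝ => ∫⁻ s in A, G (s, p.2) := by fun_prop
  have hm2 : Measurable fun p : ℝ × ℝ => ∫⁻ t in B, G (p.1, t) := by fun_prop
  have hdouble : ∫⁻ p, ∫⁻ q, ENNReal.ofReal ((g p - g q)^2) ∂μ ∂μ ≤
      ENNReal.ofReal (4 * h^2) * μ Set.univ * T := by
    calc _ ≤ ∫⁻ p, ∫⁻ q, ENNReal.ofReal (2 * h) *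
          ((∫⁻ s in A, G (s, p.2)) + ∫⁻ t in B, G (q.1, t)) ∂μ ∂μ := by
          refine lintegral_mono_ae ?_
          filter_upwards [hmem] with p hp
          refine lintegral_mono_ae ?_
          filter_upwards [hmem] with q hq using hpq p hp q hq
      _ = ENNReal.ofReal (2 * h) * (μ Set.univ * (volume A * T) + μ Set.univ * (volume B * T)) := by
          have : ∀ p : ℝ × ℝ, ∫⁻ q, ENNReal.ofReal (2 * h) *
            ((∫⁻ s in A, G (s, p.2)) + ∫⁻ t in B, G (q.1, t)) ∂μ =
            ENNReal.ofReal (2 * h) * (μ Set.univ * (∫⁻ s in A, G (s, p.2)) + volume B * T) := by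
            intro p
            rw [lintegral_const_mul _ (by fun_prop), lintegral_add_left measurable_const,
              lintegral_const, hT2, mul_comm (μ Set.univ)]
          simp_rw [this]
          rw [lintegral_const_mul _ (by fun_prop), lintegral_add_right _ measurable_const,
            lintegral_const_mul _ hm1, hT1, lintegral_const, mul_comm (volume B * T)]
      _ ≤ ENNReal.ofReal (2 * h) * (μ Set.univ * (ENNReal.ofReal h * T)
            + μ Set.univ * (ENNReal.ofReal h * T)) := by
          gcongr
          · exact hvol A hA
          · exact hvol B hB
      _ = _ := by
          have : ENNReal.ofReal (4 * h^2) = ENNReal.ofReal (2*h) * (2 * ENNReal.ofReal h) := by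
            rw [← ENNReal.ofReal_ofNat, ← ENNReal.ofReal_mul (by norm_num),
              ← ENNReal.ofReal_mul (by positivity)]
            congr 1; ring
          rw [this]; ring
  have hint2 : Integrable (fun p => (g p)^2) μ := by
    refine ⟨(hg.pow_const 2).aestronglyMeasurable, ?_⟩
    rw [hasFiniteIntegral_iff_ofReal (Filter.Eventually.of_forall fun s => sq_nonneg _)]
    exact lt_top_iff_ne_top.2 hfin
  have hint : Integrable g μ := by
    refine Integrable.mono' (hint2.add (integrable_const (1:ℝ))) hg.aestronglyMeasurable ?_
    refine Filter.Eventually.of_forall fun s => ?_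
    simp only [Pi.add_apply, Real.norm_eq_abs]
    nlinarith [sq_abs (g s), sq_nonneg (|g s| - 1)]
  set I := ∫ p, g p ∂μ with hI
  set S := ∫ p, (g p)^2 ∂μ with hS
  set V := (μ Set.univ).toReal with hV
  have hinner : ∀ p, ∫⁻ q, ENNReal.ofReal ((g p - g q)^2) ∂μ =
      ENNReal.ofReal (V * (g p)^2 - 2 * I * g p + S) ∧ 0 ≤ V * (g p)^2 - 2 * I * g p + S := by
    intro p
    have e := aux_quad μ g hint hint2 1 (-(2 * g p)) ((g p)^2) (fun q => (g p - g q)^2)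
      (fun q => by ring)
    have e2 : V * (g p)^2 - 2 * I * g p + S = ∫ q, (g p - g q)^2 ∂μ := by
      rw [e.2]; ring
    rw [e2, ofReal_integral_eq_lintegral_ofReal e.1
      (Filter.Eventually.of_forall fun s => sq_nonneg _)]
    exact ⟨rfl, integral_nonneg fun s => sq_nonneg _⟩
  have houter : ∫⁻ p, ∫⁻ q, ENNReal.ofReal ((g p - g q)^2) ∂μ ∂μ =
      ENNReal.ofReal (2 * V * S - 2 * I^2) := by
    simp_rw [fun p => (hinner p).1]
    have e := aux_quad μ g hint hint2 V (-(2 * I)) S (fun p => V * (g p)^2 - 2 * I * g p + S)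
      (fun q => by ring)
    rw [← ofReal_integral_eq_lintegral_ofReal e.1
      (Filter.Eventually.of_forall fun p => (hinner p).2), e.2]
    congr 1
    ring
  rw [houter] at hdouble
  rw [hμu, ← ofReal_integral_eq_lintegral_ofReal hint2
    (Filter.Eventually.of_forall fun s => sq_nonneg _)]
  by_cases hV0 : μ Set.univ = 0
  · have : μ = 0 := Measure.measure_univ_eq_zero.1 hV0
    simp [this]
  have hVpos : 0 < V := ENNReal.toReal_pos hV0 (measure_ne_top _ _)
  have hVe : μ Set.univ = ENNReal.ofReal V := (ENNReal.ofReal_toReal (measure_ne_top _ _)).symm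
  have e1 : S = (2 * V)⁻¹ * (2 * V * S - 2 * I^2) + I^2 / V := by field_simp; ring
  calc ENNReal.ofReal S ≤ ENNReal.ofReal ((2 * V)⁻¹ * (2 * V * S - 2 * I^2))
        + ENNReal.ofReal (I^2/V) := by
        conv_lhs => rw [e1]
        exact ENNReal.ofReal_add_le
    _ ≤ ENNReal.ofReal ((2 * V)⁻¹) * (ENNReal.ofReal (4 * h^2) * μ Set.univ * T)
        + ENNReal.ofReal (I^2/V) := by
        rw [ENNReal.ofReal_mul (by positivity)]
        gcongr
    _ = _ := by
        rw [add_comm, hVe, ← ENNReal.ofReal_mul (by positivity),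
          ← mul_assoc, ← ENNReal.ofReal_mul (by positivity)]
        have : (2 * V)⁻¹ * (4 * h^2 * V) = 2 * h^2 := by field_simp; ring
        rw [this, ENNReal.toReal_ofReal hVpos.le]

/-- A cell of the grid of mesh `1/k` inside the interval `(a,b)`. -/
def auxCell (a b : ℝ) (k i : ℕ) : Set ℝ :=
  Set.Ioo a b ∩ (fun x : ℝ => ⌊(k:ℝ) * x⌋₊) ⁻¹' {i}

lemma auxCell_meas (a b : ℝ) (k i : ℕ) : MeasurableSet (auxCell a b k i) := by
  refine measurableSet_Ioo.inter ?_
  have : Measurable (fun x : ℝ => ⌊(k:ℝ) * x⌋₊) := Nat.measurable_floor.comp (by fun_prop)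
  exact this (measurableSet_singleton i)

lemma auxCell_ord (a b : ℝ) (k i : ℕ) : (auxCell a b k i).OrdConnected := by
  refine Set.ordConnected_Ioo.inter ?_
  refine Set.OrdConnected.preimage_mono Set.ordConnected_singleton ?_
  intro x y hxy
  apply Nat.floor_mono
  gcongr

lemma auxCell_diam (a b : ℝ) (ha : 0 ≤ a) (k i : ℕ) (hk : 0 < k) :
    ∀ x ∈ auxCell a b k i, ∀ x' ∈ auxCell a b k i, |x - x'| ≤ 1 / (k:ℝ) := by
  rintro x ⟨hx, hxi⟩ y ⟨hy, hyi⟩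
  have hk' : (0:ℝ) < k := by exact_mod_cast hk
  have e1 := (Nat.floor_eq_iff (by have := hx.1; exact mul_nonneg hk'.le (by linarith))).1 hxi
  have e2 := (Nat.floor_eq_iff (by have := hy.1; exact mul_nonneg hk'.le (by linarith))).1 hyi
  rw [abs_le]
  constructor
  · rw [neg_le, div_eq_inv_mul, inv_mul_eq_div, le_div_iff₀ hk']
    nlinarith
  · rw [le_div_iff₀ hk']
    nlinarith

lemma aux_rect (a b c d : ℝ) (ha : 0 ≤ a) (hc : 0 ≤ c) (k K : ℕ) (hk : 0 < k)
    (hb : (k:ℝ) * b ≤ K) (hd : (k:ℝ) * d ≤ K)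
    (g : ℝ × ℝ → ℝ) (hg : Measurable g)
    (hdf : ∀ p ∈ Set.Ioo a b ×ˢ Set.Ioo c d, DifferentiableAt ℝ g p)
    (hfin : ∫⁻ p in Set.Ioo a b ×ˢ Set.Ioo c d, ENNReal.ofReal ((g p)^2) ≠ ⊤) :
    ∫⁻ p in Set.Ioo a b ×ˢ Set.Ioo c d, ENNReal.ofReal ((g p)^2) ≤
      ENNReal.ofReal (∑ ij ∈ Finset.range K ×ˢ Finset.range K,
        (∫ p in auxCell a b k ij.1 ×ˢ auxCell c d k ij.2, g p)^2 /
          (volume (auxCell a b k ij.1 ×ˢ auxCell c d k ij.2)).toReal) +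
      ENNReal.ofReal (2 * (1 / (k:ℝ))^2) *
        ∫⁻ p in Set.Ioo a b ×ˢ Set.Ioo c d, ENNReal.ofReal (‖fderiv ℝ g p‖^2) := by
  have hk' : (0:ℝ) < k := by exact_mod_cast hk
  have hsub : ∀ ij : ℕ × ℕ, auxCell a b k ij.1 ×ˢ auxCell c d k ij.2 ⊆
      Set.Ioo a b ×ˢ Set.Ioo c d := fun ij =>
    Set.prod_mono Set.inter_subset_left Set.inter_subset_left
  have hU : Set.Ioo a b ×ˢ Set.Ioo c d =
      ⋃ ij ∈ Finset.range K ×ˢ Finset.range K, auxCell a b k ij.1 ×ˢ auxCell c d k ij.2 := by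
    apply Set.Subset.antisymm
    · rintro ⟨x, y⟩ ⟨hx, hy⟩
      simp only [Set.mem_iUnion]
      refine ⟨(⌊(k:ℝ) * x⌋₊, ⌊(k:ℝ) * y⌋₊), ?_, ⟨hx, rfl⟩, ⟨hy, rfl⟩⟩
      have hx2 := hx.2
      have hy2 := hy.2
      have hx1 := hx.1
      have hy1 := hy.1
      simp only [Finset.mem_product, Finset.mem_range]
      dsimp only at hx1 hx2 hy1 hy2
      constructor
      · rw [Nat.floor_lt (by have : 0 ≤ x := by linarith
                             positivity)]
        nlinarith
      · rw [Nat.floor_lt (by have : 0 ≤ y := by linarith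
                             positivity)]
        nlinarith
    · exact Set.iUnion₂_subset fun ij _ => hsub ij
  have hdisj : Set.PairwiseDisjoint (↑(Finset.range K ×ˢ Finset.range K))
      (fun ij : ℕ × ℕ => auxCell a b k ij.1 ×ˢ auxCell c d k ij.2) := by
    intro ij _ ij' _ hne
    refine Set.disjoint_left.2 ?_
    rintro ⟨x, y⟩ ⟨⟨_, h1⟩, ⟨_, h2⟩⟩ ⟨⟨_, h3⟩, ⟨_, h4⟩⟩
    apply hne
    simp only [Set.mem_preimage, Set.mem_singleton_iff] at h1 h2 h3 h4
    exact Prod.ext (h1.symm.trans h3) (h2.symm.trans h4)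
  have hms : ∀ ij ∈ Finset.range K ×ˢ Finset.range K,
      MeasurableSet (auxCell a b k ij.1 ×ˢ auxCell c d k ij.2) := fun ij _ =>
    (auxCell_meas _ _ _ _).prod (auxCell_meas _ _ _ _)
  have hlint : ∀ F : ℝ × ℝ → ℝ≥0∞, ∫⁻ p in Set.Ioo a b ×ˢ Set.Ioo c d, F p =
      ∑ ij ∈ Finset.range K ×ˢ Finset.range K,
        ∫⁻ p in auxCell a b k ij.1 ×ˢ auxCell c d k ij.2, F p := by
    intro F
    conv_lhs => rw [hU]
    exact lintegral_biUnion_finset hdisj hms F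
  rw [hlint (fun p => ENNReal.ofReal (‖fderiv ℝ g p‖^2)), hlint (fun p => ENNReal.ofReal ((g p)^2)),
    ENNReal.ofReal_sum_of_nonneg (fun ij _ => by positivity), Finset.mul_sum,
    ← Finset.sum_add_distrib]
  refine Finset.sum_le_sum fun ij _ => ?_
  refine aux_poincare _ _ (auxCell_meas _ _ _ _) (auxCell_meas _ _ _ _)
    (auxCell_ord _ _ _ _) (auxCell_ord _ _ _ _) _ (auxCell_diam _ _ ha _ _ hk)
    (auxCell_diam _ _ hc _ _ hk) g hg (fun p hp => hdf p (hsub ij hp)) ?_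
  exact ne_top_of_le_ne_top hfin (lintegral_mono_set (hsub ij))

/-- simultaneous extraction of convergent subsequences of countably many bounded sequences -/
lemma aux_extract {ι : Type*} [Countable ι] (a : ℕ → ι → ℝ) (C : ι → ℝ)
    (hC : ∀ n i, |a n i| ≤ C i) :
    ∃ (φ : ℕ → ℕ) (l : ι → ℝ), StrictMono φ ∧
      ∀ i, Filter.Tendsto (fun n => a (φ n) i) Filter.atTop (nhds (l i)) := by
  have hcomp : IsCompact (Set.univ.pi fun i => Set.Icc (-C i) (C i)) :=
    isCompact_univ_pi fun i => isCompact_Icc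
  obtain ⟨l, _, φ, hφ, hl⟩ := hcomp.tendsto_subseq (x := a)
    (fun n i _ => abs_le.1 (hC n i))
  exact ⟨φ, l, hφ, fun i => (tendsto_pi_nhds.1 hl) i⟩

lemma aux_sq_sub (u v w : ℝ) (hw : 0 ≤ w) : ENNReal.ofReal ((u - v)^2 * w) ≤
    2 * (ENNReal.ofReal (u^2 * w) + ENNReal.ofReal (v^2 * w)) := by
  rw [← ENNReal.ofReal_add (by positivity) (by positivity), ← ENNReal.ofReal_ofNat,
    ← ENNReal.ofReal_mul (by norm_num)]
  apply ENNReal.ofReal_le_ofReal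
  have : (u - v)^2 ≤ 2 * (u^2 + v^2) := by nlinarith [sq_nonneg (u + v)]
  nlinarith

lemma aux_four (M : ℝ≥0∞) (hM : M ≠ ⊤) : 2 * (M + M) = ENNReal.ofReal (4 * M.toReal) := by
  rw [ENNReal.ofReal_mul (by norm_num), ENNReal.ofReal_toReal hM, ← two_mul, ← mul_assoc]
  congr 1
  rw [ENNReal.ofReal_ofNat]; norm_num

theorem stmt12 (N m₁ m₂ : ℝ) (hN : 0 < N) (hm₁ : 0 ≤ m₁) (hm : m₁ < m₂)
    (f : ℕ → ℝ × ℝ → ℝ)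
    (hdiff : ∀ n, DifferentiableOn ℝ (f n) (Set.Ioi (1:ℝ) ×ˢ Set.Ioo (0:ℝ) N))
    (hw : ∃ M : ℝ≥0∞, M ≠ ⊤ ∧ ∀ n,
      (∫⁻ p in (Set.Ioi (1:ℝ) ×ˢ Set.Ioo (0:ℝ) N : Set (ℝ × ℝ)),
        ENNReal.ofReal ((f n p)^2 * p.1 ^ (2*m₂))) ≤ M)
    (hloc : ∀ U : Set (ℝ × ℝ), IsOpen U → Bornology.IsBounded U →
      U ⊆ (Set.Ioi (1:ℝ) ×ˢ Set.Ioo (0:ℝ) N : Set (ℝ × ℝ)) →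
      ∃ M : ℝ≥0∞, M ≠ ⊤ ∧ ∀ n,
        (∫⁻ p in U, ENNReal.ofReal ((f n p)^2
          + ‖fderivWithin ℝ (f n) (Set.Ioi (1:ℝ) ×ˢ Set.Ioo (0:ℝ) N) p‖^2)) ≤ M) :
    ∃ φ : ℕ → ℕ, StrictMono φ ∧
      ∀ ε : ℝ, 0 < ε → ∃ J : ℕ, ∀ j ≥ J, ∀ k ≥ J,
        (∫⁻ p in (Set.Ioi (1:ℝ) ×ˢ Set.Ioo (0:ℝ) N : Set (ℝ × ℝ)),
          ENNReal.ofReal ((f (φ j) p - f (φ k) p)^2 * p.1 ^ (2*m₁))) ≤ ENNReal.ofReal ε := by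
  set Ω : Set (ℝ × ℝ) := Set.Ioi (1:ℝ) ×ˢ Set.Ioo (0:ℝ) N with hΩ
  have hΩo : IsOpen Ω := isOpen_Ioi.prod isOpen_Ioo
  have hΩm : MeasurableSet Ω := hΩo.measurableSet
  obtain ⟨M, hMtop, hM⟩ := hw
  set F : ℕ → ℝ × ℝ → ℝ := fun n => Ω.indicator (f n) with hF
  have hFeq : ∀ n, ∀ p ∈ Ω, F n p = f n p := fun n p hp => Set.indicator_of_mem hp _
  have hFm : ∀ n, Measurable (F n) := by
    intro n
    classical
    have := (hdiff n).continuousOn.measurable_piecewise (g := (0 : ℝ × ℝ → ℝ))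
      continuousOn_const hΩm
    rwa [Set.piecewise_eq_indicator] at this
  have hFev : ∀ n, ∀ p ∈ Ω, F n =ᶠ[nhds p] f n := by
    intro n p hp
    filter_upwards [hΩo.mem_nhds hp] with q hq using hFeq n q hq
  have hFd : ∀ n, ∀ p ∈ Ω, DifferentiableAt ℝ (F n) p := fun n p hp =>
    ((hdiff n).differentiableAt (hΩo.mem_nhds hp)).congr_of_eventuallyEq (hFev n p hp)
  have hFf : ∀ n, ∀ p ∈ Ω, fderiv ℝ (F n) p = fderivWithin ℝ (f n) Ω p := by
    intro n p hp
    rw [(hFev n p hp).fderiv_eq, fderivWithin_of_isOpen hΩo hp]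
  set Ωr : ℕ → Set (ℝ × ℝ) := fun r => Set.Ioo (1:ℝ) r ×ˢ Set.Ioo (0:ℝ) N with hΩr
  have hΩrs : ∀ r, Ωr r ⊆ Ω := fun r => Set.prod_mono (fun x hx => hx.1) subset_rfl
  have hΩro : ∀ r, IsOpen (Ωr r) := fun r => isOpen_Ioo.prod isOpen_Ioo
  have hΩrb : ∀ r, Bornology.IsBounded (Ωr r) := fun r =>
    (Metric.isBounded_Ioo _ _).prod (Metric.isBounded_Ioo _ _)
  have hΩrv : ∀ r, volume (Ωr r) ≠ ⊤ := fun r => (hΩrb r).measure_lt_top.ne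
  have hloc' := fun r => hloc (Ωr r) (hΩro r) (hΩrb r) (hΩrs r)
  choose L hLtop hL using hloc'
  have hL1 : ∀ r n, ∫⁻ p in Ωr r, ENNReal.ofReal ((F n p)^2) ≤ L r := by
    intro r n
    refine (setLIntegral_mono' (hΩro r).measurableSet fun p hp => ?_).trans (hL r n)
    rw [hFeq n p (hΩrs r hp)]
    exact ENNReal.ofReal_le_ofReal (by linarith [sq_nonneg ‖fderivWithin ℝ (f n) Ω p‖])
  have hL2 : ∀ r n, ∫⁻ p in Ωr r, ENNReal.ofReal (‖fderiv ℝ (F n) p‖^2) ≤ L r := by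
    intro r n
    refine (setLIntegral_mono' (hΩro r).measurableSet fun p hp => ?_).trans (hL r n)
    rw [hFf n p (hΩrs r hp)]
    exact ENNReal.ofReal_le_ofReal (by linarith [sq_nonneg (f n p)])
  have hM' : ∀ n, ∫⁻ p in Ω, ENNReal.ofReal ((F n p)^2 * p.1 ^ (2*m₂)) ≤ M := by
    intro n
    refine (setLIntegral_mono' hΩm fun p hp => ?_).trans (hM n)
    rw [hFeq n p hp]
  set Q : ℕ × ℕ × ℕ × ℕ → Set (ℝ × ℝ) := fun t =>
    auxCell 1 t.1 t.2.1 t.2.2.1 ×ˢ auxCell 0 N t.2.1 t.2.2.2 with hQ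
  have hQs : ∀ t, Q t ⊆ Ωr t.1 := fun t =>
    Set.prod_mono Set.inter_subset_left Set.inter_subset_left
  have habs : ∀ t n, ∫⁻ p in Q t, ENNReal.ofReal ‖F n p‖ ≤ volume (Ωr t.1) + L t.1 := by
    intro t n
    calc _ ≤ ∫⁻ p in Ωr t.1, ENNReal.ofReal ‖F n p‖ := lintegral_mono_set (hQs t)
      _ ≤ ∫⁻ p in Ωr t.1, (1 + ENNReal.ofReal ((F n p)^2)) := by
          refine lintegral_mono fun p => ?_
          rw [← ENNReal.ofReal_one, ← ENNReal.ofReal_add (by norm_num) (by positivity)]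
          apply ENNReal.ofReal_le_ofReal
          rw [Real.norm_eq_abs]
          nlinarith [sq_abs (F n p), sq_nonneg (|F n p| - 1)]
      _ ≤ _ := by
          rw [lintegral_add_left measurable_const]
          simp only [lintegral_const, Measure.restrict_apply_univ, one_mul]
          exact add_le_add le_rfl (hL1 t.1 n)
  have hint : ∀ t n, Integrable (F n) (volume.restrict (Q t)) := by
    intro t n
    refine ⟨(hFm n).aestronglyMeasurable, ?_⟩
    rw [hasFiniteIntegral_iff_norm]
    exact (habs t n).trans_lt (ENNReal.add_lt_top.2 ⟨(hΩrv _).lt_top, (hLtop _).lt_top⟩)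
  obtain ⟨φ, l, hφ, hl⟩ := aux_extract (fun n t => ∫ p in Q t, F n p)
    (fun t => (volume (Ωr t.1) + L t.1).toReal) (by
      intro n t
      rw [← Real.norm_eq_abs]
      refine (norm_integral_le_lintegral_norm _).trans ?_
      exact ENNReal.toReal_mono (ENNReal.add_ne_top.2 ⟨hΩrv _, hLtop _⟩) (habs t n))
  refine ⟨φ, hφ, ?_⟩
  -- the sum over the cells
  set Sg : ℕ → ℕ → ℕ → ℕ → ℕ → ℝ := fun r k K a b =>
    ∑ ij ∈ Finset.range K ×ˢ Finset.range K,
      ((∫ p in Q (r, k, ij.1, ij.2), F a p) - ∫ p in Q (r, k, ij.1, ij.2), F b p)^2 /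
        (volume (Q (r, k, ij.1, ij.2))).toReal with hSg
  have hSgnn : ∀ r k K a b, 0 ≤ Sg r k K a b := fun r k K a b =>
    Finset.sum_nonneg fun ij _ => by positivity
  have hrect : ∀ r k K : ℕ, 0 < k → (k:ℝ) * r ≤ K → (k:ℝ) * N ≤ K → ∀ a b,
      ∫⁻ p in Ωr r, ENNReal.ofReal ((F a p - F b p)^2) ≤
        ENNReal.ofReal (Sg r k K a b + (2 * (1 / (k:ℝ))^2) * (4 * (L r).toReal)) := by
    intro r k K hk h1 h2 a b
    have hb1 : ∫⁻ p in Ωr r, ENNReal.ofReal ((F a p - F b p)^2) ≤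
        ENNReal.ofReal (4 * (L r).toReal) := by
      rw [← aux_four _ (hLtop r)]
      calc _ ≤ ∫⁻ p in Ωr r, 2 * (ENNReal.ofReal ((F a p)^2) + ENNReal.ofReal ((F b p)^2)) :=
            lintegral_mono fun p => by simpa using aux_sq_sub (F a p) (F b p) 1 (by norm_num)
        _ = 2 * ((∫⁻ p in Ωr r, ENNReal.ofReal ((F a p)^2)) +
              ∫⁻ p in Ωr r, ENNReal.ofReal ((F b p)^2)) := by
            rw [lintegral_const_mul' _ _ (by norm_num),
              lintegral_add_left ((hFm a).pow_const 2).ennreal_ofReal]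
        _ ≤ _ := by gcongr <;> apply hL1
    have hb2 : ∫⁻ p in Ωr r, ENNReal.ofReal (‖fderiv ℝ (fun p => F a p - F b p) p‖^2) ≤
        ENNReal.ofReal (4 * (L r).toReal) := by
      rw [← aux_four _ (hLtop r)]
      calc _ ≤ ∫⁻ p in Ωr r, 2 * (ENNReal.ofReal (‖fderiv ℝ (F a) p‖^2)
                + ENNReal.ofReal (‖fderiv ℝ (F b) p‖^2)) := by
            refine setLIntegral_mono' (hΩro r).measurableSet fun p hp => ?_
            rw [fderiv_fun_sub (hFd a p (hΩrs r hp)) (hFd b p (hΩrs r hp))]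
            have h3 := aux_sq_sub (‖fderiv ℝ (F a) p‖) (-‖fderiv ℝ (F b) p‖) 1 (by norm_num)
            simp only [mul_one, neg_sq, sub_neg_eq_add] at h3
            refine le_trans (ENNReal.ofReal_le_ofReal ?_) h3
            gcongr
            exact norm_sub_le _ _
        _ = 2 * ((∫⁻ p in Ωr r, ENNReal.ofReal (‖fderiv ℝ (F a) p‖^2)) +
              ∫⁻ p in Ωr r, ENNReal.ofReal (‖fderiv ℝ (F b) p‖^2)) := by
            rw [lintegral_const_mul' _ _ (by norm_num),
              lintegral_add_left (((measurable_fderiv ℝ (F a)).norm.pow_const 2).ennreal_ofReal)]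
        _ ≤ _ := by gcongr <;> apply hL2
    have key := aux_rect 1 r 0 N (by norm_num) le_rfl k K hk h1 h2 (fun p => F a p - F b p)
      ((hFm a).sub (hFm b))
      (fun p hp => (hFd a p (hΩrs r hp)).sub (hFd b p (hΩrs r hp)))
      (ne_top_of_le_ne_top ENNReal.ofReal_ne_top hb1)
    refine key.trans ?_
    rw [ENNReal.ofReal_add (hSgnn _ _ _ _ _) (by positivity)]
    refine add_le_add (le_of_eq ?_) ?_
    · congr 1
      refine Finset.sum_congr rfl fun ij _ => ?_
      have := integral_sub (hint (r, k, ij.1, ij.2) a) (hint (r, k, ij.1, ij.2) b)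
      simp only [hQ] at this ⊢
      rw [this]
    · rw [ENNReal.ofReal_mul (p := 2 * (1 / (k:ℝ))^2) (by positivity)]
      exact mul_le_mul_right hb2 _
  have hmain : ∀ r k K : ℕ, 0 < r → 0 < k → (k:ℝ) * r ≤ K → (k:ℝ) * N ≤ K → ∀ a b,
      ∫⁻ p in Ω, ENNReal.ofReal ((f a p - f b p)^2 * p.1 ^ (2*m₁)) ≤
        ENNReal.ofReal ((r:ℝ) ^ (2*m₁) *
          (Sg r k K a b + (2 * (1 / (k:ℝ))^2) * (4 * (L r).toReal)) +
          (r:ℝ) ^ (-(2*(m₂ - m₁))) * (4 * M.toReal)) := by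
    intro r k K hr hk h1 h2 a b
    have hr' : (0:ℝ) < r := by exact_mod_cast hr
    have hsplit : Ω ⊆ Ωr r ∪ (Ω ∩ {p | (r:ℝ) ≤ p.1}) := by
      rintro ⟨x, y⟩ ⟨hx, hy⟩
      rcases lt_or_ge x r with h | h
      · exact Or.inl ⟨⟨hx, h⟩, hy⟩
      · exact Or.inr ⟨⟨hx, hy⟩, h⟩
    have hTm : MeasurableSet (Ω ∩ {p : ℝ × ℝ | (r:ℝ) ≤ p.1}) :=
      hΩm.inter (measurableSet_le measurable_const measurable_fst)
    refine (lintegral_mono_set hsplit).trans ((lintegral_union_le _ _ _).trans ?_)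
    have hnn := hSgnn r k K a b
    rw [ENNReal.ofReal_add (by positivity) (by positivity)]
    refine add_le_add ?_ ?_
    · rw [ENNReal.ofReal_mul (by positivity)]
      refine le_trans ?_ (mul_le_mul_right (hrect r k K hk h1 h2 a b) _)
      rw [← lintegral_const_mul' _ _ ENNReal.ofReal_ne_top]
      refine setLIntegral_mono' (hΩro r).measurableSet fun p hp => ?_
      rw [← ENNReal.ofReal_mul (by positivity), hFeq a p (hΩrs r hp), hFeq b p (hΩrs r hp)]
      apply ENNReal.ofReal_le_ofReal
      rw [mul_comm]
      have hp1 : 1 < p.1 := hp.1.1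
      gcongr
      · exact hp.1.2.le
    · rw [ENNReal.ofReal_mul (by positivity), ← aux_four _ hMtop]
      calc _ ≤ ∫⁻ p in Ω ∩ {p : ℝ × ℝ | (r:ℝ) ≤ p.1}, ENNReal.ofReal ((r:ℝ) ^ (-(2*(m₂ - m₁)))) *
              (2 * (ENNReal.ofReal ((F a p)^2 * p.1 ^ (2*m₂))
                + ENNReal.ofReal ((F b p)^2 * p.1 ^ (2*m₂)))) := by
            refine setLIntegral_mono' hTm fun p hp => ?_
            have hp1 : 0 < p.1 := lt_trans one_pos hp.1.1
            rw [hFeq a p hp.1, hFeq b p hp.1]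
            refine le_trans ?_ (mul_le_mul_right (aux_sq_sub _ _ _ (by positivity)) _)
            rw [← ENNReal.ofReal_mul (by positivity)]
            apply ENNReal.ofReal_le_ofReal
            have e1 : p.1 ^ (2*m₁) = p.1 ^ (-(2*(m₂ - m₁))) * p.1 ^ (2*m₂) := by
              rw [← Real.rpow_add hp1]; congr 1; ring
            have e2 : p.1 ^ (-(2*(m₂ - m₁))) ≤ (r:ℝ) ^ (-(2*(m₂ - m₁))) :=
              Real.rpow_le_rpow_of_nonpos hr' hp.2 (by linarith)
            rw [e1, mul_left_comm]
            gcongr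
        _ ≤ ∫⁻ p in Ω, ENNReal.ofReal ((r:ℝ) ^ (-(2*(m₂ - m₁)))) *
              (2 * (ENNReal.ofReal ((F a p)^2 * p.1 ^ (2*m₂))
                + ENNReal.ofReal ((F b p)^2 * p.1 ^ (2*m₂)))) :=
            lintegral_mono_set Set.inter_subset_left
        _ = ENNReal.ofReal ((r:ℝ) ^ (-(2*(m₂ - m₁)))) * (2 *
              ((∫⁻ p in Ω, ENNReal.ofReal ((F a p)^2 * p.1 ^ (2*m₂))) +
              ∫⁻ p in Ω, ENNReal.ofReal ((F b p)^2 * p.1 ^ (2*m₂)))) := by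
            have hma := hFm a
            rw [lintegral_const_mul' _ _ ENNReal.ofReal_ne_top,
              lintegral_const_mul' _ _ (by norm_num),
              lintegral_add_left (by fun_prop)]
        _ ≤ _ := by gcongr <;> apply hM'
  intro ε hε
  -- choice of the cut-off
  have t1 : Filter.Tendsto (fun r : ℕ => (r:ℝ) ^ (-(2*(m₂ - m₁))) * (4 * M.toReal))
      Filter.atTop (nhds 0) := by
    have := ((tendsto_rpow_neg_atTop (y := 2*(m₂ - m₁)) (by linarith)).comp
      tendsto_natCast_atTop_atTop).mul_const (4 * M.toReal)
    simpa using this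
  obtain ⟨r, hr1, hr0⟩ := ((t1.eventually_lt_const (show 0 < ε/3 by positivity)).and
    (Filter.eventually_gt_atTop 0)).exists
  -- choice of the mesh
  have t2 : Filter.Tendsto (fun k : ℕ => (r:ℝ) ^ (2*m₁) *
      ((2 * (1 / (k:ℝ))^2) * (4 * (L r).toReal))) Filter.atTop (nhds 0) := by
    have := ((((tendsto_one_div_atTop_nhds_zero_nat (𝕜 := ℝ)).pow 2).const_mul 2).mul_const
      (4 * (L r).toReal)).const_mul ((r:ℝ) ^ (2*m₁))
    simpa using this
  obtain ⟨k, hk1, hk0⟩ := ((t2.eventually_lt_const (show 0 < ε/3 by positivity)).and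
    (Filter.eventually_gt_atTop 0)).exists
  obtain ⟨K, hK⟩ := exists_nat_ge (max ((k:ℝ) * r) ((k:ℝ) * N))
  -- convergence of the averages
  have t3 : Filter.Tendsto (fun q : ℕ × ℕ => (r:ℝ) ^ (2*m₁) * Sg r k K (φ q.1) (φ q.2))
      Filter.atTop (nhds 0) := by
    rw [← mul_zero ((r:ℝ) ^ (2*m₁))]
    apply Filter.Tendsto.const_mul
    rw [← Finset.sum_const_zero (s := Finset.range K ×ˢ Finset.range K)]
    apply tendsto_finsetSum
    intro ij _
    have hl' := hl (r, k, ij.1, ij.2)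
    rw [← Filter.prod_atTop_atTop_eq]
    have := (((hl'.comp Filter.tendsto_fst).sub (hl'.comp
      (Filter.tendsto_snd (f := (Filter.atTop : Filter ℕ))))).pow 2).div_const
      (volume (Q (r, k, ij.1, ij.2))).toReal
    simpa using this
  obtain ⟨J, hJ⟩ := Filter.eventually_atTop_prod_self.1
    (t3.eventually_lt_const (show 0 < ε/3 by positivity))
  refine ⟨J, fun i hi j hj => ?_⟩
  refine (hmain r k K hr0 hk0 ((le_max_left _ _).trans hK) ((le_max_right _ _).trans hK)
    (φ i) (φ j)).trans (ENNReal.ofReal_le_ofReal ?_)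
  have := hJ i j hi hj
  dsimp only at this
  rw [mul_add]
  linarith
end

section
/- Let σ ∈ (0, 1/2), ε ∈ (0,1], and let χ : ℝ → [0,1] be smooth with χ = 1 on (−∞,1] and χ = 0 on [2,∞). Let v_p : [1,∞) × [0,∞) → ℝ be smooth and suppose that for every integer k ≥ 0 there are constants C_k with, for all x ≥ 1 and y ≥ 0: |∂_x^k v_p| ≤ C_k x^{−k−1+σ}, |∂_x^k ∂_y v_p| ≤ C_k x^{−k−3/2+σ}, and |∂_x^k ∂_y² v_p| ≤ C_k x^{−k−2+σ}. Define v^n(x,y) := χ(√ε · y/√x) v_p(x,y) and u^n(x,y) := ∫_x^∞ ∂_y [ χ(√ε · y/√{x'}) v_p(x',y) ] dx'. Then u^n is well defined, ∂_x u^n + ∂_y v^n = 0, and for every integer k ≥ 0 there are constants C'_k, depending only on k, σ, χ and the C_j, but not on ε, such that for all x ≥ 1, y ≥ 0: |∂_x^k v^n| ≤ C'_k x^{−k−1+σ}, |∂_x^k ∂_y v^n| ≤ C'_k x^{−k−3/2+σ}, |∂_x^k ∂_y u^n| ≤ C'_k x^{−k−1+σ}, and |∂_x^k u^n| ≤ C'_k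 x^{−k−1/2+σ}. -/
open MeasureTheory

/-- Smoothness on the open half plane `x > 0`. -/
def SM (F : ℝ → ℝ → ℝ) : Prop :=
  ∀ x : ℝ, 0 < x → ∀ y : ℝ, ContDiffAt ℝ (⊤ : ℕ∞) (fun p : ℝ × ℝ => F p.1 p.2) (x, y)

lemma SM.ev_pos {P : ℝ × ℝ → Prop} {x y : ℝ} (hx : 0 < x)
    (h : ∀ a : ℝ, 0 < a → ∀ b : ℝ, P (a, b)) : ∀ᶠ p in nhds (x, y), P p := by
  have : {p : ℝ × ℝ | 0 < p.1} ∈ nhds (x, y) :=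
    (isOpen_lt continuous_const continuous_fst).mem_nhds hx
  filter_upwards [this] with p hp
  exact h p.1 hp p.2

lemma hasDerivAt_fst {F : ℝ × ℝ → ℝ} {x y : ℝ} (h : DifferentiableAt ℝ F (x, y)) :
    HasDerivAt (fun x' => F (x', y)) (fderiv ℝ F (x, y) (1, 0)) x := by
  have h1 : HasDerivAt (fun x' : ℝ => (x', y)) ((1 : ℝ), (0 : ℝ)) x :=
    (hasDerivAt_id x).prodMk (hasDerivAt_const x y)
  exact h.hasFDerivAt.comp_hasDerivAt x h1

lemma hasDerivAt_snd {F : ℝ × ℝ → ℝ} {x y : ℝ} (h : DifferentiableAt ℝ F (x, y)) :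
    HasDerivAt (fun y' => F (x, y')) (fderiv ℝ F (x, y) (0, 1)) y := by
  have h1 : HasDerivAt (fun y' : ℝ => (x, y')) ((0 : ℝ), (1 : ℝ)) y :=
    (hasDerivAt_const y x).prodMk (hasDerivAt_id y)
  exact h.hasFDerivAt.comp_hasDerivAt y h1

lemma SM.diff {F : ℝ → ℝ → ℝ} (h : SM F) {x : ℝ} (hx : 0 < x) (y : ℝ) :
    DifferentiableAt ℝ (fun p : ℝ × ℝ => F p.1 p.2) (x, y) :=
  (h x hx y).differentiableAt (by simp)

lemma SM.dx_eq {F : ℝ → ℝ → ℝ} (h : SM F) {x : ℝ} (hx : 0 < x) (y : ℝ) :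
    deriv (fun x' => F x' y) x = fderiv ℝ (fun p : ℝ × ℝ => F p.1 p.2) (x, y) (1, 0) :=
  (hasDerivAt_fst (h.diff hx y)).deriv

lemma SM.dy_eq {F : ℝ → ℝ → ℝ} (h : SM F) {x : ℝ} (hx : 0 < x) (y : ℝ) :
    deriv (fun y' => F x y') y = fderiv ℝ (fun p : ℝ × ℝ => F p.1 p.2) (x, y) (0, 1) :=
  (hasDerivAt_snd (h.diff hx y)).deriv

lemma SM.fd {F : ℝ → ℝ → ℝ} (h : SM F) (v : ℝ × ℝ) :
    SM (fun x y => fderiv ℝ (fun p : ℝ × ℝ => F p.1 p.2) (x, y) v) := by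
  intro x hx y
  have := (h x hx y).fderiv_right (m := (⊤ : ℕ∞)) (by simp)
  exact this.clm_apply contDiffAt_const

lemma SM.congr {F G : ℝ → ℝ → ℝ} (h : SM F) (e : ∀ x : ℝ, 0 < x → ∀ y, G x y = F x y) : SM G := by
  intro x hx y
  refine (h x hx y).congr_of_eventuallyEq ?_
  exact SM.ev_pos hx (fun a ha b => e a ha b)

lemma SM.dx {F : ℝ → ℝ → ℝ} (h : SM F) : SM (fun x y => deriv (fun x' => F x' y) x) :=
  (h.fd (1, 0)).congr (fun _ hx y => h.dx_eq hx y)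

lemma SM.dy {F : ℝ → ℝ → ℝ} (h : SM F) : SM (fun x y => deriv (fun y' => F x y') y) :=
  (h.fd (0, 1)).congr (fun _ hx y => h.dy_eq hx y)

lemma SM.slice_y {F : ℝ → ℝ → ℝ} (h : SM F) {x : ℝ} (hx : 0 < x) :
    ContDiff ℝ (⊤ : ℕ∞) (fun y => F x y) := by
  rw [contDiff_iff_contDiffAt]
  intro y
  exact (h x hx y).comp (f := fun y' : ℝ => (x, y')) y (by fun_prop)

lemma SM.slice_x {F : ℝ → ℝ → ℝ} (h : SM F) {x : ℝ} (hx : 0 < x) (y : ℝ) :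
    ContDiffAt ℝ (⊤ : ℕ∞) (fun x' => F x' y) x :=
  (h x hx y).comp (f := fun x' : ℝ => (x', y)) x (by fun_prop)

lemma SM.itx {F : ℝ → ℝ → ℝ} (h : SM F) (k : ℕ) :
    SM (fun x y => iteratedDeriv k (fun x' => F x' y) x) := by
  induction k with
  | zero => simpa using h
  | succ k ih =>
    simp only [iteratedDeriv_succ]
    exact ih.dx

lemma SM.swap {F : ℝ → ℝ → ℝ} (h : SM F) {x : ℝ} (hx : 0 < x) (y : ℝ) :
    deriv (fun x' => deriv (fun y' => F x' y') y) x =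
      deriv (fun y' => deriv (fun x' => F x' y') x) y := by
  have hs : IsSymmSndFDerivAt ℝ (fun p : ℝ × ℝ => F p.1 p.2) (x, y) :=
    (h x hx y).isSymmSndFDerivAt (by
      rw [minSmoothness_of_isRCLikeNormedField]
      exact WithTop.coe_le_coe.2 (le_top : ((2 : ℕ∞)) ≤ ⊤))
  have hd : DifferentiableAt ℝ (fderiv ℝ (fun p : ℝ × ℝ => F p.1 p.2)) (x, y) :=
    ((h x hx y).fderiv_right (m := (⊤ : ℕ∞)) (by simp)).differentiableAt (by simp)
  have e1 : (fun x' => deriv (fun y' => F x' y') y) =ᶠ[nhds x]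
      (fun x' => fderiv ℝ (fun p : ℝ × ℝ => F p.1 p.2) (x', y) (0, 1)) := by
    filter_upwards [lt_mem_nhds hx] with a ha
    exact h.dy_eq ha y
  have e2 : (fun y' => deriv (fun x' => F x' y') x) =
      (fun y' => fderiv ℝ (fun p : ℝ × ℝ => F p.1 p.2) (x, y') (1, 0)) := by
    funext b
    exact h.dx_eq hx b
  rw [e1.deriv_eq, e2, ((h.fd (0, 1)).dx_eq hx y), ((h.fd (1, 0)).dy_eq hx y)]
  have key : ∀ v w : ℝ × ℝ,
      fderiv ℝ (fun p : ℝ × ℝ => fderiv ℝ (fun p : ℝ × ℝ => F p.1 p.2) (p.1, p.2) v) (x, y) w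
      = fderiv ℝ (fderiv ℝ (fun p : ℝ × ℝ => F p.1 p.2)) (x, y) w v := by
    intro v w
    have := fderiv_clm_apply hd (differentiableAt_const v)
    simp only [Prod.mk.eta]
    rw [this]
    simp
  rw [key, key]
  exact hs _ _

lemma SM.swap_it {F : ℝ → ℝ → ℝ} (h : SM F) (k : ℕ) {x : ℝ} (hx : 0 < x) (y : ℝ) :
    iteratedDeriv k (fun x' => deriv (fun y' => F x' y') y) x =
      deriv (fun y' => iteratedDeriv k (fun x' => F x' y') x) y := by
  induction k generalizing x with
  | zero => simp
  | succ k ih =>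
    simp only [iteratedDeriv_succ]
    rw [← (h.itx k).swap hx y]
    apply Filter.EventuallyEq.deriv_eq
    filter_upwards [lt_mem_nhds hx] with a ha
    exact ih ha

lemma deriv_le_of_right {f : ℝ → ℝ} {y B : ℝ} (hB : 0 ≤ B)
    (h : ∀ z, y < z → |f z - f y| ≤ B * (z - y)) : |deriv f y| ≤ B := by
  by_cases hd : DifferentiableAt ℝ f y
  · have h1 := hd.hasDerivAt.tendsto_slope
    have h2 : Filter.Tendsto (slope f y) (nhdsWithin y (Set.Ioi y)) (nhds (deriv f y)) :=
      h1.mono_left (nhdsWithin_mono _ (fun z hz => ne_of_gt hz))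
    refine le_of_tendsto h2.abs ?_
    filter_upwards [self_mem_nhdsWithin] with z hz
    have hz' : 0 < z - y := sub_pos.2 hz
    rw [slope_def_field, abs_div, abs_of_pos hz', div_le_iff₀ hz']
    exact h z hz
  · rw [deriv_zero_of_not_differentiableAt hd]; simpa

/-- The cut-off profiles. -/
noncomputable def phi (χ : ℝ → ℝ) : ℕ → ℝ → ℝ
  | 0 => χ
  | (n + 1) => fun z => -(n : ℝ) * phi χ n z - z / 2 * deriv (phi χ n) z

lemma phi_smooth {χ : ℝ → ℝ} (h : ContDiff ℝ (⊤ : ℕ∞) χ) (n : ℕ) :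
    ContDiff ℝ (⊤ : ℕ∞) (phi χ n) := by
  induction n with
  | zero => exact h
  | succ n ih =>
    have : ContDiff ℝ (⊤ : ℕ∞) (deriv (phi χ n)) := (contDiff_infty_iff_deriv.1 ih).2
    unfold phi
    fun_prop

lemma phi_zero {χ : ℝ → ℝ} (h : ∀ z : ℝ, 2 ≤ z → χ z = 0) (n : ℕ) :
    ∀ z : ℝ, 2 < z → phi χ n z = 0 := by
  induction n with
  | zero => exact fun z hz => h z hz.le
  | succ n ih =>
    intro z hz
    have e : phi χ n =ᶠ[nhds z] fun _ => 0 := by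
      filter_upwards [lt_mem_nhds hz] with a ha using ih a ha
    simp [phi, ih z hz, e.deriv_eq]

lemma phi_bdd {χ : ℝ → ℝ} (hs : ContDiff ℝ (⊤ : ℕ∞) χ) (h : ∀ z : ℝ, 2 ≤ z → χ z = 0) :
    ∃ M : ℕ → ℕ → ℝ, (∀ n l, 0 ≤ M n l) ∧
      ∀ n l, ∀ z : ℝ, 0 ≤ z → |iteratedDeriv l (phi χ n) z| ≤ M n l := by
  have : ∀ n l : ℕ, ∃ M : ℝ, 0 ≤ M ∧ ∀ z : ℝ, 0 ≤ z → |iteratedDeriv l (phi χ n) z| ≤ M := by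
    intro n l
    have hc : Continuous (iteratedDeriv l (phi χ n)) :=
      (phi_smooth hs n).continuous_iteratedDeriv l (by exact_mod_cast le_top)
    obtain ⟨M, hM⟩ := (isCompact_Icc (a := (0 : ℝ)) (b := 2)).exists_bound_of_continuousOn
      hc.continuousOn
    refine ⟨max M 0, le_max_right _ _, fun z hz => ?_⟩
    by_cases h2 : z ≤ 2
    · exact (hM z ⟨hz, h2⟩).trans (le_max_left _ _)
    · push Not at h2
      have e : phi χ n =ᶠ[nhds z] fun _ => 0 := by
        filter_upwards [lt_mem_nhds h2] with a ha using phi_zero h n a ha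
      rw [e.iteratedDeriv_eq]
      simp
  choose M h0 hM using this
  exact ⟨M, h0, hM⟩

lemma cut_deriv {χ : ℝ → ℝ} (hs : ContDiff ℝ (⊤ : ℕ∞) χ) (c : ℝ) (n : ℕ) {x : ℝ} (hx : 0 < x) :
    iteratedDeriv n (fun x' => χ (c / √x')) x = (x⁻¹) ^ n * phi χ n (c / √x) := by
  induction n generalizing x with
  | zero => simp [phi]
  | succ n ih =>
    rw [iteratedDeriv_succ]
    have e : iteratedDeriv n (fun x' => χ (c / √x')) =ᶠ[nhds x]
        fun x => (x⁻¹) ^ n * phi χ n (c / √x) := by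
      filter_upwards [lt_mem_nhds hx] with a ha using ih ha
    rw [e.deriv_eq]
    have hsq : 0 < √x := Real.sqrt_pos.2 hx
    have h1 : HasDerivAt (fun x' => c / √x') (-(c / √x) / (2 * x)) x := by
      refine ((hasDerivAt_const x c).fun_div (Real.hasDerivAt_sqrt hx.ne') hsq.ne').congr_deriv ?_
      have h5 : √x ^ 2 = x := Real.sq_sqrt hx.le
      rw [h5]
      field_simp
      ring
    have h2 : HasDerivAt (phi χ n) (deriv (phi χ n) (c / √x)) (c / √x) :=
      ((phi_smooth hs n).differentiable (by simp) _).hasDerivAt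
    have h3 := h2.comp x h1
    have h4 : HasDerivAt (fun x : ℝ => (x⁻¹) ^ n) (-(n : ℝ) * (x⁻¹) ^ (n + 1)) x := by
      refine ((hasDerivAt_inv hx.ne').fun_pow n).congr_deriv ?_
      rcases n with _ | n
      · simp
      · simp only [Nat.add_sub_cancel]
        ring
    have h5 := (h4.fun_mul h3).deriv
    simp only [Function.comp] at h5
    rw [h5]
    simp only [phi]
    ring

lemma SM_of_contDiff {vp : ℝ → ℝ → ℝ}
    (h : ContDiff ℝ (⊤ : ℕ∞) (fun p : ℝ × ℝ => vp p.1 p.2)) : SM vp :=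
  fun _ _ _ => h.contDiffAt

lemma SM_vn {χ : ℝ → ℝ} (hs : ContDiff ℝ (⊤ : ℕ∞) χ) (ε : ℝ) {vp : ℝ → ℝ → ℝ} (h : SM vp) :
    SM (fun x y => χ (√ε * y / √x) * vp x y) := by
  intro x hx y
  have h1 : ContDiffAt ℝ (⊤ : ℕ∞) (fun p : ℝ × ℝ => √p.1) (x, y) :=
    contDiffAt_fst.sqrt hx.ne'
  have h2 : ContDiffAt ℝ (⊤ : ℕ∞) (fun p : ℝ × ℝ => √ε * p.2 / √p.1) (x, y) :=
    ContDiffAt.div (by fun_prop) h1 (Real.sqrt_pos.2 hx).ne'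
  exact (hs.contDiffAt.comp (x, y) h2).mul (h x hx y)

lemma cut_smooth {χ : ℝ → ℝ} (hs : ContDiff ℝ (⊤ : ℕ∞) χ) (c : ℝ) {x : ℝ} (hx : 0 < x) :
    ContDiffAt ℝ (⊤ : ℕ∞) (fun x' => χ (c / √x')) x := by
  have h2 : ContDiffAt ℝ (⊤ : ℕ∞) (fun x' : ℝ => c / √x') x :=
    ContDiffAt.div contDiffAt_const (contDiffAt_id.sqrt hx.ne') (Real.sqrt_pos.2 hx).ne'
  exact hs.contDiffAt.comp x h2

lemma top_le_nat (n : ℕ) : ((n : ℕ) : WithTop ℕ∞) ≤ ((⊤ : ℕ∞) : WithTop ℕ∞) := by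
  exact_mod_cast le_top

lemma vn_formula {χ : ℝ → ℝ} (hs : ContDiff ℝ (⊤ : ℕ∞) χ) (ε : ℝ) {vp : ℝ → ℝ → ℝ} (h : SM vp)
    (j k : ℕ) {x : ℝ} (hx : 0 < x) (y : ℝ) :
    iteratedDeriv j (fun y' => iteratedDeriv k (fun x' => χ (√ε * y' / √x') * vp x' y') x) y =
      ∑ i ∈ Finset.range (k + 1), ((k.choose i : ℝ) * (x⁻¹) ^ i) *
        ∑ l ∈ Finset.range (j + 1), (j.choose l : ℝ) *
          ((√ε / √x) ^ l * iteratedDeriv l (phi χ i) ((√ε / √x) * y)) *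
          iteratedDeriv (j - l) (fun y' => iteratedDeriv (k - i) (fun x' => vp x' y') x) y := by
  have e : (fun y' => iteratedDeriv k (fun x' => χ (√ε * y' / √x') * vp x' y') x) =
      fun y' => ∑ i ∈ Finset.range (k + 1), ((k.choose i : ℝ) * (x⁻¹) ^ i) *
        (phi χ i ((√ε / √x) * y') * iteratedDeriv (k - i) (fun x' => vp x' y') x) := by
    funext y'
    rw [iteratedDeriv_fun_mul ((cut_smooth hs _ hx).of_le (top_le_nat k))
      ((h.slice_x hx y').of_le (top_le_nat k))]
    refine Finset.sum_congr rfl fun i _ => ?_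
    rw [cut_deriv hs _ i hx, div_mul_eq_mul_div]
    ring
  have hA : ∀ i, ContDiff ℝ (⊤ : ℕ∞) (fun y' => phi χ i ((√ε / √x) * y')) := by
    intro i
    exact (phi_smooth hs i).comp (by fun_prop)
  have hW : ∀ i, ContDiff ℝ (⊤ : ℕ∞)
      (fun y' => iteratedDeriv (k - i) (fun x' => vp x' y') x) :=
    fun i => (h.itx (k - i)).slice_y hx
  rw [e, iteratedDeriv_fun_sum]
  · refine Finset.sum_congr rfl fun i _ => ?_
    rw [iteratedDeriv_const_mul_field, iteratedDeriv_fun_mul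
      ((hA i).contDiffAt.of_le (top_le_nat j)) ((hW i).contDiffAt.of_le (top_le_nat j))]
    refine congrArg _ (Finset.sum_congr rfl fun l _ => ?_)
    rw [iteratedDeriv_comp_const_mul ((phi_smooth hs i).of_le (top_le_nat l))]
  · intro i _
    exact (contDiffAt_const.mul ((hA i).contDiffAt.mul (hW i).contDiffAt)).of_le (top_le_nat j)

lemma vn_bound (σ : ℝ) (χ : ℝ → ℝ) (hs : ContDiff ℝ (⊤ : ℕ∞) χ)
    (hχ0 : ∀ z : ℝ, 2 ≤ z → χ z = 0) (C : ℕ → ℝ) (hC : ∀ k, 0 < C k) :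
    ∃ K : ℕ → ℕ → ℝ, (∀ j k, 0 ≤ K j k) ∧
      ∀ ε : ℝ, 0 < ε → ε ≤ 1 → ∀ vp : ℝ → ℝ → ℝ, SM vp →
      (∀ k j : ℕ, j ≤ 2 → ∀ x : ℝ, 1 ≤ x → ∀ y : ℝ, 0 ≤ y →
        |iteratedDeriv j (fun y' => iteratedDeriv k (fun x' => vp x' y') x) y|
          ≤ C k * x ^ (-(k : ℝ) - 1 - j / 2 + σ)) →
      ∀ k j : ℕ, j ≤ 2 → ∀ x : ℝ, 1 ≤ x → ∀ y : ℝ, 0 ≤ y →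
        |iteratedDeriv j (fun y' => iteratedDeriv k
          (fun x' => χ (√ε * y' / √x') * vp x' y') x) y|
          ≤ K j k * x ^ (-(k : ℝ) - 1 - j / 2 + σ) := by
  obtain ⟨M, hM0, hM⟩ := phi_bdd hs hχ0
  refine ⟨fun j k => ∑ i ∈ Finset.range (k + 1), (k.choose i : ℝ) *
      ∑ l ∈ Finset.range (j + 1), (j.choose l : ℝ) * M i l * C (k - i), ?_, ?_⟩
  · intro j k
    refine Finset.sum_nonneg fun i _ => mul_nonneg (by positivity)
      (Finset.sum_nonneg fun l _ => mul_nonneg (mul_nonneg (by positivity) (hM0 _ _)) (hC _).le)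
  intro ε hε0 hε1 vp hvp hb k j hj x hx y hy
  have hx0 : 0 < x := by linarith
  have hsx : 0 < √x := Real.sqrt_pos.2 hx0
  rw [vn_formula hs ε hvp j k hx0 y, Finset.sum_mul]
  refine (Finset.abs_sum_le_sum_abs _ _).trans (Finset.sum_le_sum fun i hi => ?_)
  have hik : i ≤ k := Nat.lt_succ_iff.1 (Finset.mem_range.1 hi)
  rw [abs_mul, abs_of_nonneg (by positivity : 0 ≤ (k.choose i : ℝ) * (x⁻¹) ^ i), mul_assoc,
    mul_assoc]
  refine mul_le_mul_of_nonneg_left ?_ (by positivity)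
  rw [Finset.sum_mul]
  refine (mul_le_mul_of_nonneg_left (Finset.abs_sum_le_sum_abs _ _) (by positivity)).trans ?_
  rw [Finset.mul_sum]
  refine Finset.sum_le_sum fun l hl => ?_
  have hlj : l ≤ j := Nat.lt_succ_iff.1 (Finset.mem_range.1 hl)
  have h1 := hM i l ((√ε / √x) * y) (by positivity)
  have h2 := hb (k - i) (j - l) (by omega) x hx y hy
  have h3 : (√ε / √x) ^ l ≤ x ^ (-(l : ℝ) / 2) := by
    have : √ε / √x ≤ x ^ (-(1 : ℝ) / 2) := by
      rw [neg_div, Real.rpow_neg hx0.le, ← Real.sqrt_eq_rpow, div_eq_mul_inv]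
      have : √ε ≤ 1 := Real.sqrt_le_one.2 hε1
      exact mul_le_of_le_one_left (by positivity) this
    calc (√ε / √x) ^ l ≤ (x ^ (-(1 : ℝ) / 2)) ^ l := pow_le_pow_left₀ (by positivity) this l
      _ = x ^ (-(l : ℝ) / 2) := by
        rw [← Real.rpow_natCast, ← Real.rpow_mul hx0.le]; congr 1; ring
  have h4 : (x⁻¹) ^ i = x ^ (-(i : ℝ)) := by
    rw [Real.rpow_neg hx0.le, Real.rpow_natCast, inv_pow]
  rw [abs_mul, abs_mul, abs_mul, abs_of_nonneg (by positivity : 0 ≤ (j.choose l : ℝ)),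
    abs_of_nonneg (by positivity : 0 ≤ (√ε / √x) ^ l), h4]
  have hM' := hM0 i l
  have hC' := (hC (k - i)).le
  calc x ^ (-(i : ℝ)) * ((j.choose l : ℝ) * ((√ε / √x) ^ l *
        |iteratedDeriv l (phi χ i) (√ε / √x * y)|) *
        |iteratedDeriv (j - l) (fun y' => iteratedDeriv (k - i) (fun x' => vp x' y') x) y|)
      ≤ x ^ (-(i : ℝ)) * ((j.choose l : ℝ) * (x ^ (-(l : ℝ) / 2) * M i l) *
        (C (k - i) * x ^ (-((k - i : ℕ) : ℝ) - 1 - ((j - l : ℕ) : ℝ) / 2 + σ))) := by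
        gcongr
    _ = (j.choose l : ℝ) * M i l * C (k - i) * (x ^ (-(i : ℝ)) * x ^ (-(l : ℝ) / 2) *
        x ^ (-((k - i : ℕ) : ℝ) - 1 - ((j - l : ℕ) : ℝ) / 2 + σ)) := by ring
    _ = (j.choose l : ℝ) * M i l * C (k - i) * x ^ (-(k : ℝ) - 1 - j / 2 + σ) := by
        rw [← Real.rpow_add hx0, ← Real.rpow_add hx0, Nat.cast_sub hik, Nat.cast_sub hlj]
        congr 2
        ring

lemma un_integrable {F : ℝ → ℝ → ℝ} (hF : SM F) {A r : ℝ} (hr : r < -1) {y : ℝ}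
    (hb : ∀ x : ℝ, 1 ≤ x → |F x y| ≤ A * x ^ r) {x : ℝ} (hx : 0 < x) :
    IntegrableOn (fun x' => F x' y) (Set.Ioi x) := by
  have hc : ContinuousOn (fun x' => F x' y) (Set.Ioi 0) := fun a ha =>
    (hF.slice_x ha y).continuousAt.continuousWithinAt
  have h1 : IntegrableOn (fun x' => F x' y) (Set.Ioi 1) := by
    refine Integrable.mono' ((integrableOn_Ioi_rpow_of_lt hr one_pos).const_mul A)
      ((hc.mono (Set.Ioi_subset_Ioi zero_le_one)).aestronglyMeasurable measurableSet_Ioi) ?_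
    filter_upwards [ae_restrict_mem measurableSet_Ioi] with a ha
    exact hb a (le_of_lt ha)
  have h2 : IntegrableOn (fun x' => F x' y) (Set.Icc x 1) :=
    (hc.mono (fun a ha => lt_of_lt_of_le hx ha.1)).integrableOn_compact isCompact_Icc
  refine (h2.union h1).mono_set fun a ha => ?_
  by_cases h : a ≤ 1
  · exact Or.inl ⟨le_of_lt ha, h⟩
  · exact Or.inr (not_le.1 h)

lemma un_hasDeriv {F : ℝ → ℝ → ℝ} (hF : SM F) {y : ℝ}
    (hi : ∀ x : ℝ, 0 < x → IntegrableOn (fun x' => F x' y) (Set.Ioi x)) {x : ℝ} (hx : 0 < x) :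
    HasDerivAt (fun x => ∫ x' in Set.Ioi x, F x' y) (-F x y) x := by
  have hc : ContinuousOn (fun x' => F x' y) (Set.Ioi 0) := fun a ha =>
    (hF.slice_x ha y).continuousAt.continuousWithinAt
  have e : (fun x => ∫ x' in Set.Ioi x, F x' y) =ᶠ[nhds x]
      fun x => (∫ x' in Set.Ioi 1, F x' y) - ∫ x' in (1 : ℝ)..x, F x' y := by
    filter_upwards [lt_mem_nhds hx] with a ha
    rw [← intervalIntegral.integral_interval_add_Ioi (hi 1 one_pos) (hi a ha)]
    ring
  refine HasDerivAt.congr_of_eventuallyEq ?_ e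
  refine (intervalIntegral.integral_hasDerivAt_right ?_ ?_ ?_).const_sub _
  · refine ContinuousOn.intervalIntegrable (hc.mono fun a ha => ?_)
    exact lt_of_lt_of_le (lt_min one_pos hx) ha.1
  · exact hc.stronglyMeasurableAtFilter isOpen_Ioi x hx
  · exact (hF.slice_x hx y).continuousAt

lemma int_bound_s16 {f : ℝ → ℝ} {A r x : ℝ} (hr : r < -1) (hx : 0 < x)
    (hb : ∀ x' : ℝ, x < x' → |f x'| ≤ A * x' ^ r) :
    |∫ x' in Set.Ioi x, f x'| ≤ A / (-(r + 1)) * x ^ (r + 1) := by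
  have h := norm_integral_le_of_norm_le (μ := volume.restrict (Set.Ioi x)) (f := f)
    ((integrableOn_Ioi_rpow_of_lt hr hx).const_mul A) (by
      filter_upwards [ae_restrict_mem measurableSet_Ioi] with a ha
      exact hb a ha)
  rw [integral_const_mul, integral_Ioi_rpow_of_lt hr hx] at h
  refine h.trans (le_of_eq ?_)
  have : r + 1 ≠ 0 := by linarith
  rw [div_neg]
  field_simp

lemma mvt_right {f : ℝ → ℝ} (hf : Differentiable ℝ f) {B y z : ℝ} (hy : 0 ≤ y) (hz : y < z)
    (hb : ∀ a, 0 ≤ a → |deriv f a| ≤ B) : |f z - f y| ≤ B * (z - y) := by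
  have := (convex_Ici (0 : ℝ)).norm_image_sub_le_of_norm_deriv_le (f := f) (C := B)
    (fun a _ => hf a) (fun a ha => hb a ha) (Set.mem_Ici.2 hy) (Set.mem_Ici.2 (hy.trans hz.le))
  rwa [Real.norm_eq_abs, Real.norm_eq_abs, abs_of_pos (sub_pos.2 hz)] at this

theorem stmt16 (σ : ℝ) (hσ0 : 0 < σ) (hσ1 : σ < 1/2)
    (χ : ℝ → ℝ) (hχs : ContDiff ℝ (⊤ : ℕ∞) χ) (hχrange : ∀ z : ℝ, 0 ≤ χ z ∧ χ z ≤ 1)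
    (hχ1 : ∀ z : ℝ, z ≤ 1 → χ z = 1) (hχ0 : ∀ z : ℝ, 2 ≤ z → χ z = 0)
    (C : ℕ → ℝ) (hC : ∀ k, 0 < C k) :
    ∃ C' : ℕ → ℝ, (∀ k, 0 < C' k) ∧
      ∀ ε : ℝ, 0 < ε → ε ≤ 1 →
      ∀ vp : ℝ → ℝ → ℝ, ContDiff ℝ (⊤ : ℕ∞) (fun p : ℝ × ℝ => vp p.1 p.2) →
        (∀ k : ℕ, ∀ x : ℝ, 1 ≤ x → ∀ y : ℝ, 0 ≤ y →
          |iteratedDeriv k (fun x' => vp x' y) x| ≤ C k * x ^ (-(k:ℝ) - 1 + σ)) →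
        (∀ k : ℕ, ∀ x : ℝ, 1 ≤ x → ∀ y : ℝ, 0 ≤ y →
          |deriv (fun y' => iteratedDeriv k (fun x' => vp x' y') x) y|
            ≤ C k * x ^ (-(k:ℝ) - 3/2 + σ)) →
        (∀ k : ℕ, ∀ x : ℝ, 1 ≤ x → ∀ y : ℝ, 0 ≤ y →
          |iteratedDeriv 2 (fun y' => iteratedDeriv k (fun x' => vp x' y') x) y|
            ≤ C k * x ^ (-(k:ℝ) - 2 + σ)) →
        ∀ vn un : ℝ → ℝ → ℝ,
          (∀ x y : ℝ, vn x y = χ (Real.sqrt ε * y / Real.sqrt x) * vp x y) →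
          (∀ x y : ℝ, un x y =
            ∫ x' in Set.Ioi x,
              deriv (fun y' => χ (Real.sqrt ε * y' / Real.sqrt x') * vp x' y') y) →
          (∀ x : ℝ, 1 ≤ x → ∀ y : ℝ, 0 ≤ y →
            IntegrableOn
              (fun x' => deriv (fun y' => χ (Real.sqrt ε * y' / Real.sqrt x') * vp x' y') y)
              (Set.Ioi x)) ∧
          (∀ x : ℝ, 1 ≤ x → ∀ y : ℝ, 0 ≤ y →
            deriv (fun x' => un x' y) x + deriv (fun y' => vn x y') y = 0) ∧
          (∀ k : ℕ, ∀ x : ℝ, 1 ≤ x → ∀ y : ℝ, 0 ≤ y →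
            |iteratedDeriv k (fun x' => vn x' y) x| ≤ C' k * x ^ (-(k:ℝ) - 1 + σ) ∧
            |deriv (fun y' => iteratedDeriv k (fun x' => vn x' y') x) y|
              ≤ C' k * x ^ (-(k:ℝ) - 3/2 + σ) ∧
            |deriv (fun y' => iteratedDeriv k (fun x' => un x' y') x) y|
              ≤ C' k * x ^ (-(k:ℝ) - 1 + σ) ∧
            |iteratedDeriv k (fun x' => un x' y) x| ≤ C' k * x ^ (-(k:ℝ) - 1/2 + σ)) := by
  obtain ⟨K, hK0, hK⟩ := vn_bound σ χ hχs hχ0 C hC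
  have hd1 : 0 < 1 / 2 - σ := by linarith
  have hd2 : 0 < 1 - σ := by linarith
  have p0 := fun k => hK0 0 k
  have p1 := fun k => hK0 1 k
  have p2 := fun k => hK0 2 k
  have p3 : 0 ≤ K 1 0 / (1 / 2 - σ) := div_nonneg (p1 0) hd1.le
  have p4 : 0 ≤ K 2 0 / (1 - σ) := div_nonneg (p2 0) hd2.le
  refine ⟨fun k => 1 + K 0 k + K 1 k + K 1 (k - 1) + K 2 (k - 1) +
    K 1 0 / (1 / 2 - σ) + K 2 0 / (1 - σ), ?_, ?_⟩
  · intro k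
    have := p0 k; have := p1 k; have := p1 (k - 1); have := p2 (k - 1)
    positivity
  intro ε hε0 hε1 vp hvp h0 h1 h2 vn un hvn hun
  have hSvp := SM_of_contDiff hvp
  have hS : SM vn := (SM_vn hχs ε hSvp).congr fun x _ y => hvn x y
  have evn : vn = fun x y => χ (√ε * y / √x) * vp x y := by funext x y; exact hvn x y
  have hB := hK ε hε0 hε1 vp hSvp (by
    intro k j hj x hx y hy
    interval_cases j
    · simpa using h0 k x hx y hy
    · have := h1 k x hx y hy
      rw [iteratedDeriv_one]
      convert this using 3
      push_cast; ring
    · have := h2 k x hx y hy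
      convert this using 3
      push_cast; ring)
  have b0 : ∀ k : ℕ, ∀ x : ℝ, 1 ≤ x → ∀ y : ℝ, 0 ≤ y →
      |iteratedDeriv k (fun x' => vn x' y) x| ≤ K 0 k * x ^ (-(k : ℝ) - 1 + σ) := by
    intro k x hx y hy
    have := hB k 0 (by norm_num) x hx y hy
    simpa [evn] using this
  have b1 : ∀ k : ℕ, ∀ x : ℝ, 1 ≤ x → ∀ y : ℝ, 0 ≤ y →
      |deriv (fun y' => iteratedDeriv k (fun x' => vn x' y') x) y|
        ≤ K 1 k * x ^ (-(k : ℝ) - 3 / 2 + σ) := by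
    intro k x hx y hy
    have := hB k 1 (by norm_num) x hx y hy
    rw [iteratedDeriv_one] at this
    rw [evn]
    convert this using 3
    push_cast; ring
  have b2 : ∀ k : ℕ, ∀ x : ℝ, 1 ≤ x → ∀ y : ℝ, 0 ≤ y →
      |deriv (deriv (fun y' => iteratedDeriv k (fun x' => vn x' y') x)) y|
        ≤ K 2 k * x ^ (-(k : ℝ) - 2 + σ) := by
    intro k x hx y hy
    have := hB k 2 (by norm_num) x hx y hy
    rw [iteratedDeriv_succ, iteratedDeriv_one] at this
    rw [evn]
    convert this using 3
    push_cast; ring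
  clear hB
  -- the integrand
  obtain ⟨G, hG⟩ : ∃ G : ℝ → ℝ → ℝ, G = fun x y => deriv (fun y' => vn x y') y := ⟨_, rfl⟩
  have hGS : SM G := by rw [hG]; exact hS.dy
  have eG : ∀ y, (fun x' => deriv (fun y' => χ (√ε * y' / √x') * vp x' y') y) =
      fun x' => G x' y := by
    intro y; rw [hG, evn]
  have eun : ∀ y, (fun x => un x y) = fun x => ∫ x' in Set.Ioi x, G x' y := by
    intro y; funext x; rw [hun, eG]
  have bG : ∀ x : ℝ, 1 ≤ x → ∀ y : ℝ, 0 ≤ y → |G x y| ≤ K 1 0 * x ^ (-3 / 2 + σ) := by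
    intro x hx y hy
    have := b1 0 x hx y hy
    simp only [iteratedDeriv_zero] at this
    have e : -((0 : ℕ) : ℝ) - 3 / 2 + σ = -3 / 2 + σ := by push_cast; ring
    rw [e] at this
    rw [hG]
    exact this
  have bGy : ∀ x : ℝ, 1 ≤ x → ∀ y : ℝ, 0 ≤ y →
      |deriv (fun y' => G x y') y| ≤ K 2 0 * x ^ (-2 + σ) := by
    intro x hx y hy
    have := b2 0 x hx y hy
    simp only [iteratedDeriv_zero] at this
    have e : -((0 : ℕ) : ℝ) - 2 + σ = -2 + σ := by push_cast; ring
    rw [e] at this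
    rw [hG]
    exact this
  have hint : ∀ y : ℝ, 0 ≤ y → ∀ x : ℝ, 0 < x → IntegrableOn (fun x' => G x' y) (Set.Ioi x) :=
    fun y hy x hx => un_integrable hGS (by linarith : -3 / 2 + σ < -1)
      (fun x hx => bG x hx y hy) hx
  have hder : ∀ y : ℝ, 0 ≤ y → ∀ x : ℝ, 0 < x → HasDerivAt (fun x => un x y) (-G x y) x := by
    intro y hy x hx
    rw [eun y]
    exact un_hasDeriv hGS (hint y hy) hx
  have hsucc : ∀ (k : ℕ) (y : ℝ), 0 ≤ y → ∀ x : ℝ, 0 < x →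
      iteratedDeriv (k + 1) (fun x' => un x' y) x =
        - deriv (fun y' => iteratedDeriv k (fun x' => vn x' y') x) y := by
    intro k y hy x hx
    rw [iteratedDeriv_succ']
    have e : deriv (fun x' => un x' y) =ᶠ[nhds x] fun x' => - G x' y := by
      filter_upwards [lt_mem_nhds hx] with a ha
      exact (hder y hy a ha).deriv
    rw [e.iteratedDeriv_eq, iteratedDeriv_fun_neg, hG]
    exact congrArg _ (hS.swap_it k hx y)
  refine ⟨fun x hx y hy => ?_, fun x hx y hy => ?_, fun k x hx y hy => ?_⟩
  · rw [eG]; exact hint y hy x (by linarith)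
  · rw [(hder y hy x (by linarith)).deriv, hG]; simp
  have hx0 : 0 < x := by linarith
  have q0 := p0 k
  have q1 := p1 k
  have q2 := p1 (k - 1)
  have q3 := p2 (k - 1)
  refine ⟨?_, ?_, ?_, ?_⟩
  · refine (b0 k x hx y hy).trans ?_
    gcongr
    linarith
  · refine (b1 k x hx y hy).trans ?_
    gcongr
    linarith
  · refine deriv_le_of_right (by positivity) fun z hz => ?_
    have hz0 : 0 ≤ z := hy.trans hz.le
    have hzy : 0 ≤ z - y := by linarith
    rcases k with _ | k
    · simp only [iteratedDeriv_zero]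
      have ez : un x z - un x y = ∫ x' in Set.Ioi x, (G x' z - G x' y) := by
        rw [integral_sub (hint z hz0 x hx0) (hint y hy x hx0), ← congrFun (eun z) x,
          ← congrFun (eun y) x]
      have hb : |un x z - un x y| ≤ (K 2 0 * (z - y)) / (-(-2 + σ + 1)) * x ^ (-2 + σ + 1) := by
        rw [ez]
        refine int_bound_s16 (by linarith) hx0 fun a ha => ?_
        have := mvt_right (f := fun y' => G a y')
          ((hGS.slice_y (by linarith)).differentiable (by simp)) hy hz
          (fun b hb => bGy a (by linarith) b hb)
        refine this.trans (le_of_eq (by ring))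
      refine hb.trans ?_
      have e2 : (-2 + σ + 1) = -((0 : ℕ) : ℝ) - 1 + σ := by push_cast; ring
      have e3 : -(-2 + σ + 1) = 1 - σ := by ring
      rw [e3, e2]
      calc K 2 0 * (z - y) / (1 - σ) * x ^ (-((0 : ℕ) : ℝ) - 1 + σ)
          = K 2 0 / (1 - σ) * x ^ (-((0 : ℕ) : ℝ) - 1 + σ) * (z - y) := by ring
        _ ≤ _ := by
          gcongr
          linarith
    · rw [hsucc k z hz0 x hx0, hsucc k y hy x hx0]
      have hsm : ContDiff ℝ (⊤ : ℕ∞)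
          (fun y => deriv (fun y' => iteratedDeriv k (fun x' => vn x' y') x) y) :=
        (hS.itx k).dy.slice_y hx0
      have := mvt_right (hsm.differentiable (by simp)) hy hz (fun b hb => b2 k x hx b hb)
      rw [neg_sub_neg, abs_sub_comm]
      refine this.trans ?_
      have e2 : -(k : ℝ) - 2 + σ = -((k + 1 : ℕ) : ℝ) - 1 + σ := by push_cast; ring
      rw [e2]
      gcongr
      simp only [Nat.add_sub_cancel] at *
      linarith
  · rcases k with _ | k
    · simp only [iteratedDeriv_zero]
      rw [congrFun (eun y) x]
      have hb := int_bound_s16 (f := fun x' => G x' y) (by linarith : -3 / 2 + σ < -1) hx0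
        (fun a ha => bG a (by linarith) y hy)
      refine hb.trans ?_
      have e2 : (-3 / 2 + σ + 1) = -((0 : ℕ) : ℝ) - 1 / 2 + σ := by push_cast; ring
      have e3 : -(-3 / 2 + σ + 1) = 1 / 2 - σ := by ring
      rw [e3, e2]
      gcongr
      linarith
    · rw [hsucc k y hy x hx0, abs_neg]
      refine (b1 k x hx y hy).trans ?_
      have e2 : -(k : ℝ) - 3 / 2 + σ = -((k + 1 : ℕ) : ℝ) - 1 / 2 + σ := by push_cast; ring
      rw [e2]
      gcongr
      simp only [Nat.add_sub_cancel] at *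
      linarith
end
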